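/- Under Assumptions A1, A2, A3 (fractional-linear BPRE), for any fixed t ∈ (0,1), as n → ∞ the conditional law of Y_t^{(n)} := Z_{⌊nt⌋} e^{−S_{⌊nt⌋}} given T = n+1 converges weakly to the law of a random variable W which is almost surely strictly positive and finite: the limiting Laplace transform H*(λ) = E e^{−λW} satisfies lim_{λ→∞} H*(λ) = 0 (no atom at zero) and lim_{λ↓0} H*(λ) = 1 (no atom at infinity). -/

import Mathlib

open MeasureTheory ProbabilityTheory Filter Set Topology

noncomputable section

namespace BPREpaper

variable {Ω : Type*} [MeasurableSpace Ω]

/-- The random walk `S n = X 1 + ... + X n` (increments indexed from `1`, `S 0 = 0`). -/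
def walk (X : ℕ → Ω → ℝ) (n : ℕ) (ω : Ω) : ℝ := ∑ i ∈ Finset.Icc 1 n, X i ω

/-- `Mwalk X n = max (S 1, ..., S n)` for `n ≥ 1` (junk value `0` for `n = 0`). -/
def Mwalk (X : ℕ → Ω → ℝ) : ℕ → Ω → ℝ
  | 0, _ => 0
  | n + 1, ω =>
      (Finset.Icc 1 (n + 1)).sup' (Finset.nonempty_Icc.mpr (by omega)) fun i => walk X i ω

/-- `Lwalk X n = min (S 1, ..., S n)` for `n ≥ 1` (junk value `0` for `n = 0`). -/
def Lwalk (X : ℕ → Ω → ℝ) : ℕ → Ω → ℝ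
  | 0, _ => 0
  | n + 1, ω =>
      (Finset.Icc 1 (n + 1)).inf' (Finset.nonempty_Icc.mpr (by omega)) fun i => walk X i ω

/-- minimum of `S 0, S 1, ..., S n`. -/
def minWalk (X : ℕ → Ω → ℝ) (n : ℕ) (ω : Ω) : ℝ :=
  (Finset.range (n + 1)).inf' (by simp) fun i => walk X i ω

/-- `τ(n)`: the first moment at which the minimum of `S 0, ..., S n` is attained. -/
def tauWalk (X : ℕ → Ω → ℝ) (n : ℕ) (ω : Ω) : ℕ :=
  sInf {i : ℕ | walk X i ω = minWalk X n ω}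

/-- The renewal function `u(x) = 1 + ∑_{k ≥ 1} P(-S_k ≤ x, M_k < 0)` for `x ≥ 0`,
`u(x) = 0` for `x < 0`. -/
def uFun (μ : Measure Ω) (X : ℕ → Ω → ℝ) (x : ℝ) : ℝ :=
  if 0 ≤ x then
    1 + ∑' k : ℕ, (μ {ω | -walk X (k + 1) ω ≤ x ∧ Mwalk X (k + 1) ω < 0}).toReal
  else 0

/-- The renewal function `v(x) = 1 + ∑_{k ≥ 1} P(-S_k > x, L_k ≥ 0)` for `x ≤ 0`,
`v(x) = 0` for `x > 0`. -/
def vFun (μ : Measure Ω) (X : ℕ → Ω → ℝ) (x : ℝ) : ℝ :=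
  if x ≤ 0 then
    1 + ∑' k : ℕ, (μ {ω | x < -walk X (k + 1) ω ∧ 0 ≤ Lwalk X (k + 1) ω}).toReal
  else 0

/-- The event `{∀ 1 ≤ i ≤ n, x + S_i ≥ 0} = {L_n ≥ 0}` for the walk started at `x`. -/
def posSet (X : ℕ → Ω → ℝ) (x : ℝ) (n : ℕ) : Set Ω :=
  {ω | ∀ i ∈ Finset.Icc 1 n, 0 ≤ x + walk X i ω}

/-- The event `{∀ 1 ≤ i ≤ n, x + S_i < 0} = {M_n < 0}` for the walk started at `x`. -/
def negSet (X : ℕ → Ω → ℝ) (x : ℝ) (n : ℕ) : Set Ω :=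
  {ω | ∀ i ∈ Finset.Icc 1 n, x + walk X i ω < 0}

/-- A distribution on `ℝ` is non-lattice: it is not concentrated on any arithmetic
progression `a + hℤ`. -/
def NonLattice (ν : Measure ℝ) : Prop :=
  ¬ ∃ a h : ℝ, ν {x | ∃ k : ℤ, x = a + k * h} = 1

/-- `ν` is an `α`-stable law on `ℝ`. -/
def IsStableLaw (α : ℝ) (ν : Measure ℝ) : Prop :=
  ∀ a b : ℝ, 0 < a → 0 < b → ∃ c d : ℝ, 0 < c ∧ a ^ α + b ^ α = c ^ α ∧
    ((ν.map (fun x => a * x)).prod (ν.map (fun x => b * x))).map (fun p : ℝ × ℝ => p.1 + p.2)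
      = ν.map (fun x => c * x + d)

/-- Weak convergence of a sequence of laws on `ℝ`, tested against bounded continuous
functions. -/
def WeakTendsto (μs : ℕ → Measure ℝ) (ν : Measure ℝ) : Prop :=
  ∀ g : BoundedContinuousFunction ℝ ℝ,
    Tendsto (fun n => ∫ x, g x ∂(μs n)) atTop (𝓝 (∫ x, g x ∂ν))

/-- Assumption A4: there are norming constants `c n → ∞` such that `S n / c n` converges in
distribution to an `α`-stable law concentrated neither on `[0,∞)` nor on `(-∞,0]`; the
increment distribution is non-lattice. -/
def AssumptionA4 (μ : Measure Ω) (X : ℕ → Ω → ℝ) (c : ℕ → ℝ) : Prop :=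
  Tendsto c atTop atTop ∧ NonLattice (μ.map (X 1)) ∧
    ∃ (α : ℝ) (ν : Measure ℝ), IsProbabilityMeasure ν ∧ IsStableLaw α ν ∧
      0 < ν (Set.Iio 0) ∧ 0 < ν (Set.Ioi 0) ∧
      WeakTendsto (fun n => μ.map fun ω => walk X n ω / c n) ν

/-- A family of random elements indexed by `ι` which is i.i.d. (the common distribution
being that of the element with index `i0`). -/
def IIDfam {ι : Type*} {E : Type*} [MeasurableSpace E] (μ : Measure Ω) (Q : ι → Ω → E)
    (i0 : ι) : Prop :=
  (∀ i, Measurable (Q i)) ∧ iIndepFun Q μ ∧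
    ∀ i, IdentDistrib (Q i) (Q i0) μ μ

/-- An i.i.d. sequence indexed by `ℕ` (indices from `1` are the relevant ones). -/
def IIDseq {E : Type*} [MeasurableSpace E] (μ : Measure Ω) (Q : ℕ → Ω → E) : Prop :=
  IIDfam μ Q 1

/-- `P` is the h-transform measure `P_x⁺`: for every `n` and every bounded
`F n`-measurable `g`, `E_P[g] = u(x)⁻¹ E_x[g · u(S_n); L_n ≥ 0]`. -/
def IsPplus (μ : Measure Ω) (X : ℕ → Ω → ℝ) (F : ℕ → MeasurableSpace Ω) (x : ℝ)
    (P : Measure Ω) : Prop :=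
  IsProbabilityMeasure P ∧
    ∀ (n : ℕ) (g : Ω → ℝ), Measurable[F n] g → (∃ C, ∀ ω, |g ω| ≤ C) →
      ∫ ω, g ω ∂P =
        (uFun μ X x)⁻¹ * ∫ ω in posSet X x n, g ω * uFun μ X (x + walk X n ω) ∂μ

/-- `P` is the h-transform measure `P_x⁻`: for every `n` and every bounded
`F n`-measurable `g`, `E_P[g] = v(x)⁻¹ E_x[g · v(S_n); M_n < 0]`. -/
def IsPminus (μ : Measure Ω) (X : ℕ → Ω → ℝ) (F : ℕ → MeasurableSpace Ω) (x : ℝ)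
    (P : Measure Ω) : Prop :=
  IsProbabilityMeasure P ∧
    ∀ (n : ℕ) (g : Ω → ℝ), Measurable[F n] g → (∃ C, ∀ ω, |g ω| ≤ C) →
      ∫ ω, g ω ∂P =
        (vFun μ X x)⁻¹ * ∫ ω in negSet X x n, g ω * vFun μ X (x + walk X n ω) ∂μ

/-- The filtration generated by the environment `Q 1, ..., Q n`. -/
def envFiltration {E : Type*} [MeasurableSpace E] (Q : ℕ → Ω → E) (n : ℕ) :
    MeasurableSpace Ω :=
  ⨆ i ∈ Finset.Icc 1 n, MeasurableSpace.comap (Q i) inferInstance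

/-- The σ-algebra generated by the whole environment `Q 1, Q 2, ...`. -/
def envSigma {E : Type*} [MeasurableSpace E] (Q : ℕ → Ω → E) : MeasurableSpace Ω :=
  ⨆ i, MeasurableSpace.comap (Q (i + 1)) inferInstance




/-- Probability generating function of the (random) offspring law `Q n`. -/
def pgf (Q : ℕ → Ω → Measure ℕ) (n : ℕ) (ω : Ω) (s : ℝ) : ℝ :=
  ∑' i : ℕ, (Q n ω {i}).toReal * s ^ i

/-- Mean `m(Q_n)` of the offspring law `Q n`. -/
def meanQ (Q : ℕ → Ω → Measure ℕ) (n : ℕ) (ω : Ω) : ℝ :=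
  ∑' i : ℕ, (i : ℝ) * (Q n ω {i}).toReal

/-- `X_n = log f_n'(1)`, the increments of the associated random walk. -/
def Xenv (Q : ℕ → Ω → Measure ℕ) (n : ℕ) (ω : Ω) : ℝ := Real.log (meanQ Q n ω)

/-- `η_n = f_n''(1) / (2 f_n'(1)^2)`. -/
def etaEnv (Q : ℕ → Ω → Measure ℕ) (n : ℕ) (ω : Ω) : ℝ :=
  (∑' i : ℕ, ((i : ℝ) * ((i : ℝ) - 1)) * (Q n ω {i}).toReal) / (2 * meanQ Q n ω ^ 2)

/-- The associated random walk `S_n = X_1 + ... + X_n`. -/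
def Senv (Q : ℕ → Ω → Measure ℕ) : ℕ → Ω → ℝ := walk (Xenv Q)

/-- The composition `f_{j,n}(s) = f_{j+1}(f_{j+2}(⋯ f_n(s) ⋯))`, with `f_{j,n} = id` for
`n ≤ j`. -/
def pgfComp (Q : ℕ → Ω → Measure ℕ) (j : ℕ) : ℕ → Ω → ℝ → ℝ
  | 0, _, s => s
  | n + 1, ω, s => if n + 1 ≤ j then s else pgfComp Q j n ω (pgf Q (n + 1) ω s)

/-- `b_n = ∑_{i=0}^{n-1} η_{i+1} e^{-S_i}`. -/
def bEnv (Q : ℕ → Ω → Measure ℕ) (n : ℕ) (ω : Ω) : ℝ :=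
  ∑ i ∈ Finset.range n, etaEnv Q (i + 1) ω * Real.exp (-(Senv Q i ω))

/-- `B⁺ = ∑_{i=0}^∞ η_{i+1} e^{-S_i}`. -/
def Bplus (Q : ℕ → Ω → Measure ℕ) (ω : Ω) : ℝ :=
  ∑' i : ℕ, etaEnv Q (i + 1) ω * Real.exp (-(Senv Q i ω))

/-- `B⁻ = ∑_{i=1}^∞ η_i e^{S_i}`. -/
def Bminus (Q : ℕ → Ω → Measure ℕ) (ω : Ω) : ℝ :=
  ∑' i : ℕ, etaEnv Q (i + 1) ω * Real.exp (Senv Q (i + 1) ω)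

/-- `V_∞(r) = 1 / (B⁻ + (1 - r)⁻¹)`. -/
def Vinf (Q : ℕ → Ω → Measure ℕ) (r : ℝ) (ω : Ω) : ℝ := (Bminus Q ω + (1 - r)⁻¹)⁻¹

/-- All the offspring generating functions are fractional linear:
`1/(1 - f_n(s)) = e^{-X_n}/(1-s) + η_n`. -/
def FracLinear (Q : ℕ → Ω → Measure ℕ) : Prop :=
  ∀ n, 1 ≤ n → ∀ ω : Ω, ∀ s : ℝ, 0 ≤ s → s < 1 →
    (1 - pgf Q n ω s)⁻¹ = Real.exp (-(Xenv Q n ω)) / (1 - s) + etaEnv Q n ω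

/-- Assumption A1 with explicit constant `χ`. -/
def AssumptionA1With (μ : Measure Ω) (Q : ℕ → Ω → Measure ℕ) (χ : ℝ) : Prop :=
  0 < χ ∧ χ < 1 / 2 ∧ ∀ n, 1 ≤ n →
    ∀ᵐ ω ∂μ, χ ≤ pgf Q n ω 0 ∧ pgf Q n ω 0 ≤ 1 - χ ∧ χ ≤ etaEnv Q n ω

/-- Assumption A1: for some `χ ∈ (0,1/2)`, `χ ≤ f(0) ≤ 1 - χ` and `η ≥ χ` a.s. -/
def AssumptionA1 (μ : Measure Ω) (Q : ℕ → Ω → Measure ℕ) : Prop :=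
  ∃ χ : ℝ, AssumptionA1With μ Q χ

/-- Assumption A2: `X` has zero mean, finite positive variance and is non-lattice. -/
def AssumptionA2 (μ : Measure Ω) (Q : ℕ → Ω → Measure ℕ) : Prop :=
  Integrable (Xenv Q 1) μ ∧ (∫ ω, Xenv Q 1 ω ∂μ) = 0 ∧
    Integrable (fun ω => Xenv Q 1 ω ^ 2) μ ∧ 0 < ∫ ω, Xenv Q 1 ω ^ 2 ∂μ ∧
    NonLattice (μ.map (Xenv Q 1))

/-- `ζ(a) = ∑_{y ≥ a} y² Q({y}) / m(Q)²`. -/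
def zetaEnv (Q : ℕ → Ω → Measure ℕ) (a : ℕ) (ω : Ω) : ℝ :=
  (∑' y : ℕ, if a ≤ y then (y : ℝ) ^ 2 * (Q 1 ω {y}).toReal else 0) / meanQ Q 1 ω ^ 2

/-- Assumption A3: `E[(log⁺ ζ(a))^{2+ε}] < ∞` for some `ε > 0`, `a ∈ ℕ`. -/
def AssumptionA3 (μ : Measure Ω) (Q : ℕ → Ω → Measure ℕ) : Prop :=
  ∃ ε : ℝ, 0 < ε ∧ ∃ a : ℕ, 1 ≤ a ∧
    Integrable (fun ω => Real.log (max (zetaEnv Q a ω) 1) ^ (2 + ε)) μ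

/-- The extinction moment `T = min {k ≥ 0 : Z_k = 0}`. -/
def extinctTime (Z : ℕ → Ω → ℕ) (ω : Ω) : ℕ := sInf {k | Z k ω = 0}

/-- The branching property of `Z` in the environment `Q` (started from one particle):
given the environment and `Z_k`, the conditional generating function of `Z_n` is
`f_{k,n}(s)^{Z_k}`; the state `0` is absorbing. -/
def BranchingProperty (μ : Measure Ω) (Q : ℕ → Ω → Measure ℕ) (Z : ℕ → Ω → ℕ) : Prop :=
  (∀ ω, Z 0 ω = 1) ∧ (∀ n, Measurable (Z n)) ∧ (∀ n ω, Z n ω = 0 → Z (n + 1) ω = 0) ∧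
    ∀ k n : ℕ, k ≤ n → ∀ s : ℝ, 0 ≤ s → s ≤ 1 →
      (μ[fun ω => s ^ Z n ω | envSigma Q ⊔ MeasurableSpace.comap (Z k) inferInstance])
        =ᵐ[μ] fun ω => pgfComp Q k n ω s ^ Z k ω

open scoped ENNReal

/-- The `n`-fold convolution power of a measure on the line. -/
def convPow (F : Measure ℝ) : ℕ → Measure ℝ
  | 0 => Measure.dirac 0
  | n + 1 => Measure.conv (convPow F n) F

instance isProbabilityMeasure_convPow (F : Measure ℝ) [IsProbabilityMeasure F] (n : ℕ) :
    IsProbabilityMeasure (convPow F n) := by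
  induction n with
  | zero => unfold convPow; infer_instance
  | succ n ih => unfold convPow; infer_instance

lemma charFun_convPow (F : Measure ℝ) [IsProbabilityMeasure F] (n : ℕ) (t : ℝ) :
    charFun (convPow F n) t = charFun F t ^ n := by
  induction n with
  | zero => simp [convPow, charFun_dirac]
  | succ n ih => rw [convPow, charFun_conv, ih, pow_succ]

/-- A non-lattice step distribution with zero mean and variance `σ ^ 2`. -/
structure IsCenteredStep (F : Measure ℝ) (σ : ℝ) : Prop where
  sq_int : Integrable (fun x => x ^ 2) F
  mean : ∫ x, x ∂F = 0
  var : ∫ x, x ^ 2 ∂F = σ ^ 2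
  pos : 0 < σ
  nonlattice : NonLattice F

lemma norm_charFun_lt_one {F : Measure ℝ} [IsProbabilityMeasure F] (hF : NonLattice F) {t : ℝ}
    (ht : t ≠ 0) : ‖charFun F t‖ < 1 := by
  refine lt_of_le_of_ne (norm_charFun_le_one t) fun h1 => hF ?_
  set z := charFun F t with hz
  set θ := Complex.arg z with hθ
  have hzθ : z = Complex.exp (θ * Complex.I) := by
    conv_lhs => rw [← Complex.norm_mul_exp_arg_mul_I z, h1]
    simp [hθ]
  have h_intble : Integrable (fun x : ℝ => Complex.exp (t * x * Complex.I)) F := by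
    refine Integrable.of_bound (C := 1) (by fun_prop) (ae_of_all _ fun x => ?_)
    rw [← Complex.ofReal_mul, Complex.norm_exp_ofReal_mul_I]
  have h2 : ∫ x : ℝ, Complex.exp (-(θ * Complex.I)) * Complex.exp (t * x * Complex.I) ∂F = 1 := by
    rw [integral_const_mul, ← charFun_apply_real, ← hz, hzθ, ← Complex.exp_add]; simp
  have h3 : ∀ x : ℝ, Complex.exp (-(θ * Complex.I)) * Complex.exp (t * x * Complex.I)
      = Complex.exp (((t * x - θ : ℝ) : ℂ) * Complex.I) := by
    intro x; rw [← Complex.exp_add]; push_cast; ring_nf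
  have hcos : ∫ x : ℝ, Real.cos (t * x - θ) ∂F = 1 := by
    have := congrArg Complex.re h2
    rw [← RCLike.re_eq_complex_re, ← integral_re (h_intble.const_mul _)] at this
    simp only [h3, RCLike.re_eq_complex_re, Complex.exp_ofReal_mul_I_re] at this
    simpa using this
  have hci : Integrable (fun x : ℝ => Real.cos (t * x - θ)) F :=
    Integrable.of_bound (C := 1) (by fun_prop) (ae_of_all _ fun x => Real.abs_cos_le_one _)
  have hi1 : Integrable (fun x : ℝ => 1 - Real.cos (t * x - θ)) F := (integrable_const _).sub hci
  have h0 : ∫ x : ℝ, (1 - Real.cos (t * x - θ)) ∂F = 0 := by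
    rw [integral_sub (integrable_const _) hci, hcos]; simp
  rw [integral_eq_zero_iff_of_nonneg (fun x => by simp [Real.cos_le_one]) hi1] at h0
  refine ⟨θ / t, 2 * Real.pi / t, ?_⟩
  rw [← prob_compl_eq_zero_iff]
  · refine measure_mono_null ?_ h0
    intro x hx
    simp only [mem_compl_iff, mem_ofPred_eq, not_exists] at hx ⊢
    intro hc
    have hc' : Real.cos (t * x - θ) = 1 := by
      simp only [Pi.zero_apply] at hc; linarith
    obtain ⟨k, hk⟩ := (Real.cos_eq_one_iff _).1 hc'
    refine hx k ?_
    field_simp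
    linarith
  · have : {x : ℝ | ∃ k : ℤ, x = θ / t + k * (2 * Real.pi / t)}
        = Set.range (fun k : ℤ => θ / t + k * (2 * Real.pi / t)) := by
      ext x; simp [eq_comm]
    rw [this]
    exact (Set.countable_range _).measurableSet

lemma charFun_taylor {F : Measure ℝ} [IsProbabilityMeasure F] {σ : ℝ} (hF : IsCenteredStep F σ) :
    (fun t => charFun F t - (1 - (σ * t) ^ 2 / 2)) =o[𝓝 0] fun t => t ^ 2 := by
  have hX : AEMeasurable (fun x : ℝ => σ⁻¹ * x) F := by fun_prop
  have h := taylor_charFun_two hX (by rw [integral_const_mul, hF.mean, mul_zero]) (by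
    have : ((fun x : ℝ => σ⁻¹ * x) ^ 2) = fun x : ℝ => (σ⁻¹) ^ 2 * x ^ 2 := by
      ext x; simp [mul_pow]
    rw [this, integral_const_mul, hF.var]
    have := hF.pos.ne'
    field_simp)
  have ht : Tendsto (fun t : ℝ => σ * t) (𝓝 0) (𝓝 0) := by
    have : Continuous (fun t : ℝ => σ * t) := by fun_prop
    simpa using this.tendsto 0
  have h2 := h.comp_tendsto ht
  have h3 : ((fun t : ℝ => charFun (F.map (fun x : ℝ => σ⁻¹ * x)) t - (1 - (t : ℂ) ^ 2 / 2))
      ∘ fun t : ℝ => σ * t) = fun t : ℝ => charFun F t - (1 - (σ * t) ^ 2 / 2) := by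
    ext t
    simp only [Function.comp_apply]
    rw [charFun_map_mul, inv_mul_cancel_left₀ hF.pos.ne']
    push_cast; rfl
  have h4 : ((fun t : ℝ => t ^ 2) ∘ fun t : ℝ => σ * t) =O[𝓝 0] fun t => t ^ 2 := by
    have : ((fun t : ℝ => t ^ 2) ∘ fun t : ℝ => σ * t) = fun t => σ ^ 2 * t ^ 2 := by
      ext t; simp [mul_pow]
    rw [this]
    exact Asymptotics.isBigO_const_mul_self _ _ _
  rw [h3] at h2
  exact h2.trans_isBigO h4

lemma norm_charFun_le_gauss {F : Measure ℝ} [IsProbabilityMeasure F] {σ : ℝ}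
    (hF : IsCenteredStep F σ) (R : ℝ) :
    ∃ c > 0, ∀ t, |t| ≤ R → ‖charFun F t‖ ≤ Real.exp (-c * t ^ 2) := by
  have hσ := hF.pos
  obtain ⟨δ, hδ, hnear⟩ : ∃ δ > 0, ∀ t : ℝ, |t| < δ →
      ‖charFun F t‖ ≤ Real.exp (-(σ ^ 2 / 4) * t ^ 2) := by
    have h := (charFun_taylor hF).bound (show 0 < σ ^ 2 / 4 by positivity)
    have hs : ∀ᶠ t : ℝ in 𝓝 0, (σ * t) ^ 2 / 2 ≤ 1 := by
      have : Continuous (fun t : ℝ => (σ * t) ^ 2 / 2) := by fun_prop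
      have h := this.tendsto 0
      exact h.eventually_le_const (by norm_num)
    obtain ⟨δ, hδ, hb⟩ := Metric.eventually_nhds_iff.1 (h.and hs)
    refine ⟨δ, hδ, fun t ht => ?_⟩
    obtain ⟨h1, h2⟩ := hb (show dist t 0 < δ by simpa using ht)
    have h3 : ‖(1 - ((σ : ℂ) * t) ^ 2 / 2)‖ = 1 - (σ * t) ^ 2 / 2 := by
      have : (1 - ((σ : ℂ) * t) ^ 2 / 2) = ((1 - (σ * t) ^ 2 / 2 : ℝ) : ℂ) := by push_cast; rfl
      rw [this, Complex.norm_real, Real.norm_of_nonneg (by linarith)]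
    have h4 := norm_le_norm_add_norm_sub (1 - ((σ : ℂ) * t) ^ 2 / 2) (charFun F t)
    rw [norm_sub_rev] at h4
    have h5 : ‖t ^ 2‖ = t ^ 2 := Real.norm_of_nonneg (by positivity)
    have h6 := Real.add_one_le_exp (-(σ ^ 2 / 4) * t ^ 2)
    rw [h5] at h1
    have : (σ * t) ^ 2 = σ ^ 2 * t ^ 2 := by ring
    have h4' : ‖charFun F t‖ ≤ ‖(1 - ((σ : ℂ) * t) ^ 2 / 2)‖
        + ‖charFun F t - (1 - ((σ : ℂ) * t) ^ 2 / 2)‖ := by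
      have := norm_add_le (1 - ((σ : ℂ) * t) ^ 2 / 2) (charFun F t - (1 - ((σ : ℂ) * t) ^ 2 / 2))
      simpa using this
    rw [h3] at h4'
    linarith
  set A : Set ℝ := {t | δ ≤ |t| ∧ |t| ≤ R} with hA
  have hAc : IsCompact A := by
    refine Metric.isCompact_of_isClosed_isBounded ?_ ?_
    · exact (isClosed_le continuous_const continuous_abs).inter
        (isClosed_le continuous_abs continuous_const)
    · refine (Metric.isBounded_closedBall (x := (0 : ℝ)) (r := R)).subset fun t ht => ?_
      simpa using ht.2
  obtain ⟨m, hm0, hm1, hm⟩ : ∃ m : ℝ, 0 < m ∧ m < 1 ∧ ∀ t ∈ A, ‖charFun F t‖ ≤ m := by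
    rcases A.eq_empty_or_nonempty with he | hne
    · exact ⟨1 / 2, by norm_num, by norm_num, by simp [he]⟩
    · obtain ⟨t0, ht0, hmax⟩ := hAc.exists_isMaxOn hne
        (f := fun t => ‖charFun F t‖) (continuous_charFun.norm.continuousOn)
      refine ⟨max (1 / 2) ‖charFun F t0‖, by positivity, max_lt (by norm_num) ?_, fun t ht =>
        le_max_of_le_right (hmax ht)⟩
      refine norm_charFun_lt_one hF.nonlattice ?_
      rintro rfl
      have := ht0.1
      simp at this
      linarith
  have hlog : 0 < -Real.log m := by
    have := Real.log_neg hm0 hm1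
    linarith
  refine ⟨min (σ ^ 2 / 4) (-Real.log m / (R ^ 2 + 1)), lt_min (by positivity) (by positivity),
    fun t ht => ?_⟩
  by_cases htδ : |t| < δ
  · refine (hnear t htδ).trans (Real.exp_le_exp.2 ?_)
    have := mul_le_mul_of_nonneg_right (min_le_left (σ ^ 2 / 4) (-Real.log m / (R ^ 2 + 1)))
      (sq_nonneg t)
    linarith
  · refine (hm t ⟨not_lt.1 htδ, ht⟩).trans ?_
    rw [← Real.log_le_iff_le_exp hm0]
    have h1 := mul_le_mul_of_nonneg_right (min_le_right (σ ^ 2 / 4) (-Real.log m / (R ^ 2 + 1)))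
      (sq_nonneg t)
    have h2 : t ^ 2 ≤ R ^ 2 + 1 := by
      have : t ^ 2 ≤ R ^ 2 := sq_le_sq' (by linarith [abs_le.1 ht]) (abs_le.1 ht).2
      linarith
    have h3 : -Real.log m / (R ^ 2 + 1) * t ^ 2 ≤ -Real.log m := by
      rw [div_mul_eq_mul_div, div_le_iff₀ (by positivity)]
      exact mul_le_mul_of_nonneg_left h2 hlog.le
    linarith

lemma integral_norm_charFun_pow_le {F : Measure ℝ} [IsProbabilityMeasure F] {σ : ℝ}
    (hF : IsCenteredStep F σ) (R : ℝ) :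
    ∃ C > 0, ∀ n : ℕ, ∫ t in Icc (-R) R, ‖charFun F t‖ ^ (n + 1) ≤ C / √(n + 1) := by
  obtain ⟨c, hc, hb⟩ := norm_charFun_le_gauss hF R
  refine ⟨√(Real.pi / c), by positivity, fun n => ?_⟩
  have h1 : √(Real.pi / c) / √(n + 1) = ∫ t : ℝ, Real.exp (-(c * (n + 1)) * t ^ 2) := by
    rw [integral_gaussian, ← Real.sqrt_div (by positivity), div_div]
  rw [h1]
  have hgi : Integrable fun t : ℝ => Real.exp (-(c * (n + 1)) * t ^ 2) :=
    integrable_exp_neg_mul_sq (by positivity)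
  refine (setIntegral_mono_on ?_ hgi.integrableOn measurableSet_Icc fun t ht => ?_).trans
    (setIntegral_le_integral hgi (ae_of_all _ fun t => by positivity))
  · exact (continuous_charFun.norm.pow _).integrableOn_Icc
  · refine (pow_le_pow_left₀ (norm_nonneg _) (hb t (abs_le.2 ht)) _).trans (le_of_eq ?_)
    rw [← Real.exp_nat_mul]; push_cast; ring_nf

lemma tendsto_sqrt_integral_charFun_pow {F : Measure ℝ} [IsProbabilityMeasure F] {σ : ℝ}
    (hF : IsCenteredStep F σ) {g : ℝ → ℂ} (hg : Continuous g) {R : ℝ}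
    (hsupp : ∀ t, R < |t| → g t = 0) :
    Tendsto (fun n : ℕ => (√n : ℂ) * ∫ t, g t * charFun F t ^ n) atTop
      (𝓝 (g 0 * (√(2 * Real.pi) / σ : ℝ))) := by
  have hσ := hF.pos
  obtain ⟨c, hc, hb⟩ := norm_charFun_le_gauss hF R
  have hcs : HasCompactSupport g := by
    refine HasCompactSupport.of_support_subset_isCompact (isCompact_Icc (a := -R) (b := R)) ?_
    intro t ht
    by_contra h
    refine ht (hsupp t (not_le.1 fun h' => h (abs_le.1 h')))
  obtain ⟨G, hG⟩ := hcs.exists_bound_of_continuous hg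
  have key : ∀ n : ℕ, 0 < n → (√n : ℂ) * ∫ t, g t * charFun F t ^ n
      = ∫ s : ℝ, g ((√n)⁻¹ * s) * charFun F ((√n)⁻¹ * s) ^ n := by
    intro n hn
    have hn' : 0 < √(n : ℝ) := by positivity
    have := Measure.integral_comp_mul_left (fun t => g t * charFun F t ^ n) (√(n : ℝ))⁻¹
    rw [this, inv_inv, abs_of_pos hn']
    simp
  have hlim : ∫ s : ℝ, g 0 * Complex.exp (-((σ * s : ℝ) : ℂ) ^ 2 / 2)
      = g 0 * (√(2 * Real.pi) / σ : ℝ) := by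
    rw [integral_const_mul]
    congr 1
    have h1 : ∀ s : ℝ, Complex.exp (-((σ * s : ℝ) : ℂ) ^ 2 / 2)
        = ((Real.exp (-(σ ^ 2 / 2) * s ^ 2) : ℝ) : ℂ) := by
      intro s; push_cast; ring_nf
    simp_rw [h1]
    rw [integral_complex_ofReal, integral_gaussian]
    congr 1
    rw [show Real.pi / (σ ^ 2 / 2) = (2 * Real.pi) / σ ^ 2 by field_simp,
      Real.sqrt_div (by positivity), Real.sqrt_sq hσ.le]
  rw [← hlim]
  have h2 : Tendsto (fun n : ℕ => ∫ s : ℝ, g ((√n)⁻¹ * s) * charFun F ((√n)⁻¹ * s) ^ n) atTop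
      (𝓝 (∫ s : ℝ, g 0 * Complex.exp (-((σ * s : ℝ) : ℂ) ^ 2 / 2))) := by
    refine tendsto_integral_filter_of_dominated_convergence
      (fun s => G * Real.exp (-c * s ^ 2)) ?_ ?_ ?_ ?_
    · refine Eventually.of_forall fun n => Continuous.aestronglyMeasurable ?_
      exact (hg.comp (by fun_prop)).mul ((continuous_charFun.comp (by fun_prop)).pow _)
    · filter_upwards [eventually_gt_atTop 0] with n hn
      refine ae_of_all _ fun s => ?_
      have hn' : 0 < √(n : ℝ) := by positivity
      rw [norm_mul, norm_pow]
      by_cases hs : R < |(√(n : ℝ))⁻¹ * s|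
      · rw [hsupp _ hs]
        have : 0 ≤ G := (norm_nonneg _).trans (hG 0)
        simp; positivity
      · refine mul_le_mul (hG _) ?_ (by positivity) ((norm_nonneg _).trans (hG 0))
        refine (pow_le_pow_left₀ (norm_nonneg _) (hb _ (not_lt.1 hs)) _).trans (le_of_eq ?_)
        rw [← Real.exp_nat_mul]
        congr 1
        rw [mul_pow, inv_pow, Real.sq_sqrt (by positivity)]
        field_simp
    · exact (integrable_exp_neg_mul_sq hc).const_mul _
    · refine ae_of_all _ fun s => Tendsto.mul ?_ ?_
      · have h0 : Tendsto (fun n : ℕ => (√(n : ℝ))⁻¹ * s) atTop (𝓝 (0 * s)) :=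
          (tendsto_inv_atTop_zero.comp
            (Real.tendsto_sqrt_atTop.comp tendsto_natCast_atTop_atTop)).mul_const s
        rw [zero_mul] at h0
        exact (hg.tendsto 0).comp h0
      · have hX : AEMeasurable (fun x : ℝ => σ⁻¹ * x) F := by fun_prop
        have h := tendsto_charFun_inv_sqrt_mul_pow hX (by rw [integral_const_mul, hF.mean, mul_zero]) (by
          have : ((fun x : ℝ => σ⁻¹ * x) ^ 2) = fun x : ℝ => (σ⁻¹) ^ 2 * x ^ 2 := by
            ext x; simp [mul_pow]
          rw [this, integral_const_mul, hF.var]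
          field_simp) (σ * s)
        refine h.congr fun n => ?_
        rw [charFun_map_mul]
        congr 2
        field_simp
  refine h2.congr' ?_
  filter_upwards [eventually_gt_atTop 0] with n hn
  rw [key n hn]

/-- The triangle function supported on `[-1, 1]`. -/
def tri (t : ℝ) : ℝ := max (1 - |t|) 0

lemma continuous_tri : Continuous tri := by unfold tri; fun_prop

lemma tri_nonneg (t : ℝ) : 0 ≤ tri t := le_max_right _ _

lemma tri_le_one (t : ℝ) : tri t ≤ 1 := max_le (by linarith [abs_nonneg t]) zero_le_one

lemma tri_zero : tri 0 = 1 := by simp [tri]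

lemma tri_eq_zero {t : ℝ} (ht : 1 < |t|) : tri t = 0 := max_eq_right (by linarith)

lemma tri_neg (t : ℝ) : tri (-t) = tri t := by simp [tri]

lemma tri_hasCompactSupport : HasCompactSupport tri := by
  refine HasCompactSupport.of_support_subset_isCompact (isCompact_Icc (a := -1) (b := 1)) ?_
  intro t ht
  by_contra h
  exact ht (tri_eq_zero (not_le.1 fun h' => h (abs_le.1 h')))

lemma integrable_tri : Integrable tri :=
  continuous_tri.integrable_of_hasCompactSupport tri_hasCompactSupport

lemma integrable_tri_mul {g : ℝ → ℝ} (hg : Continuous g) : Integrable fun t => tri t * g t :=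
  (continuous_tri.mul hg).integrable_of_hasCompactSupport tri_hasCompactSupport.mul_right

/-- The total mass of the triangle function. -/
lemma integral_tri_pos : 0 < ∫ t, tri t :=
  continuous_tri.integral_pos_of_hasCompactSupport_nonneg_nonzero tri_hasCompactSupport tri_nonneg
    (x := 0) (by simp [tri_zero])

/-- The Fourier transform of the triangle function. -/
def fejer (x : ℝ) : ℝ := ∫ t, tri t * Real.cos (t * x)

lemma fejer_eq (x : ℝ) : x ^ 2 * fejer x = 2 * (1 - Real.cos x) := by
  rcases eq_or_ne x 0 with rfl | hx
  · simp
  have h1 : fejer x = 2 * ∫ t in Ioi (0 : ℝ), max (1 - t) 0 * Real.cos (t * x) := by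
    rw [← integral_comp_abs (f := fun t : ℝ => max (1 - t) 0 * Real.cos (t * x))]
    refine integral_congr_ae (ae_of_all _ fun t => ?_)
    simp only [tri]
    rcases abs_cases t with ⟨h, _⟩ | ⟨h, _⟩ <;> simp [h]
  have h2 : ∫ t in Ioi (0 : ℝ), max (1 - t) 0 * Real.cos (t * x)
      = ∫ t in (0 : ℝ)..1, (1 - t) * Real.cos (t * x) := by
    rw [intervalIntegral.integral_of_le zero_le_one,
      setIntegral_eq_of_subset_of_forall_sdiff_eq_zero measurableSet_Ioi
        (s := Ioc (0 : ℝ) 1) Ioc_subset_Ioi_self]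
    · refine setIntegral_congr_fun measurableSet_Ioc fun t ht => ?_
      rw [max_eq_left (by linarith [ht.2])]
    · intro t ht
      have : 1 < t := by
        by_contra h
        exact ht.2 ⟨ht.1, not_lt.1 h⟩
      rw [max_eq_right (by linarith), zero_mul]
  have h3 : ∫ t in (0 : ℝ)..1, (1 - t) * Real.cos (t * x)
      = ((1 - 1) * (Real.sin (1 * x) / x) - Real.cos (1 * x) / x ^ 2)
        - ((1 - 0) * (Real.sin (0 * x) / x) - Real.cos (0 * x) / x ^ 2) := by
    refine intervalIntegral.integral_eq_sub_of_hasDerivAt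
      (f := fun t => (1 - t) * (Real.sin (t * x) / x) - Real.cos (t * x) / x ^ 2)
      (fun t _ => ?_) ?_
    · have hl : HasDerivAt (fun t : ℝ => t * x) x t := by
        simpa using (hasDerivAt_id t).mul_const x
      have h1 := (((hasDerivAt_id t).const_sub 1).mul (hl.sin.div_const x)).sub
        (hl.cos.div_const (x ^ 2))
      refine h1.congr_deriv ?_
      simp only [id]
      field_simp
      ring
    · exact Continuous.intervalIntegrable (by fun_prop) _ _
  rw [h1, h2, h3]
  simp
  field_simp
  ring

lemma continuous_fejer : Continuous fejer := by
  refine continuous_of_dominated (bound := tri) ?_ ?_ integrable_tri ?_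
  · intro x
    exact (integrable_tri_mul (by fun_prop)).aestronglyMeasurable
  · refine fun x => ae_of_all _ fun t => ?_
    rw [norm_mul, Real.norm_of_nonneg (tri_nonneg t)]
    exact mul_le_of_le_one_right (tri_nonneg t) (Real.abs_cos_le_one _)
  · exact ae_of_all _ fun t => by fun_prop

lemma fejer_nonneg (x : ℝ) : 0 ≤ fejer x := by
  rcases eq_or_ne x 0 with rfl | hx
  · simp only [fejer, mul_zero, Real.cos_zero, mul_one]
    exact integral_nonneg tri_nonneg
  · have h := fejer_eq x
    have : 0 < x ^ 2 := by positivity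
    by_contra hneg
    have := mul_neg_of_pos_of_neg this (not_le.1 hneg)
    linarith [Real.cos_le_one x]

lemma fejer_lower : ∃ c > 0, ∀ x, |x| ≤ 1 → c ≤ fejer x := by
  have hc : 0 < Real.cos 1 := Real.cos_one_pos
  refine ⟨Real.cos 1 * ∫ t, tri t, mul_pos hc integral_tri_pos, fun x hx => ?_⟩
  rw [← integral_const_mul]
  refine integral_mono (integrable_tri.const_mul _) (integrable_tri_mul (by fun_prop)) fun t => ?_
  simp only []
  rw [mul_comm]
  by_cases ht : 1 < |t|
  · simp [tri_eq_zero ht]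
  · refine mul_le_mul_of_nonneg_left ?_ (tri_nonneg t)
    rw [← Real.cos_abs (t * x)]
    refine Real.cos_le_cos_of_nonneg_of_le_pi (abs_nonneg _) (by linarith [Real.pi_gt_three]) ?_
    rw [abs_mul]
    exact mul_le_one₀ (not_lt.1 ht) (abs_nonneg _) hx

lemma integral_fejer_convPow {F : Measure ℝ} [IsProbabilityMeasure F] (n : ℕ) (z : ℝ) :
    ∫ x, fejer (x - z) ∂(convPow F n) ≤ ∫ t in Icc (-1 : ℝ) 1, ‖charFun F t‖ ^ n := by
  have hprod : Integrable (Function.uncurry fun (x t : ℝ) => tri t * Real.cos (t * (x - z)))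
      ((convPow F n).prod volume) := by
    have h1 : Integrable (fun p : ℝ × ℝ => tri p.2) ((convPow F n).prod volume) := by
      simpa using (integrable_const (1 : ℝ) (μ := convPow F n)).mul_prod integrable_tri
    refine h1.mono' ?_ (ae_of_all _ fun p => ?_)
    · refine Continuous.aestronglyMeasurable ?_
      have := continuous_tri
      unfold Function.uncurry
      fun_prop
    · simp only [Function.uncurry]
      rw [norm_mul, Real.norm_of_nonneg (tri_nonneg _)]
      exact mul_le_of_le_one_right (tri_nonneg _) (Real.abs_cos_le_one _)
  simp only [fejer]
  rw [integral_integral_swap hprod]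
  have hle : ∀ t, ∫ x, tri t * Real.cos (t * (x - z)) ∂(convPow F n)
      ≤ (Icc (-1 : ℝ) 1).indicator (fun t => ‖charFun F t‖ ^ n) t := by
    intro t
    by_cases ht : t ∈ Icc (-1 : ℝ) 1
    · rw [indicator_of_mem ht, integral_const_mul]
      have h_intble : Integrable (fun x : ℝ => Complex.exp (t * x * Complex.I)) (convPow F n) := by
        refine Integrable.of_bound (C := 1) (by fun_prop) (ae_of_all _ fun x => ?_)
        rw [← Complex.ofReal_mul, Complex.norm_exp_ofReal_mul_I]
      have h1 : ∫ x, Real.cos (t * (x - z)) ∂(convPow F n)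
          = (Complex.exp (-(t * z * Complex.I)) * charFun (convPow F n) t).re := by
        rw [charFun_apply_real, ← integral_const_mul, ← RCLike.re_eq_complex_re,
          ← integral_re (h_intble.const_mul _)]
        refine integral_congr_ae (ae_of_all _ fun x => ?_)
        simp only [RCLike.re_eq_complex_re]
        rw [← Complex.exp_add, ← Complex.exp_ofReal_mul_I_re]
        push_cast
        ring_nf
      have h2 : ∫ x, Real.cos (t * (x - z)) ∂(convPow F n) ≤ ‖charFun F t‖ ^ n := by
        rw [h1, charFun_convPow]
        refine (Complex.re_le_norm _).trans ?_
        rw [norm_mul, norm_pow]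
        have : ‖Complex.exp (-(t * z * Complex.I))‖ = 1 := by
          have := Complex.norm_exp_ofReal_mul_I (-(t * z))
          rw [← this]; push_cast; ring_nf
        rw [this, one_mul]
      have hle1 := tri_le_one t
      have h0 := tri_nonneg t
      calc tri t * ∫ x, Real.cos (t * (x - z)) ∂(convPow F n)
          ≤ tri t * ‖charFun F t‖ ^ n := mul_le_mul_of_nonneg_left h2 h0
        _ ≤ ‖charFun F t‖ ^ n := mul_le_of_le_one_left (by positivity) hle1
    · rw [indicator_of_notMem ht, integral_const_mul,
        tri_eq_zero (not_le.1 fun h => ht (abs_le.1 h)), zero_mul]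
  have hswap := hprod.integral_prod_right
  refine (integral_mono hswap ?_ hle).trans (le_of_eq ?_)
  · rw [integrable_indicator_iff measurableSet_Icc]
    exact (continuous_charFun.norm.pow _).integrableOn_Icc
  · rw [integral_indicator measurableSet_Icc]

lemma continuous_integrable_of_le {f : ℝ → ℝ} (hf : Continuous f) {C : ℝ} (hb : ∀ x, |f x| ≤ C)
    (μ : Measure ℝ) [IsFiniteMeasure μ] : Integrable f μ :=
  Integrable.of_bound hf.aestronglyMeasurable C (ae_of_all _ hb)

lemma fejer_le (x : ℝ) : fejer x ≤ 6 / (1 + x ^ 2) := by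
  have h := fejer_eq x
  have h1 : fejer x ≤ 2 := by
    have h2 : fejer x ≤ ∫ t, (Icc (-1 : ℝ) 1).indicator (fun _ => (1 : ℝ)) t := by
      refine integral_mono (integrable_tri_mul (by fun_prop)) ?_ fun t => ?_
      · rw [integrable_indicator_iff measurableSet_Icc]
        exact continuous_const.integrableOn_Icc
      · by_cases ht : t ∈ Icc (-1 : ℝ) 1
        · rw [indicator_of_mem ht]
          exact (mul_le_of_le_one_right (tri_nonneg _) (Real.cos_le_one _)).trans (tri_le_one t)
        · rw [indicator_of_notMem ht, tri_eq_zero (not_le.1 fun h => ht (abs_le.1 h)), zero_mul]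
    rw [integral_indicator measurableSet_Icc] at h2
    simp at h2
    linarith
  rw [le_div_iff₀ (by positivity)]
  have := Real.neg_one_le_cos x
  nlinarith

lemma convPow_unit_interval_le {F : Measure ℝ} [IsProbabilityMeasure F] {σ : ℝ}
    (hF : IsCenteredStep F σ) :
    ∃ C > 0, ∀ (n : ℕ) (z : ℝ), (convPow F (n + 1)).real (Icc z (z + 1)) ≤ C / √(n + 1) := by
  obtain ⟨C, hC, h1⟩ := integral_norm_charFun_pow_le hF 1
  obtain ⟨c, hc, h2⟩ := fejer_lower
  refine ⟨C / c, by positivity, fun n z => ?_⟩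
  have h3 := (integral_fejer_convPow (F := F) (n + 1) z).trans (h1 n)
  have h_intble : Integrable (fun x => fejer (x - z)) (convPow F (n + 1)) := by
    refine continuous_integrable_of_le (C := 6) (continuous_fejer.comp (by fun_prop)) (fun x => ?_) _
    rw [Function.comp_apply, abs_of_nonneg (fejer_nonneg _)]
    refine (fejer_le _).trans ?_
    rw [div_le_iff₀ (by positivity)]
    nlinarith [sq_nonneg (x - z)]
  have h4 : c * (convPow F (n + 1)).real (Icc z (z + 1)) ≤
      ∫ x, fejer (x - z) ∂(convPow F (n + 1)) := by
    calc c * (convPow F (n + 1)).real (Icc z (z + 1))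
        = ∫ x in Icc z (z + 1), c ∂(convPow F (n + 1)) := by simp [mul_comm]
      _ ≤ ∫ x in Icc z (z + 1), fejer (x - z) ∂(convPow F (n + 1)) := by
        refine setIntegral_mono_on (integrable_const _).integrableOn h_intble.integrableOn
          measurableSet_Icc fun x hx => h2 _ ?_
        rw [abs_le]
        constructor <;> linarith [hx.1, hx.2]
      _ ≤ _ := setIntegral_le_integral h_intble (ae_of_all _ fun x => fejer_nonneg _)
  rw [div_div, mul_comm c, ← div_div, le_div_iff₀ hc]
  linarith

/-- A positive integrable kernel whose Fourier transform has compact support. -/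
def posKernel (x : ℝ) : ℝ := fejer x + fejer (x + 1)

/-- The Fourier transform of `posKernel`, up to normalisation. -/
def posKernelHat (t : ℝ) : ℂ := tri t * (1 + Complex.exp (t * Complex.I))

lemma continuous_posKernel : Continuous posKernel :=
  continuous_fejer.add (continuous_fejer.comp (by fun_prop))

lemma continuous_posKernelHat : Continuous posKernelHat := by
  have := continuous_tri
  unfold posKernelHat
  fun_prop

lemma posKernelHat_eq_zero {t : ℝ} (ht : 1 < |t|) : posKernelHat t = 0 := by
  simp [posKernelHat, tri_eq_zero ht]

lemma integrable_posKernelHat : Integrable posKernelHat := by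
  refine continuous_posKernelHat.integrable_of_hasCompactSupport ?_
  refine HasCompactSupport.of_support_subset_isCompact (isCompact_Icc (a := -1) (b := 1)) ?_
  intro t ht
  by_contra h
  exact ht (posKernelHat_eq_zero (not_le.1 fun h' => h (abs_le.1 h')))

lemma posKernel_le (x : ℝ) : posKernel x ≤ 24 / (1 + x ^ 2) := by
  have h1 := fejer_le x
  have h2 := fejer_le (x + 1)
  have h3 : 6 / (1 + (x + 1) ^ 2) ≤ 18 / (1 + x ^ 2) := by
    rw [div_le_div_iff₀ (by positivity) (by positivity)]
    nlinarith [sq_nonneg (2 * x + 3)]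
  have h4 : 6 / (1 + x ^ 2) + 18 / (1 + x ^ 2) = 24 / (1 + x ^ 2) := by ring
  unfold posKernel
  linarith

lemma posKernel_lower : ∃ c > 0, ∀ x, c / (1 + x ^ 2) ≤ posKernel x := by
  have hc : Real.cos (1 / 2) < 1 := by
    have h := Real.cos_lt_cos_of_nonneg_of_le_pi (x := 0) (y := 1 / 2) le_rfl
      (by linarith [Real.pi_gt_three]) (by norm_num)
    rwa [Real.cos_zero] at h
  refine ⟨2 * (1 - Real.cos (1 / 2)), by linarith, fun x => ?_⟩
  rw [div_le_iff₀ (by positivity)]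
  have h1 := fejer_eq x
  have h2 := fejer_eq (x + 1)
  have h3 : Real.cos x + Real.cos (x + 1) ≤ 2 * Real.cos (1 / 2) := by
    rw [Real.cos_add_cos]
    have : (x - (x + 1)) / 2 = -(1 / 2) := by ring
    rw [this, Real.cos_neg]
    have h := Real.cos_le_one ((x + (x + 1)) / 2)
    have h0 : 0 ≤ Real.cos (1 / 2) :=
      Real.cos_nonneg_of_mem_Icc ⟨by linarith [Real.pi_gt_three], by linarith [Real.pi_gt_three]⟩
    nlinarith
  have h4 := mul_nonneg (fejer_nonneg x) (sq_nonneg x)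
  have h5 := mul_nonneg (fejer_nonneg (x + 1)) (sq_nonneg (x - 1))
  have h6 := fejer_nonneg x
  unfold posKernel
  nlinarith

lemma posKernel_pos (x : ℝ) : 0 < posKernel x := by
  obtain ⟨c, hc, h⟩ := posKernel_lower
  exact lt_of_lt_of_le (by positivity) (h x)

lemma integrable_posKernel : Integrable posKernel := by
  refine (integrable_inv_one_add_sq.const_mul 24).mono'
    continuous_posKernel.aestronglyMeasurable (ae_of_all _ fun x => ?_)
  rw [Real.norm_of_nonneg (posKernel_pos x).le, ← div_eq_mul_inv]
  exact posKernel_le x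

lemma fejer_eq_integral_exp (x : ℝ) :
    ∫ t, (tri t : ℂ) * Complex.exp (t * x * Complex.I) = fejer x := by
  have h1 : ∫ t, tri t * Real.sin (t * x) = 0 := by
    have h := integral_neg_eq_self (fun t => tri t * Real.sin (t * x)) volume
    simp only [tri_neg, neg_mul, Real.sin_neg, mul_neg, integral_neg] at h
    linarith
  have h2 : ∀ t : ℝ, (tri t : ℂ) * Complex.exp (t * x * Complex.I)
      = ((tri t * Real.cos (t * x) : ℝ) : ℂ) + ((tri t * Real.sin (t * x) : ℝ) : ℂ) * Complex.I := by
    intro t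
    rw [Complex.exp_mul_I]
    push_cast
    ring
  simp_rw [h2]
  rw [integral_add (integrable_tri_mul (by fun_prop)).ofReal
    ((integrable_tri_mul (by fun_prop)).ofReal.mul_const _), integral_mul_const,
    integral_complex_ofReal, integral_complex_ofReal, h1]
  simp [fejer]

lemma posKernel_eq_integral_exp (x : ℝ) :
    ∫ t, posKernelHat t * Complex.exp (t * x * Complex.I) = posKernel x := by
  have hi : ∀ y : ℝ, Integrable fun t : ℝ => (tri t : ℂ) * Complex.exp (t * y * Complex.I) := by
    intro y
    refine Continuous.integrable_of_hasCompactSupport ?_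
      (tri_hasCompactSupport.comp_left (g := Complex.ofReal) rfl).mul_right
    have := continuous_tri
    fun_prop
  have h2 : ∀ t : ℝ, posKernelHat t * Complex.exp (t * x * Complex.I)
      = (tri t : ℂ) * Complex.exp (t * x * Complex.I)
        + (tri t : ℂ) * Complex.exp (t * (x + 1 : ℝ) * Complex.I) := by
    intro t
    have : Complex.exp (t * (x + 1 : ℝ) * Complex.I)
        = Complex.exp (t * Complex.I) * Complex.exp (t * x * Complex.I) := by
      rw [← Complex.exp_add]; push_cast; ring_nf
    rw [this, posKernelHat]
    ring
  simp_rw [h2]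
  rw [integral_add (hi x) (hi (x + 1)), fejer_eq_integral_exp, fejer_eq_integral_exp, posKernel]
  push_cast
  rfl

lemma integral_posKernel_exp (u : ℝ) :
    ∫ x, (posKernel x : ℂ) * Complex.exp (u * x * Complex.I)
      = 2 * Real.pi * posKernelHat (-u) := by
  set f : ℝ → ℂ := fun v => posKernelHat (-(2 * Real.pi * v)) with hf
  have hfc : Continuous f := continuous_posKernelHat.comp (by fun_prop)
  have hpi := Real.pi_pos
  have hfi : Integrable f := by
    have := (integrable_posKernelHat.comp_mul_left' (g := posKernelHat)
      (R := -(2 * Real.pi)) (by linarith : -(2 * Real.pi) ≠ 0))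
    refine this.congr (ae_of_all _ fun v => ?_)
    simp [hf]
  have hF : ∀ w : ℝ, FourierTransform.fourier f w = (2 * Real.pi)⁻¹ * posKernel w := by
    intro w
    rw [Real.fourier_real_eq_integral_exp_smul]
    have h := Measure.integral_comp_mul_left
      (fun t : ℝ => posKernelHat t * Complex.exp (t * w * Complex.I)) (-(2 * Real.pi))
    rw [posKernel_eq_integral_exp] at h
    rw [abs_inv, abs_neg, abs_of_pos (by positivity : 0 < 2 * Real.pi)] at h
    rw [Complex.real_smul] at h
    push_cast at h ⊢
    rw [← h]
    refine integral_congr_ae (ae_of_all _ fun v => ?_)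
    simp only [hf, smul_eq_mul]
    rw [mul_comm]
    ring_nf
  have hFi : Integrable (FourierTransform.fourier f) := by
    rw [funext hF]
    exact integrable_posKernel.ofReal.const_mul _
  have hinv := congrFun (hfc.fourierInv_fourier_eq hfi hFi) (u / (2 * Real.pi))
  rw [Real.fourierInv_eq'] at hinv
  have h1 : f (u / (2 * Real.pi)) = posKernelHat (-u) := by
    simp only [hf]
    congr 1
    field_simp
  rw [h1] at hinv
  rw [← hinv, ← integral_const_mul]
  refine integral_congr_ae (ae_of_all _ fun x => ?_)
  simp only [hF, smul_eq_mul]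
  have h2 : (2 * Real.pi * (inner ℝ x (u / (2 * Real.pi))) : ℝ) = u * x := by
    simp
    field_simp
  rw [h2]
  have : (Real.pi : ℂ) ≠ 0 := by exact_mod_cast hpi.ne'
  push_cast
  field_simp

lemma integral_tilted_log {P : Measure ℝ} {g : ℝ → ℝ} (hg : ∀ x, 0 < g x)
    {E : Type*} [NormedAddCommGroup E] [NormedSpace ℝ E] (h : ℝ → E) :
    ∫ x, h x ∂(P.tilted fun x => Real.log (g x)) = (∫ x, g x ∂P)⁻¹ • ∫ x, g x • h x ∂P := by
  rw [integral_tilted, ← integral_smul]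
  simp only [Real.exp_log (hg _), smul_smul]
  refine integral_congr_ae (ae_of_all _ fun x => ?_)
  simp only [div_eq_inv_mul]

lemma isProbabilityMeasure_tilted_log {P : Measure ℝ} [NeZero P] {g : ℝ → ℝ}
    (hg : ∀ x, 0 < g x) (hi : Integrable g P) :
    IsProbabilityMeasure (P.tilted fun x => Real.log (g x)) := by
  refine isProbabilityMeasure_tilted (hi.congr (ae_of_all _ fun x => ?_))
  simp only [Real.exp_log (hg _)]

/-- Weak convergence passes to integrals over continuity sets. -/
lemma tendsto_setIntegral_of_tendsto {μs : ℕ → ProbabilityMeasure ℝ} {μ : ProbabilityMeasure ℝ}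
    (hμ : Tendsto μs atTop (𝓝 μ)) {g : ℝ → ℝ} (hg : Continuous g) {G : ℝ} (hG : ∀ x, |g x| ≤ G)
    {s : Set ℝ} (hs : MeasurableSet s) (hfr : (μ : Measure ℝ) (frontier s) = 0) :
    Tendsto (fun n => ∫ x in s, g x ∂(μs n : Measure ℝ)) atTop
      (𝓝 (∫ x in s, g x ∂(μ : Measure ℝ))) := by
  have hG0 : 0 ≤ G := (abs_nonneg _).trans (hG 0)
  have hreal : ∀ {νs : ℕ → ProbabilityMeasure ℝ} {ν : ProbabilityMeasure ℝ},
      Tendsto νs atTop (𝓝 ν) → (ν : Measure ℝ) (frontier s) = 0 →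
      Tendsto (fun n => (νs n : Measure ℝ).real s) atTop (𝓝 ((ν : Measure ℝ).real s)) := by
    intro νs ν h h0
    exact (ENNReal.tendsto_toReal (measure_ne_top _ _)).comp
      (ProbabilityMeasure.tendsto_measure_of_null_frontier_of_tendsto' h h0)
  set f : ℝ → ℝ := fun x => g x + (G + 1) with hf
  have hf1 : ∀ x, 0 < f x := fun x => by simp only [hf]; linarith [abs_le.1 (hG x)]
  have hfc : Continuous f := by fun_prop
  have hfb : ∀ x, |f x| ≤ 2 * G + 1 := fun x => by
    rw [abs_of_pos (hf1 x)]; simp only [hf]; linarith [abs_le.1 (hG x)]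
  have hfi : ∀ P : Measure ℝ, [IsFiniteMeasure P] → Integrable f P := fun P _ =>
    continuous_integrable_of_le hfc hfb P
  let T : ProbabilityMeasure ℝ → ProbabilityMeasure ℝ := fun P =>
    ⟨(P : Measure ℝ).tilted fun x => Real.log (f x), isProbabilityMeasure_tilted_log hf1 (hfi _)⟩
  have hconv : ∀ h : ℝ → ℝ, Continuous h → (∃ C, ∀ x, |h x| ≤ C) →
      Tendsto (fun n => ∫ x, h x ∂(μs n : Measure ℝ)) atTop (𝓝 (∫ x, h x ∂(μ : Measure ℝ))) := by
    rintro h hc ⟨C, hC⟩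
    exact (ProbabilityMeasure.tendsto_iff_forall_integral_tendsto.1 hμ)
      (BoundedContinuousFunction.ofNormedAddCommGroup h hc C hC)
  have hpos : ∀ P : Measure ℝ, [IsProbabilityMeasure P] → 0 < ∫ x, f x ∂P := by
    intro P _
    have : ∫ x, (1 : ℝ) ∂P ≤ ∫ x, f x ∂P := integral_mono (integrable_const _) (hfi P) fun x => by
      simp only [hf]; linarith [abs_le.1 (hG x)]
    simp at this
    linarith
  have hT : Tendsto (fun n => T (μs n)) atTop (𝓝 (T μ)) := by
    rw [ProbabilityMeasure.tendsto_iff_forall_integral_tendsto]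
    intro h
    simp only [T, ProbabilityMeasure.coe_mk, integral_tilted_log hf1, smul_eq_mul]
    refine ((hconv f hfc ⟨_, hfb⟩).inv₀ (hpos _).ne').mul (hconv _ (hfc.mul h.continuous) ?_)
    refine ⟨(2 * G + 1) * ‖h‖, fun x => ?_⟩
    rw [abs_mul]
    exact mul_le_mul (hfb x) (h.norm_coe_le_norm x) (abs_nonneg _) (by linarith)
  have h1 := hreal hT (by
    simp only [T, ProbabilityMeasure.coe_mk]
    exact tilted_absolutelyContinuous _ _ hfr)
  have h2 : ∀ P : ProbabilityMeasure ℝ, ∫ x in s, f x ∂(P : Measure ℝ)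
      = (∫ x, f x ∂(P : Measure ℝ)) * (T P : Measure ℝ).real s := by
    intro P
    have h3 := integral_tilted_log (P := (P : Measure ℝ)) hf1 (s.indicator fun _ => (1 : ℝ))
    rw [integral_indicator hs] at h3
    simp only [integral_const, smul_eq_mul, mul_one, measureReal_restrict_apply_univ] at h3
    simp only [T, ProbabilityMeasure.coe_mk]
    rw [h3, mul_inv_cancel_left₀ (hpos _).ne', ← integral_indicator hs]
    refine integral_congr_ae (ae_of_all _ fun x => ?_)
    by_cases hx : x ∈ s <;> simp [hx]
  have h4 : ∀ P : ProbabilityMeasure ℝ, ∫ x in s, g x ∂(P : Measure ℝ)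
      = (∫ x, f x ∂(P : Measure ℝ)) * (T P : Measure ℝ).real s
        - (G + 1) * (P : Measure ℝ).real s := by
    intro P
    rw [← h2]
    simp only [hf]
    rw [integral_add (continuous_integrable_of_le hg hG _).integrableOn
      (integrable_const _).integrableOn]
    simp [mul_comm]
  simp only [h4]
  exact ((hconv f hfc ⟨_, hfb⟩).mul h1).sub ((hreal hμ hfr).const_mul _)

/-- The local limit theorem: convergence of `√n E[f(S_n); S_n ∈ s]` for functions decaying at
least quadratically. -/
lemma tendsto_sqrt_mul_setIntegral_convPow {F : Measure ℝ} [IsProbabilityMeasure F] {σ : ℝ}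
    (hF : IsCenteredStep F σ) {f : ℝ → ℝ} (hf : Continuous f) {C : ℝ}
    (hb : ∀ x, |f x| ≤ C / (1 + x ^ 2)) {s : Set ℝ} (hs : MeasurableSet s)
    (hfr : volume (frontier s) = 0) :
    Tendsto (fun n : ℕ => √n * ∫ x in s, f x ∂(convPow F n)) atTop
      (𝓝 ((σ * √(2 * Real.pi))⁻¹ * ∫ x in s, f x)) := by
  have hσ := hF.pos
  have hpi := Real.pi_pos
  have hKi : ∀ P : Measure ℝ, [IsFiniteMeasure P] → Integrable posKernel P := fun P _ => by
    refine continuous_integrable_of_le (C := 24) continuous_posKernel (fun x => ?_) P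
    rw [abs_of_pos (posKernel_pos x)]
    refine (posKernel_le x).trans ?_
    rw [div_le_iff₀ (by positivity)]
    nlinarith [sq_nonneg x]
  let M : ℕ → ProbabilityMeasure ℝ := fun n =>
    ⟨(convPow F n).tilted fun x => Real.log (posKernel x),
      isProbabilityMeasure_tilted_log posKernel_pos (hKi _)⟩
  let M0 : ProbabilityMeasure ℝ := ⟨volume.tilted fun x => Real.log (posKernel x),
      isProbabilityMeasure_tilted_log posKernel_pos integrable_posKernel⟩
  have hhat0 : posKernelHat 0 = 2 := by simp [posKernelHat, tri_zero]; norm_num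
  have hK0 : ∫ x, posKernel x = 4 * Real.pi := by
    have h := integral_posKernel_exp 0
    simp only [Complex.ofReal_zero, zero_mul, Complex.exp_zero, mul_one, neg_zero, hhat0] at h
    rw [integral_complex_ofReal] at h
    have h' : ((∫ x, posKernel x : ℝ) : ℂ) = ((4 * Real.pi : ℝ) : ℂ) := by
      rw [h]; push_cast; ring
    exact_mod_cast h'
  have hchar : ∀ (n : ℕ) (u : ℝ), ∫ x, (posKernel x : ℂ) * Complex.exp (u * x * Complex.I)
      ∂(convPow F n) = ∫ t, posKernelHat (t - u) * charFun F t ^ n := by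
    intro n u
    have hprod : Integrable (Function.uncurry fun (x t : ℝ) =>
        posKernelHat (t - u) * Complex.exp (t * x * Complex.I)) ((convPow F n).prod volume) := by
      have h1 : Integrable (fun p : ℝ × ℝ => posKernelHat (p.2 - u))
          ((convPow F n).prod volume) := by
        have := (integrable_const (1 : ℂ) (μ := convPow F n)).mul_prod
          (integrable_posKernelHat.comp_sub_right u)
        simpa using this
      refine h1.mono (Continuous.aestronglyMeasurable ?_) (ae_of_all _ fun p => ?_)
      · have := continuous_posKernelHat
        unfold Function.uncurry
        fun_prop
      · simp only [Function.uncurry]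
        rw [norm_mul, ← Complex.ofReal_mul, Complex.norm_exp_ofReal_mul_I, mul_one]
    have h2 : ∀ x : ℝ, (posKernel x : ℂ) * Complex.exp (u * x * Complex.I)
        = ∫ t, posKernelHat (t - u) * Complex.exp (t * x * Complex.I) := by
      intro x
      rw [← integral_add_right_eq_self _ u, ← posKernel_eq_integral_exp, ← integral_mul_const]
      refine integral_congr_ae (ae_of_all _ fun t => ?_)
      simp only [add_sub_cancel_right]
      rw [mul_assoc, ← Complex.exp_add]
      push_cast
      ring_nf
    simp_rw [h2]
    rw [integral_integral_swap hprod]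
    refine integral_congr_ae (ae_of_all _ fun t => ?_)
    simp only []
    rw [integral_const_mul, ← charFun_apply_real, charFun_convPow]
  have hlim : ∀ u : ℝ, Tendsto (fun n : ℕ => (√n : ℂ) *
      ∫ x, (posKernel x : ℂ) * Complex.exp (u * x * Complex.I) ∂(convPow F n)) atTop
      (𝓝 (posKernelHat (-u) * (√(2 * Real.pi) / σ : ℝ))) := by
    intro u
    simp_rw [hchar]
    have := tendsto_sqrt_integral_charFun_pow hF
      (g := fun t => posKernelHat (t - u)) (continuous_posKernelHat.comp (by fun_prop))
      (R := 1 + |u|) (fun t ht => posKernelHat_eq_zero ?_)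
    · simpa using this
    · have := abs_sub_abs_le_abs_sub t u
      linarith
  have hm : Tendsto (fun n : ℕ => √n * ∫ x, posKernel x ∂(convPow F n)) atTop
      (𝓝 (2 * (√(2 * Real.pi) / σ))) := by
    have h := (Complex.continuous_re.tendsto _).comp (hlim 0)
    rw [neg_zero, hhat0, ← Complex.ofReal_ofNat, ← Complex.ofReal_mul, Complex.ofReal_re] at h
    refine h.congr fun n => ?_
    simp only [Complex.ofReal_zero, zero_mul, Complex.exp_zero, mul_one, Function.comp_apply]
    rw [integral_complex_ofReal, ← Complex.ofReal_mul, Complex.ofReal_re]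
  have hweak : Tendsto M atTop (𝓝 M0) := by
    rw [ProbabilityMeasure.tendsto_iff_tendsto_charFun]
    intro u
    have hc0 : (2 * (√(2 * Real.pi) / σ) : ℂ) ≠ 0 := by
      have : 2 * (√(2 * Real.pi) / σ) ≠ 0 := by positivity
      exact_mod_cast this
    have h1 := (hlim u).mul (((Complex.continuous_ofReal.tendsto _).comp hm).inv₀ (by
      push_cast; exact hc0))
    have h2 : charFun (M0 : Measure ℝ) u = posKernelHat (-u) * (√(2 * Real.pi) / σ : ℝ)
        * (((2 * (√(2 * Real.pi) / σ) : ℝ)) : ℂ)⁻¹ := by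
      rw [charFun_apply_real]
      simp only [M0, ProbabilityMeasure.coe_mk, integral_tilted_log posKernel_pos,
        Complex.real_smul]
      rw [integral_posKernel_exp, hK0]
      have h3 : ((√(2 * Real.pi) / σ : ℝ) : ℂ) ≠ 0 := by
        have : √(2 * Real.pi) / σ ≠ 0 := by positivity
        exact_mod_cast this
      have h4 : (Real.pi : ℂ) ≠ 0 := by exact_mod_cast hpi.ne'
      rw [Complex.ofReal_mul 2]
      generalize ((√(2 * Real.pi) / σ : ℝ) : ℂ) = z at h3
      push_cast
      field_simp
      norm_num
    rw [h2]
    refine h1.congr' ?_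
    filter_upwards [eventually_gt_atTop 0] with n hn
    rw [charFun_apply_real]
    simp only [M, ProbabilityMeasure.coe_mk, integral_tilted_log posKernel_pos,
        Complex.real_smul, Function.comp_apply]
    have : (√(n : ℝ) : ℂ) ≠ 0 := by
      have : √(n : ℝ) ≠ 0 := by positivity
      exact_mod_cast this
    generalize ∫ x, (posKernel x : ℂ) * Complex.exp (u * x * Complex.I) ∂(convPow F n) = z
    push_cast
    field_simp
  obtain ⟨c, hc, hlow⟩ := posKernel_lower
  have hC0 : 0 ≤ C := by
    have := (abs_nonneg _).trans (hb 0)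
    simpa using this
  have hq := tendsto_setIntegral_of_tendsto hweak
    (hf.div continuous_posKernel fun x => (posKernel_pos x).ne') (G := C / c) (fun x => ?_) hs (by
      simp only [M0, ProbabilityMeasure.coe_mk]
      exact tilted_absolutelyContinuous _ _ hfr)
  · have h5 : ∀ P : Measure ℝ, (hne : (∫ x, posKernel x ∂P) ≠ 0) →
        ∫ x in s, f x ∂P = (∫ x, posKernel x ∂P) *
          ∫ x in s, f x / posKernel x ∂(P.tilted fun x => Real.log (posKernel x)) := by
      intro P hne
      rw [← integral_indicator hs, ← integral_indicator hs, integral_tilted_log posKernel_pos,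
        smul_eq_mul, mul_inv_cancel_left₀ hne]
      refine integral_congr_ae (ae_of_all _ fun x => ?_)
      have := (posKernel_pos x).ne'
      by_cases hx : x ∈ s
      · simp [hx]
        field_simp
      · simp [hx]
    have h6 := hm.mul hq
    have h7 : 2 * (√(2 * Real.pi) / σ) * ∫ x in s, f x / posKernel x ∂(M0 : Measure ℝ)
        = (σ * √(2 * Real.pi))⁻¹ * ∫ x in s, f x := by
      rw [h5 volume (by rw [hK0]; positivity), hK0]
      simp only [M0, ProbabilityMeasure.coe_mk]
      have h8 : √(2 * Real.pi) * √(2 * Real.pi) = 2 * Real.pi :=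
        Real.mul_self_sqrt (by positivity)
      have h9 : √(2 * Real.pi) ≠ 0 := by positivity
      generalize ∫ x in s, f x / posKernel x ∂(volume.tilted fun x => Real.log (posKernel x)) = I
      field_simp
      rw [pow_two, h8]
      ring
    rw [← h7]
    refine h6.congr fun n => ?_
    rw [h5 (convPow F n) (ne_of_gt ?_)]
    · simp only [M, ProbabilityMeasure.coe_mk, Pi.div_apply]
      rw [mul_assoc]
    · rw [integral_pos_iff_support_of_nonneg (fun x => (posKernel_pos x).le) (hKi _)]
      have : Function.support posKernel = univ := by
        ext x; simp [(posKernel_pos x).ne']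
      simp [this]
  · rw [Pi.div_apply, abs_div, abs_of_pos (posKernel_pos x), div_le_iff₀ (posKernel_pos x)]
    refine (hb x).trans ?_
    have := mul_le_mul_of_nonneg_left (hlow x) (show 0 ≤ C / c by positivity)
    refine le_trans (le_of_eq ?_) this
    field_simp

lemma conv_null_compl {μ ν : Measure ℝ} [SFinite μ] [SFinite ν] {s t r : Set ℝ} (hr : MeasurableSet r)
    (hμ : μ sᶜ = 0) (hν : ν tᶜ = 0) (h : ∀ x ∈ s, ∀ y ∈ t, x + y ∈ r) :
    (μ.conv ν) rᶜ = 0 := by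
  rw [Measure.conv, Measure.map_apply (by fun_prop) hr.compl]
  refine measure_mono_null (t := sᶜ ×ˢ univ ∪ univ ×ˢ tᶜ) ?_ ?_
  · rintro ⟨x, y⟩ hxy
    by_contra hc
    simp only [mem_union, mem_prod, mem_compl_iff, mem_univ, and_true, true_and, not_or,
      not_not] at hc
    exact hxy (h x hc.1 y hc.2)
  · simp [Measure.prod_prod, hμ, hν]

/-- Convolution of two sequences of measures, both in the index and in the space variable. -/
def seqConv (M N : ℕ → Measure ℝ) (n : ℕ) : Measure ℝ :=
  ∑ p ∈ Finset.HasAntidiagonal.antidiagonal n, (M p.1).conv (N p.2)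

instance isFiniteMeasure_seqConv (M N : ℕ → Measure ℝ) [∀ n, IsFiniteMeasure (M n)]
    [∀ n, IsFiniteMeasure (N n)] (n : ℕ) : IsFiniteMeasure (seqConv M N n) := by
  unfold seqConv; infer_instance

lemma seqConv_null_compl {M N : ℕ → Measure ℝ} [∀ n, IsFiniteMeasure (M n)]
    [∀ n, IsFiniteMeasure (N n)] {s t r : Set ℝ} (hr : MeasurableSet r)
    (hM : ∀ n, M n sᶜ = 0) (hN : ∀ n, N n tᶜ = 0) (h : ∀ x ∈ s, ∀ y ∈ t, x + y ∈ r) (n : ℕ) :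
    seqConv M N n rᶜ = 0 := by
  simp only [seqConv, Measure.coe_finsetSum, Finset.sum_apply]
  exact Finset.sum_eq_zero fun p _ => conv_null_compl hr (hM _) (hN _) h

lemma charFun_add_measure (μ ν : Measure ℝ) [IsFiniteMeasure μ] [IsFiniteMeasure ν] (t : ℝ) :
    charFun (μ + ν) t = charFun μ t + charFun ν t := by
  have h (ρ : Measure ℝ) [IsFiniteMeasure ρ] :
      Integrable (fun x : ℝ => Complex.exp (t * x * Complex.I)) ρ := by
    refine Integrable.of_bound (C := 1) (by fun_prop) (ae_of_all _ fun x => ?_)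
    rw [← Complex.ofReal_mul, Complex.norm_exp_ofReal_mul_I]
  simp only [charFun_apply_real]
  exact integral_add_measure (h μ) (h ν)

lemma charFun_sum_measure {ι : Type*} (s : Finset ι) (M : ι → Measure ℝ)
    [∀ i, IsFiniteMeasure (M i)] (t : ℝ) :
    charFun (∑ i ∈ s, M i) t = ∑ i ∈ s, charFun (M i) t := by
  classical
  induction s using Finset.induction_on with
  | empty => simp
  | insert a s ha ih =>
    rw [Finset.sum_insert ha, Finset.sum_insert ha, charFun_add_measure, ih]

/-- The generating function of the characteristic functions of a sequence of measures. -/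
def ps (M : ℕ → Measure ℝ) (t : ℝ) : PowerSeries ℂ := PowerSeries.mk fun n => charFun (M n) t

lemma ps_inj {M N : ℕ → Measure ℝ} [∀ n, IsFiniteMeasure (M n)] [∀ n, IsFiniteMeasure (N n)]
    (h : ∀ t, ps M t = ps N t) (n : ℕ) : M n = N n := by
  refine Measure.ext_of_charFun (funext fun t => ?_)
  simpa [ps] using congrArg (PowerSeries.coeff n) (h t)

lemma ps_add (M N : ℕ → Measure ℝ) [∀ n, IsFiniteMeasure (M n)] [∀ n, IsFiniteMeasure (N n)]
    (t : ℝ) : ps (fun n => M n + N n) t = ps M t + ps N t := by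
  ext n; simp [ps, charFun_add_measure]

lemma ps_seqConv (M N : ℕ → Measure ℝ) [∀ n, IsFiniteMeasure (M n)] [∀ n, IsFiniteMeasure (N n)]
    (t : ℝ) : ps (seqConv M N) t = ps M t * ps N t := by
  ext n
  simp [ps, seqConv, PowerSeries.coeff_mul, charFun_sum_measure, charFun_conv]

/-- The sequence `n ↦ (n + 1) • M (n + 1)`. -/
def seqDeriv (M : ℕ → Measure ℝ) (n : ℕ) : Measure ℝ := (n + 1 : NNReal) • M (n + 1)

instance isFiniteMeasure_seqDeriv (M : ℕ → Measure ℝ) [∀ n, IsFiniteMeasure (M n)] (n : ℕ) :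
    IsFiniteMeasure (seqDeriv M n) := by
  unfold seqDeriv; infer_instance

lemma seqDeriv_null {M : ℕ → Measure ℝ} {s : Set ℝ} (h : ∀ n, M (n + 1) s = 0) (n : ℕ) :
    seqDeriv M n s = 0 := by
  simp [seqDeriv, h]

lemma ps_seqDeriv (M : ℕ → Measure ℝ) (t : ℝ) :
    ps (seqDeriv M) t = PowerSeries.derivative ℂ (ps M t) := by
  ext n
  simp only [ps, seqDeriv, PowerSeries.coeff_mk, PowerSeries.coeff_derivative, charFun_apply_real,
    integral_smul_nnreal_measure]
  rw [NNReal.smul_def, Complex.real_smul, mul_comm]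
  simp

/-- The law of the walk with step `F` started from `x`, killed when it leaves `s`. -/
def killed (F : Measure ℝ) (s : Set ℝ) (x : Measure ℝ) : ℕ → Measure ℝ
  | 0 => x
  | n + 1 => ((killed F s x n).conv F).restrict s

/-- The law of the walk with step `F` started from `x` at the time it leaves `s`. -/
def exitLaw (F : Measure ℝ) (s : Set ℝ) (x : Measure ℝ) : ℕ → Measure ℝ
  | 0 => 0
  | n + 1 => ((killed F s x n).conv F).restrict sᶜ

section WienerHopf

variable (F : Measure ℝ)

lemma killed_succ_null {s : Set ℝ} (hs : MeasurableSet s) (x : Measure ℝ) (n : ℕ) :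
    killed F s x (n + 1) sᶜ = 0 := by
  rw [killed, Measure.restrict_apply hs.compl]; simp

lemma exitLaw_null {s : Set ℝ} (hs : MeasurableSet s) (x : Measure ℝ) (n : ℕ) :
    exitLaw F s x n s = 0 := by
  cases n with
  | zero => simp [exitLaw]
  | succ n => rw [exitLaw, Measure.restrict_apply hs]; simp

/-- Laws of the walk on the event that it is non-negative up to time `n`. -/
abbrev posLaw : ℕ → Measure ℝ := killed F (Ici 0) (Measure.dirac 0)

/-- Laws of the walk on the event that it is negative at times `1, ..., n`. -/
abbrev negLaw : ℕ → Measure ℝ := killed F (Iio 0) (Measure.dirac 0)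

lemma posLaw_null (n : ℕ) : posLaw F n (Ici 0)ᶜ = 0 := by
  cases n with
  | zero => simp [posLaw, killed]
  | succ n => exact killed_succ_null F measurableSet_Ici _ n

lemma negLaw_null (n : ℕ) : negLaw F n (Iic 0)ᶜ = 0 := by
  cases n with
  | zero => simp [negLaw, killed]
  | succ n =>
    exact measure_mono_null (compl_subset_compl.2 Iio_subset_Iic_self)
      (killed_succ_null F measurableSet_Iio _ n)

variable [IsProbabilityMeasure F]

instance isFiniteMeasure_killed (s : Set ℝ) (x : Measure ℝ) [IsFiniteMeasure x] (n : ℕ) :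
    IsFiniteMeasure (killed F s x n) := by
  induction n with
  | zero => simpa [killed]
  | succ n ih => rw [killed]; infer_instance

instance isFiniteMeasure_exitLaw (s : Set ℝ) (x : Measure ℝ) [IsFiniteMeasure x] (n : ℕ) :
    IsFiniteMeasure (exitLaw F s x n) := by
  cases n with
  | zero => rw [exitLaw]; infer_instance
  | succ n => rw [exitLaw]; infer_instance

lemma ps_killed {s : Set ℝ} (hs : MeasurableSet s) (x : Measure ℝ) [IsFiniteMeasure x] (t : ℝ) :
    ps (killed F s x) t * (1 - PowerSeries.C (charFun F t) * PowerSeries.X) =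
      PowerSeries.C (charFun x t) - ps (exitLaw F s x) t := by
  ext n
  rw [mul_sub, mul_one, ← mul_assoc, map_sub, map_sub]
  cases n with
  | zero => simp [ps, killed, exitLaw, PowerSeries.coeff_zero_mul_X]
  | succ n =>
    rw [PowerSeries.coeff_succ_mul_X, PowerSeries.coeff_mul_C]
    have h : charFun (killed F s x n) t * charFun F t =
        charFun (killed F s x (n + 1)) t + charFun (exitLaw F s x (n + 1)) t := by
      rw [← charFun_conv, ← charFun_add_measure, killed, exitLaw, Measure.restrict_add_restrict_compl hs]
    simp only [ps, PowerSeries.coeff_mk, h, PowerSeries.coeff_C, Nat.succ_ne_zero, if_false]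
    ring

lemma restrict_eq_self_of_null {μ : Measure ℝ} {s : Set ℝ} (h : μ sᶜ = 0) : μ.restrict s = μ :=
  Measure.restrict_eq_self_of_ae_mem (by rwa [ae_iff])

lemma wienerHopf_aux (t : ℝ) :
    ps (posLaw F) t * (1 - ps (exitLaw F (Iio 0) (.dirac 0)) t) =
      ps (negLaw F) t * (1 - ps (exitLaw F (Ici 0) (.dirac 0)) t) := by
  have h1 := ps_killed F measurableSet_Ici (Measure.dirac 0) (s := Ici 0) t
  have h2 := ps_killed F measurableSet_Iio (Measure.dirac 0) (s := Iio 0) t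
  simp only [charFun_dirac, inner_zero_left, Complex.ofReal_zero, zero_mul, Complex.exp_zero,
    map_one] at h1 h2
  rw [← h1, ← h2]; ring

lemma wienerHopf_neg (t : ℝ) :
    ps (negLaw F) t * (1 - ps (exitLaw F (Ici 0) (.dirac 0)) t) = 1 := by
  set α := exitLaw F (Ici 0) (.dirac 0)
  set β := exitLaw F (Iio 0) (.dirac 0)
  have hα (n) : α n (Iio 0)ᶜ = 0 := by
    rw [compl_Iio]; exact exitLaw_null F measurableSet_Ici _ n
  have hβ (n) : β n (Ici 0)ᶜ = 0 := by
    rw [compl_Ici]; exact exitLaw_null F measurableSet_Iio _ n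
  have key (n) : negLaw F n + seqConv (posLaw F) β n = posLaw F n + seqConv (negLaw F) α n :=
    ps_inj (M := fun n => negLaw F n + seqConv (posLaw F) β n)
      (N := fun n => posLaw F n + seqConv (negLaw F) α n) (fun t => by
      rw [ps_add, ps_add, ps_seqConv, ps_seqConv]
      linear_combination -(wienerHopf_aux F t)) n
  have h1 (n) : (seqConv (posLaw F) β n).restrict (Iio 0) = 0 := by
    have := seqConv_null_compl measurableSet_Ici (posLaw_null F) hβ
      (fun x hx y hy => mem_Ici.2 (add_nonneg (mem_Ici.1 hx) (mem_Ici.1 hy)) : ∀ x ∈ Ici (0:ℝ), ∀ y ∈ Ici (0:ℝ), x + y ∈ Ici (0:ℝ)) n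
    rwa [Measure.restrict_eq_zero, ← compl_Ici]
  have h2 (n) : (seqConv (negLaw F) α n).restrict (Iio 0) = seqConv (negLaw F) α n :=
    restrict_eq_self_of_null (seqConv_null_compl measurableSet_Iio (negLaw_null F) hα
      (fun x hx y hy => mem_Iio.2 (add_neg_of_nonpos_of_neg (mem_Iic.1 hx) (mem_Iio.1 hy)) :
        ∀ x ∈ Iic (0:ℝ), ∀ y ∈ Iio (0:ℝ), x + y ∈ Iio (0:ℝ)) n)
  have h3 (n) : (posLaw F n).restrict (Iio 0) = 0 := by
    rw [Measure.restrict_eq_zero, ← compl_Ici]; exact posLaw_null F n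
  have key' (n) : (negLaw F n).restrict (Iio 0) = seqConv (negLaw F) α n := by
    simpa only [Measure.restrict_add, h1, h2, h3, add_zero, zero_add] using
      congrArg (fun μ => μ.restrict (Iio 0)) (key n)
  have : ps (negLaw F) t = 1 + ps (seqConv (negLaw F) α) t := by
    ext n
    cases n with
    | zero =>
      have : (Measure.dirac (0 : ℝ)).restrict (Iio 0) = 0 := by simp [Measure.restrict_eq_zero]
      simp [ps, ← key', negLaw, killed, this]
    | succ n =>
      simp only [ps, PowerSeries.coeff_mk, ← key', map_add, PowerSeries.coeff_one,
        Nat.succ_ne_zero, if_false, zero_add]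
      rw [restrict_eq_self_of_null (killed_succ_null F measurableSet_Iio _ n)]
  rw [ps_seqConv] at this
  linear_combination this

lemma wienerHopf_pos (t : ℝ) :
    ps (posLaw F) t * (1 - ps (exitLaw F (Iio 0) (.dirac 0)) t) = 1 := by
  rw [wienerHopf_aux, wienerHopf_neg]

lemma wienerHopf_prod (t : ℝ) : ps (posLaw F) t * ps (negLaw F) t *
    (1 - PowerSeries.C (charFun F t) * PowerSeries.X) = 1 := by
  have h1 := ps_killed F measurableSet_Ici (Measure.dirac 0) (s := Ici 0) t
  simp only [charFun_dirac, inner_zero_left, Complex.ofReal_zero, zero_mul, Complex.exp_zero,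
    map_one] at h1
  linear_combination ps (negLaw F) t * h1 + wienerHopf_neg F t

lemma ps_restrict_convPow {s : Set ℝ} (hs : MeasurableSet s) (t : ℝ) :
    ps (fun i => (convPow F (i + 1)).restrict s) t +
      ps (fun i => (convPow F (i + 1)).restrict sᶜ) t =
    PowerSeries.C (charFun F t) * (ps (posLaw F) t * ps (negLaw F) t) := by
  have : (ps (fun i => (convPow F (i + 1)).restrict s) t +
      ps (fun i => (convPow F (i + 1)).restrict sᶜ) t) *
      (1 - PowerSeries.C (charFun F t) * PowerSeries.X) = PowerSeries.C (charFun F t) := by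
    rw [← ps_add]
    simp only [Measure.restrict_add_restrict_compl hs]
    ext n
    rw [mul_sub, mul_one, ← mul_assoc, map_sub]
    cases n with
    | zero => simp [ps, charFun_convPow]
    | succ n =>
      rw [PowerSeries.coeff_succ_mul_X, PowerSeries.coeff_mul_C]
      simp [ps, charFun_convPow, pow_succ]
  linear_combination (ps (posLaw F) t * ps (negLaw F) t) * this -
    (ps (fun i => (convPow F (i + 1)).restrict s) t +
      ps (fun i => (convPow F (i + 1)).restrict sᶜ) t) * wienerHopf_prod F t

lemma wienerHopf_deriv (n : ℕ) :
    seqDeriv (posLaw F) n = seqConv (fun i => (convPow F (i + 1)).restrict (Ici 0)) (posLaw F) n ∧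
    seqDeriv (negLaw F) n = seqConv (fun i => (convPow F (i + 1)).restrict (Iio 0)) (negLaw F) n := by
  set α := exitLaw F (Ici 0) (.dirac 0)
  set β := exitLaw F (Iio 0) (.dirac 0)
  set C := fun i => (convPow F (i + 1)).restrict (Ici 0)
  set D := fun i => (convPow F (i + 1)).restrict (Iio 0)
  have hα (n) : α n (Iio 0)ᶜ = 0 := by
    rw [compl_Iio]; exact exitLaw_null F measurableSet_Ici _ n
  have hβ (n) : β n (Ici 0)ᶜ = 0 := by
    rw [compl_Ici]; exact exitLaw_null F measurableSet_Iio _ n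
  have hC (n) : C n (Ici 0)ᶜ = 0 := by
    simp only [C]; rw [Measure.restrict_apply measurableSet_Ici.compl, compl_inter_self, measure_empty]
  have hD (n) : D n (Iio 0)ᶜ = 0 := by
    simp only [D]; rw [Measure.restrict_apply measurableSet_Iio.compl, compl_inter_self, measure_empty]
  have hA' (n) : seqDeriv (posLaw F) n (Ici 0)ᶜ = 0 := seqDeriv_null (fun n => posLaw_null F _) n
  have hB' (n) : seqDeriv (negLaw F) n (Iio 0)ᶜ = 0 :=
    seqDeriv_null (fun n => killed_succ_null F measurableSet_Iio _ n) n
  have hAβ (n) : seqConv (seqDeriv (posLaw F)) β n (Ici 0)ᶜ = 0 :=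
    seqConv_null_compl measurableSet_Ici hA' hβ
      (fun x hx y hy => mem_Ici.2 (add_nonneg (mem_Ici.1 hx) (mem_Ici.1 hy)) : ∀ x ∈ Ici (0:ℝ), ∀ y ∈ Ici (0:ℝ), x + y ∈ Ici (0:ℝ)) n
  have hBα (n) : seqConv (seqDeriv (negLaw F)) α n (Iio 0)ᶜ = 0 :=
    seqConv_null_compl measurableSet_Iio hB' hα
      (fun x hx y hy => mem_Iio.2 (add_neg (mem_Iio.1 hx) (mem_Iio.1 hy)) : ∀ x ∈ Iio (0:ℝ), ∀ y ∈ Iio (0:ℝ), x + y ∈ Iio (0:ℝ)) n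
  have hG (t) : ps C t + ps D t =
      PowerSeries.C (charFun F t) * (ps (posLaw F) t * ps (negLaw F) t) := by
    have := ps_restrict_convPow F (measurableSet_Ici (a := (0:ℝ))) t
    rwa [compl_Ici] at this
  have hder (t) : ps (seqDeriv (posLaw F)) t * ps (negLaw F) t +
      ps (posLaw F) t * ps (seqDeriv (negLaw F)) t =
      (ps C t + ps D t) * (ps (posLaw F) t * ps (negLaw F) t) := by
    have h := congrArg (PowerSeries.derivative ℂ) (wienerHopf_prod F t)
    simp only [Derivation.leibniz, smul_eq_mul, map_sub, Derivation.map_one_eq_zero,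
      PowerSeries.derivative_C, PowerSeries.derivative_X, zero_sub, mul_zero, mul_one, add_zero] at h
    rw [← ps_seqDeriv, ← ps_seqDeriv] at h
    rw [hG]
    have hp := wienerHopf_prod F t
    linear_combination (ps (posLaw F) t * ps (negLaw F) t) * h - (ps (seqDeriv (posLaw F)) t * ps (negLaw F) t +
      ps (posLaw F) t * ps (seqDeriv (negLaw F)) t) * hp
  have key (n) : (seqDeriv (posLaw F) n + seqDeriv (negLaw F) n) =
      (C n + D n) + (seqConv (seqDeriv (posLaw F)) β n + seqConv (seqDeriv (negLaw F)) α n) :=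
    ps_inj (M := fun n => seqDeriv (posLaw F) n + seqDeriv (negLaw F) n)
      (N := fun n => (C n + D n) + (seqConv (seqDeriv (posLaw F)) β n + seqConv (seqDeriv (negLaw F)) α n))
      (fun t => by
      have ha := wienerHopf_pos F t
      have hb := wienerHopf_neg F t
      rw [ps_add (seqDeriv (posLaw F)) (seqDeriv (negLaw F)), ps_add (fun n => C n + D n) (fun n => seqConv (seqDeriv (posLaw F)) β n + seqConv (seqDeriv (negLaw F)) α n), ps_add C D, ps_add (seqConv (seqDeriv (posLaw F)) β) (seqConv (seqDeriv (negLaw F)) α), ps_seqConv, ps_seqConv]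
      change ps (posLaw F) t * (1 - ps β t) = 1 at ha
      change ps (negLaw F) t * (1 - ps α t) = 1 at hb
      linear_combination (1 - ps α t) * (1 - ps β t) * hder t
        - ps (seqDeriv (posLaw F)) t * (1 - ps β t) * hb
        - ps (seqDeriv (negLaw F)) t * (1 - ps α t) * ha
        + (ps C t + ps D t) * (ps (negLaw F) t * (1 - ps α t) * ha + hb)) n
  have null {μ : Measure ℝ} (h : μ (Iio 0)ᶜ = 0) : μ.restrict (Ici 0) = 0 := by
    rwa [Measure.restrict_eq_zero, ← compl_Iio]
  have null' {μ : Measure ℝ} (h : μ (Ici 0)ᶜ = 0) : μ.restrict (Iio 0) = 0 := by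
    rwa [Measure.restrict_eq_zero, ← compl_Ici]
  have k1 (n) : seqDeriv (posLaw F) n = C n + seqConv (seqDeriv (posLaw F)) β n := by
    have := congrArg (fun μ => μ.restrict (Ici 0)) (key n)
    simpa only [Measure.restrict_add, null (hB' n), null (hD n), null (hBα n),
      restrict_eq_self_of_null (hA' n), restrict_eq_self_of_null (hC n),
      restrict_eq_self_of_null (hAβ n), add_zero] using this
  have k2 (n) : seqDeriv (negLaw F) n = D n + seqConv (seqDeriv (negLaw F)) α n := by
    have := congrArg (fun μ => μ.restrict (Iio 0)) (key n)
    simpa only [Measure.restrict_add, null' (hA' n), null' (hC n), null' (hAβ n),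
      restrict_eq_self_of_null (hB' n), restrict_eq_self_of_null (hD n),
      restrict_eq_self_of_null (hBα n), zero_add] using this
  constructor
  · refine ps_inj (fun t => ?_) n
    have h : ps (seqDeriv (posLaw F)) t = ps C t + ps (seqDeriv (posLaw F)) t * ps β t := by
      rw [← ps_seqConv, ← ps_add]; exact congrArg (ps · t) (funext k1)
    have ha : ps (posLaw F) t * (1 - ps β t) = 1 := wienerHopf_pos F t
    rw [ps_seqConv]
    linear_combination ps (posLaw F) t * h - ps (seqDeriv (posLaw F)) t * ha
  · refine ps_inj (fun t => ?_) n
    have h : ps (seqDeriv (negLaw F)) t = ps D t + ps (seqDeriv (negLaw F)) t * ps α t := by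
      rw [← ps_seqConv, ← ps_add]; exact congrArg (ps · t) (funext k2)
    have ha : ps (negLaw F) t * (1 - ps α t) = 1 := wienerHopf_neg F t
    rw [ps_seqConv]
    linear_combination ps (negLaw F) t * h - ps (seqDeriv (negLaw F)) t * ha

lemma killed_dirac_eq {x : ℝ} (hx : 0 ≤ x) (n : ℕ) :
    killed F (Ici 0) (.dirac x) n =
      seqConv (fun i => ((Measure.dirac x).conv (negLaw F i)).restrict (Ici 0)) (posLaw F) n := by
  set β := exitLaw F (Iio 0) (.dirac 0)
  set o := exitLaw F (Ici 0) (.dirac x)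
  set W := killed F (Ici 0) (.dirac x)
  set b := fun i => ((Measure.dirac x).conv (negLaw F i)).restrict (Ici 0)
  have hβ (n) : β n (Ici 0)ᶜ = 0 := by
    rw [compl_Ici]; exact exitLaw_null F measurableSet_Iio _ n
  have ho (n) : o n (Iio 0)ᶜ = 0 := by
    rw [compl_Iio]; exact exitLaw_null F measurableSet_Ici _ n
  have hW (n) : W n (Ici 0)ᶜ = 0 := by
    cases n with
    | zero => simp [W, killed, hx]
    | succ n => exact killed_succ_null F measurableSet_Ici _ n
  have key (n) : W n + seqConv o (negLaw F) n =
      (Measure.dirac x).conv (negLaw F n) + seqConv W β n :=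
    ps_inj (M := fun n => W n + seqConv o (negLaw F) n)
      (N := fun n => (Measure.dirac x).conv (negLaw F n) + seqConv W β n) (fun t => by
      have h1 := ps_killed F measurableSet_Ici (Measure.dirac x) (s := Ici 0) t
      have h2 := ps_killed F measurableSet_Iio (Measure.dirac 0) (s := Iio 0) t
      simp only [charFun_dirac, inner_zero_left, Complex.ofReal_zero, zero_mul, Complex.exp_zero,
        map_one] at h2
      have h3 : ps (fun n => (Measure.dirac x).conv (negLaw F n)) t =
          PowerSeries.C (charFun (.dirac x) t) * ps (negLaw F) t := by
        ext n; simp [ps, charFun_conv]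
      rw [ps_add, ps_add, ps_seqConv, ps_seqConv, h3]
      change ps W t * _ = _ - ps o t at h1
      change ps (negLaw F) t * _ = 1 - ps β t at h2
      linear_combination ps (negLaw F) t * h1 - ps W t * h2) n
  have h1 (n) : (seqConv o (negLaw F) n).restrict (Ici 0) = 0 := by
    have := seqConv_null_compl measurableSet_Iio ho (negLaw_null F)
      (fun x hx y hy => mem_Iio.2 (add_neg_of_neg_of_nonpos (mem_Iio.1 hx) (mem_Iic.1 hy)) :
        ∀ x ∈ Iio (0:ℝ), ∀ y ∈ Iic (0:ℝ), x + y ∈ Iio (0:ℝ)) n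
    rwa [Measure.restrict_eq_zero, ← compl_Iio]
  have h2 (n) : (seqConv W β n).restrict (Ici 0) = seqConv W β n :=
    restrict_eq_self_of_null (seqConv_null_compl measurableSet_Ici hW hβ
      (fun x hx y hy => mem_Ici.2 (add_nonneg (mem_Ici.1 hx) (mem_Ici.1 hy)) : ∀ x ∈ Ici (0:ℝ), ∀ y ∈ Ici (0:ℝ), x + y ∈ Ici (0:ℝ)) n)
  have k (n) : W n = b n + seqConv W β n := by
    simpa only [Measure.restrict_add, h1, h2, restrict_eq_self_of_null (hW n), add_zero] using
      congrArg (fun μ => μ.restrict (Ici 0)) (key n)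
  refine ps_inj (fun t => ?_) n
  have h : ps W t = ps b t + ps W t * ps β t := by
    rw [← ps_seqConv, ← ps_add]; exact congrArg (ps · t) (funext k)
  have ha : ps (posLaw F) t * (1 - ps β t) = 1 := wienerHopf_pos F t
  rw [ps_seqConv]
  linear_combination ps (posLaw F) t * h - ps W t * ha

end WienerHopf

/-- The weight `(n + 1) ^ (-3/2)`. -/
def wt (n : ℕ) : ℝ := ((n + 1) * √(n + 1))⁻¹

lemma wt_pos (n : ℕ) : 0 < wt n := by unfold wt; positivity

lemma wt_eq_rpow (n : ℕ) : wt n = 1 / ((n + 1 : ℕ) : ℝ) ^ (3 / 2 : ℝ) := by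
  have h : (0 : ℝ) < n + 1 := by positivity
  rw [wt, one_div, Real.sqrt_eq_rpow]
  push_cast
  rw [show (3 / 2 : ℝ) = 1 + 1 / 2 by norm_num, Real.rpow_add h, Real.rpow_one]

lemma summable_wt : Summable wt := by
  have h : Summable fun n : ℕ => 1 / (n : ℝ) ^ (3 / 2 : ℝ) :=
    Real.summable_one_div_nat_rpow.2 (by norm_num)
  simpa only [← wt_eq_rpow] using (summable_nat_add_iff 1).2 h

lemma sqrt_le_two_mul_sqrt {n i : ℕ} (h : n ≤ 2 * i) : √((n : ℝ) + 1) ≤ 2 * √(i + 1) := by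
  have h' : (n : ℝ) ≤ 2 * i := by exact_mod_cast h
  rw [Real.sqrt_le_left (by positivity), mul_pow, Real.sq_sqrt (by positivity)]
  linarith

lemma inv_sqrt_le {n i : ℕ} (h : n ≤ 2 * i) : (√((i : ℝ) + 1))⁻¹ ≤ 2 * (√(n + 1))⁻¹ := by
  rw [← div_eq_mul_inv, inv_eq_one_div, div_le_div_iff₀ (by positivity) (by positivity), one_mul]
  exact sqrt_le_two_mul_sqrt h

lemma wt_half {n i : ℕ} (h : n ≤ 2 * i) : wt i ≤ 4 * wt n := by
  have h' : (n : ℝ) ≤ 2 * i := by exact_mod_cast h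
  rw [wt, wt, ← div_eq_mul_inv, inv_eq_one_div, div_le_div_iff₀ (by positivity) (by positivity), one_mul]
  calc ((n : ℝ) + 1) * √(n + 1) ≤ (2 * (i + 1)) * (2 * √(i + 1)) := by
        gcongr ?_ * ?_
        · linarith
        · exact sqrt_le_two_mul_sqrt h
    _ = _ := by ring

lemma wt_mul_wt_le (i j : ℕ) : wt i * wt j ≤ 4 * wt (i + j) * (wt i + wt j) := by
  rcases le_total i j with h | h
  · have := wt_half (n := i + j) (i := j) (by omega)
    nlinarith [wt_pos i, wt_pos j, wt_pos (i + j)]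
  · have := wt_half (n := i + j) (i := i) (by omega)
    nlinarith [wt_pos i, wt_pos j, wt_pos (i + j)]

lemma sum_wt_le (n : ℕ) : ∑ i ∈ Finset.range n, wt i ≤ ∑' i, wt i :=
  summable_wt.sum_le_tsum _ fun i _ => (wt_pos i).le

lemma sum_wt_mul_wt_le : ∃ C > 0, ∀ n : ℕ,
    ∑ i ∈ Finset.range (n + 1), wt i * wt (n - i) ≤ C * wt n := by
  refine ⟨8 * ∑' i, wt i, mul_pos (by norm_num) (summable_wt.tsum_pos (fun i => (wt_pos i).le) 0 (wt_pos 0)), fun n => ?_⟩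
  have h1 : ∑ i ∈ Finset.range (n + 1), wt i * wt (n - i) ≤
      ∑ i ∈ Finset.range (n + 1), 4 * wt n * (wt i + wt (n - i)) := by
    refine Finset.sum_le_sum fun i hi => ?_
    have := wt_mul_wt_le i (n - i)
    rwa [Nat.add_sub_cancel' (by simpa [Nat.lt_succ_iff] using hi)] at this
  have h2 : ∑ i ∈ Finset.range (n + 1), wt (n - i) = ∑ i ∈ Finset.range (n + 1), wt i := by
    simpa using Finset.sum_range_reflect wt (n + 1)
  rw [← Finset.mul_sum, Finset.sum_add_distrib, h2] at h1
  nlinarith [sum_wt_le (n + 1), wt_pos n]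

lemma sum_inv_sqrt_le (n : ℕ) : ∑ i ∈ Finset.range n, (√((i : ℝ) + 1))⁻¹ ≤ 2 * √n := by
  induction n with
  | zero => simp
  | succ n ih =>
    rw [Finset.sum_range_succ]
    push_cast
    have h0 : 0 < √((n : ℝ) + 1) := by positivity
    have h1 : √((n : ℝ) + 1) ^ 2 = n + 1 := Real.sq_sqrt (by positivity)
    have h2 : √(n : ℝ) ^ 2 = n := Real.sq_sqrt (by positivity)
    have h3 : (√((n : ℝ) + 1))⁻¹ ≤ 2 * √(n + 1) - 2 * √n := by
      rw [inv_eq_one_div, div_le_iff₀ h0]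
      nlinarith [sq_nonneg (√((n : ℝ) + 1) - √n)]
    linarith

lemma sqrt_mul_sum_inv_sqrt_mul_wt_le (n : ℕ) :
    √((n : ℝ) + 1) * ((∑ i ∈ Finset.range (n + 1), (√((i : ℝ) + 1))⁻¹) * wt n) ≤ 2 / √(n + 1) := by
  have h := sum_inv_sqrt_le (n + 1)
  push_cast at h
  have h0 : 0 < √((n : ℝ) + 1) := by positivity
  have h1 : √((n : ℝ) + 1) * √((n : ℝ) + 1) = n + 1 := Real.mul_self_sqrt (by positivity)
  calc _ ≤ √((n : ℝ) + 1) * ((2 * √(n + 1)) * wt n) := by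
        gcongr
        exact (wt_pos n).le
    _ = _ := by
        rw [wt]
        have : ((n : ℝ) + 1) ≠ 0 := by positivity
        field_simp
        rw [sq, h1]

/-- A solution of a convolution inequality with kernel of order `n ^ (-1/2)` decays like
`n ^ (-3/2)`. -/
lemma le_wt_of_conv_le {v p : ℕ → ℝ} {c U : ℝ} (hc : 0 ≤ c) (hU : 0 ≤ U) (hp0 : ∀ j, 0 ≤ p j)
    (hpU : ∀ n, ∑ j ∈ Finset.range (n + 1), p j ≤ U) (hp : ∀ j, p j ≤ 2 * U / (j + 1))
    (hv : ∀ n : ℕ, (n + 1) * v (n + 1) ≤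
      ∑ j ∈ Finset.range (n + 1), c * (√(((n - j : ℕ) : ℝ) + 1))⁻¹ * p j) (n : ℕ) :
    v (n + 1) ≤ 40 * c * U * wt (n + 1) := by
  have h1 : ∀ j ∈ Finset.range (n + 1), c * (√(((n - j : ℕ) : ℝ) + 1))⁻¹ * p j ≤
      c * (2 * (√(n + 1))⁻¹) * p j + c * (√(((n - j : ℕ) : ℝ) + 1))⁻¹ * (4 * U / (n + 1)) := by
    intro j hj
    have hj' : j ≤ n := by simpa [Nat.lt_succ_iff] using hj
    have ha : 0 ≤ (√(((n - j : ℕ) : ℝ) + 1))⁻¹ := by positivity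
    rcases le_total (2 * j) n with h | h
    · have := inv_sqrt_le (n := n) (i := n - j) (by omega)
      have h2 : c * (√(((n - j : ℕ) : ℝ) + 1))⁻¹ * p j ≤ c * (2 * (√(n + 1))⁻¹) * p j := by
        gcongr
        exact hp0 j
      have : 0 ≤ c * (√(((n - j : ℕ) : ℝ) + 1))⁻¹ * (4 * U / (n + 1)) := by positivity
      linarith
    · have h2 : p j ≤ 4 * U / (n + 1) := by
        refine (hp j).trans ?_
        rw [div_le_div_iff₀ (by positivity) (by positivity)]
        have : (n : ℝ) ≤ 2 * j := by exact_mod_cast h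
        nlinarith
      have h3 : c * (√(((n - j : ℕ) : ℝ) + 1))⁻¹ * p j ≤
        c * (√(((n - j : ℕ) : ℝ) + 1))⁻¹ * (4 * U / (n + 1)) := by gcongr
      have : 0 ≤ c * (2 * (√((n : ℝ) + 1))⁻¹) * p j := mul_nonneg (by positivity) (hp0 j)
      linarith
  have h2 := (hv n).trans (Finset.sum_le_sum h1)
  rw [Finset.sum_add_distrib, ← Finset.mul_sum, ← Finset.sum_mul, ← Finset.mul_sum] at h2
  have h3 : ∑ j ∈ Finset.range (n + 1), (√(((n - j : ℕ) : ℝ) + 1))⁻¹ =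
      ∑ j ∈ Finset.range (n + 1), (√((j : ℝ) + 1))⁻¹ := by
    simpa using Finset.sum_range_reflect (fun j : ℕ => (√((j : ℝ) + 1))⁻¹) (n + 1)
  rw [h3] at h2
  have h4 := sum_inv_sqrt_le (n + 1)
  push_cast at h4
  have h5 : c * (2 * (√((n : ℝ) + 1))⁻¹) * ∑ j ∈ Finset.range (n + 1), p j ≤
      c * (2 * (√((n : ℝ) + 1))⁻¹) * U := by gcongr; exact hpU n
  have h6 : (c * ∑ j ∈ Finset.range (n + 1), (√((j : ℝ) + 1))⁻¹) * (4 * U / (n + 1)) ≤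
      (c * (2 * √(n + 1))) * (4 * U / (n + 1)) := by gcongr
  have h0 : 0 < √((n : ℝ) + 1) := by positivity
  have hs : √((n : ℝ) + 1) ^ 2 = n + 1 := Real.sq_sqrt (by positivity)
  have h7 : (c * (2 * √((n : ℝ) + 1))) * (4 * U / (n + 1)) = 8 * c * U * (√((n : ℝ) + 1))⁻¹ := by
    field_simp
    linear_combination (8 * c * U) * hs
  have h8 : (n + 1) * v (n + 1) ≤ 10 * c * U * (√((n : ℝ) + 1))⁻¹ := by linarith
  have h9 : v (n + 1) ≤ 10 * c * U * wt n := by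
    have : v (n + 1) ≤ (10 * c * U * (√((n : ℝ) + 1))⁻¹) / (n + 1) := by
      rw [le_div_iff₀ (by positivity)]; linarith
    refine this.trans (le_of_eq ?_)
    rw [wt]; field_simp
  rcases Nat.eq_zero_or_pos n with rfl | hn
  · refine h9.trans ?_
    have : wt 0 ≤ 4 * wt 1 := by
      simp only [wt]
      norm_num
      rw [inv_mul_eq_div, mul_div_assoc', le_div_iff₀ (by positivity)]
      nlinarith [Real.sqrt_nonneg 2, Real.sq_sqrt (show (0:ℝ) ≤ 2 by norm_num), Real.sqrt_le_left (x := 2) (y := 2) (by norm_num)]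
    nlinarith [mul_nonneg hc hU]
  · have := wt_half (n := n + 1) (i := n) (by omega)
    nlinarith [mul_nonneg hc hU]

lemma sum_le_exp_of_conv_eq {m d : ℕ → ℝ} (hm0 : m 0 = 1) (hm : ∀ n, 0 ≤ m n) (hd : ∀ n, 0 ≤ d n)
    (h : ∀ n : ℕ, (n + 1) * m (n + 1) = ∑ j ∈ Finset.range (n + 1), d (n - j) * m j) (N : ℕ) :
    ∑ j ∈ Finset.range (N + 1), m j ≤ Real.exp (∑ k ∈ Finset.range N, d k / (k + 1)) := by
  set p : ℝ → ℝ := fun x => ∑ j ∈ Finset.range (N + 1), m j * x ^ j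
  set D : ℝ → ℝ := fun x => ∑ k ∈ Finset.range N, d k / (k + 1) * x ^ (k + 1)
  set p' : ℝ → ℝ := fun x => ∑ n ∈ Finset.range N, (n + 1) * m (n + 1) * x ^ n
  set D' : ℝ → ℝ := fun x => ∑ k ∈ Finset.range N, d k * x ^ k
  have hp (x : ℝ) : HasDerivAt p (p' x) x := by
    have : HasDerivAt p (∑ j ∈ Finset.range (N + 1), m j * (j * x ^ (j - 1))) x :=
      HasDerivAt.fun_sum fun j _ => (hasDerivAt_pow j x).const_mul (m j)
    rw [Finset.sum_range_succ'] at this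
    convert this using 1
    simp only [p']
    simp
    exact Finset.sum_congr rfl fun i _ => by ring
  have hD (x : ℝ) : HasDerivAt D (D' x) x := by
    have : HasDerivAt D (∑ k ∈ Finset.range N, d k / (k + 1) * ((k + 1 : ℕ) * x ^ (k + 1 - 1))) x :=
      HasDerivAt.fun_sum fun k _ => (hasDerivAt_pow (k + 1) x).const_mul _
    convert this using 1
    refine Finset.sum_congr rfl fun k _ => ?_
    have : (k : ℝ) + 1 ≠ 0 := by positivity
    push_cast
    field_simp
  have hle (x : ℝ) (hx : 0 ≤ x) : p' x ≤ D' x * p x := by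
    have e1 : p' x = ∑ n ∈ Finset.range N, ∑ j ∈ Finset.range (n + 1),
        (d (n - j) * x ^ (n - j)) * (m j * x ^ j) := by
      refine Finset.sum_congr rfl fun n _ => ?_
      rw [h, Finset.sum_mul]
      refine Finset.sum_congr rfl fun j hj => ?_
      have : x ^ n = x ^ (n - j) * x ^ j := by
        rw [← pow_add, Nat.sub_add_cancel (by simpa [Nat.lt_succ_iff] using hj)]
      rw [this]; ring
    rw [e1, Finset.sum_mul_sum, ← Finset.sum_product', Finset.sum_sigma']
    set φ : (_ : ℕ) × ℕ → ℕ × ℕ := fun q => (q.1 - q.2, q.2)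
    have hinj : Set.InjOn φ ((Finset.range N).sigma fun n => Finset.range (n + 1)) := by
      rintro ⟨a, b⟩ hq ⟨a', b'⟩ hr hqr
      simp only [Finset.coe_sigma, Finset.coe_range, mem_sigma_iff, mem_Iio, Prod.mk.injEq, φ]
        at hq hr hqr
      obtain rfl := hqr.2
      obtain rfl : a = a' := by omega
      rfl
    rw [← Finset.sum_image (f := fun r : ℕ × ℕ => (d r.1 * x ^ r.1) * (m r.2 * x ^ r.2)) hinj]
    refine Finset.sum_le_sum_of_subset_of_nonneg ?_ ?_
    · intro r hr
      obtain ⟨q, hq, rfl⟩ := Finset.mem_image.1 hr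
      simp only [Finset.mem_sigma, Finset.mem_range, Finset.mem_product, φ] at hq ⊢
      omega
    · intro q _ _
      exact mul_nonneg (mul_nonneg (hd _) (by positivity)) (mul_nonneg (hm _) (by positivity))
  have hanti : AntitoneOn (fun x => p x * Real.exp (-D x)) (Icc 0 1) := by
    refine antitoneOn_of_deriv_nonpos (convex_Icc 0 1) ?_ ?_ ?_
    · exact fun x _ => ((hp x).mul (hD x).neg.exp).continuousAt.continuousWithinAt
    · exact fun x _ => ((hp x).mul (hD x).neg.exp).differentiableAt.differentiableWithinAt
    · intro x hx
      rw [interior_Icc] at hx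
      have hd' : HasDerivAt (fun x => p x * Real.exp (-D x))
          (p' x * Real.exp (-D x) + p x * (Real.exp (-D x) * -D' x)) x :=
        (hp x).mul (hD x).neg.exp
      rw [hd'.deriv]
      nlinarith [hle x hx.1.le, Real.exp_pos (-D x)]
  have h01 := hanti (left_mem_Icc.2 zero_le_one) (right_mem_Icc.2 zero_le_one) zero_le_one
  have e0 : p 0 = 1 := by
    simp only [p]
    rw [Finset.sum_range_succ']
    simp [hm0]
  have e1 : D 0 = 0 := by simp [D]
  have e2 : p 1 = ∑ j ∈ Finset.range (N + 1), m j := by simp [p]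
  have e3 : D 1 = ∑ k ∈ Finset.range N, d k / (k + 1) := by simp [D]
  simp only [e0, e1, e2, e3, neg_zero, Real.exp_zero, mul_one] at h01
  rwa [Real.exp_neg, ← div_eq_mul_inv, div_le_one (Real.exp_pos _)] at h01

lemma sum_min_div_le {d : ℕ → ℝ} {c : ℝ} (hc : 0 ≤ c) (h1 : ∀ k, d k ≤ 1)
    (h2 : ∀ k : ℕ, d k ≤ c / √(k + 1)) (N : ℕ) :
    Real.exp (∑ k ∈ Finset.range N, d k / (k + 1)) ≤ Real.exp 3 * (c ^ 2 + 2) := by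
  set K := ⌈c ^ 2⌉₊ + 1
  have hK : c ^ 2 ≤ K := (Nat.le_ceil _).trans (by simp [K])
  have hK' : (K : ℝ) ≤ c ^ 2 + 2 := by
    have := Nat.ceil_lt_add_one (sq_nonneg c)
    simp only [K]; push_cast; linarith
  have hK0 : (0 : ℝ) < K := by positivity
  have hKc : c ≤ √K := Real.le_sqrt_of_sq_le hK
  have tail (k : ℕ) (hk : 0 < k) : d k / (k + 1) ≤ 2 * c * ((√(k : ℝ))⁻¹ - (√((k + 1 : ℕ) : ℝ))⁻¹) := by
    have hk' : (0 : ℝ) < k := by exact_mod_cast hk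
    push_cast
    have a0 : 0 < √(k : ℝ) := by positivity
    have b0 : 0 < √((k : ℝ) + 1) := by positivity
    have a2 : √(k : ℝ) ^ 2 = k := Real.sq_sqrt (by positivity)
    have b2 : √((k : ℝ) + 1) ^ 2 = k + 1 := Real.sq_sqrt (by positivity)
    have hab : √(k : ℝ) ≤ √((k : ℝ) + 1) := Real.sqrt_le_sqrt (by linarith)
    calc d k / (k + 1) ≤ c / √(k + 1) / (k + 1) := by gcongr; exact h2 k
      _ = c * (1 / (√(k + 1) * (k + 1))) := by field_simp
      _ ≤ c * (2 * ((√(k : ℝ))⁻¹ - (√((k : ℝ) + 1))⁻¹)) := by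
          gcongr
          have : (√(k : ℝ))⁻¹ - (√((k : ℝ) + 1))⁻¹ = 1 / (√k * √(k + 1) * (√k + √(k + 1))) := by
            field_simp
            linear_combination b2 - a2
          rw [this, mul_one_div, div_le_div_iff₀ (by positivity) (by positivity), one_mul]
          nth_rewrite 4 [← b2]
          nlinarith [mul_pos a0 b0, mul_nonneg b0.le (sub_nonneg.2 hab), mul_nonneg (mul_pos a0 b0).le (sub_nonneg.2 hab), mul_nonneg (mul_pos b0 b0).le (sub_nonneg.2 hab)]
      _ = _ := by ring
  have head (n : ℕ) : ∑ k ∈ Finset.range n, d k / (k + 1) ≤ (harmonic n : ℝ) := by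
    rw [harmonic]; push_cast
    refine Finset.sum_le_sum fun k _ => ?_
    rw [div_eq_mul_inv]
    exact (mul_le_mul_of_nonneg_right (h1 k) (by positivity)).trans_eq (one_mul _)
  have hlog (n : ℕ) (hn : n ≤ K) : (harmonic n : ℝ) ≤ 1 + Real.log K := by
    rcases Nat.eq_zero_or_pos n with rfl | h0
    · have : 0 ≤ Real.log K := Real.log_natCast_nonneg K
      simp; linarith
    · exact (harmonic_le_one_add_log n).trans (by gcongr)
  have key : ∑ k ∈ Finset.range N, d k / (k + 1) ≤ 3 + Real.log K := by
    rcases le_total N K with h | h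
    · linarith [(head N).trans (hlog N h)]
    · rw [← Finset.sum_range_add_sum_Ico _ h]
      have t1 : ∑ k ∈ Finset.Ico K N, d k / (k + 1) ≤
          ∑ k ∈ Finset.Ico K N, 2 * c * ((√(k : ℝ))⁻¹ - (√((k + 1 : ℕ) : ℝ))⁻¹) :=
        Finset.sum_le_sum fun k hk => tail k (by
          have := (Finset.mem_Ico.1 hk).1
          simp only [K] at this; omega)
      have t2 : ∑ k ∈ Finset.Ico K N, ((√(k : ℝ))⁻¹ - (√((k + 1 : ℕ) : ℝ))⁻¹) =
          (√(K : ℝ))⁻¹ - (√(N : ℝ))⁻¹ := by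
        have := Finset.sum_Ico_sub (fun k : ℕ => -(√(k : ℝ))⁻¹) h
        simp only [sub_neg_eq_add] at this
        rw [show (√(K : ℝ))⁻¹ - (√(N : ℝ))⁻¹ = -(√(N : ℝ))⁻¹ + (√(K : ℝ))⁻¹ by ring, ← this]
        exact Finset.sum_congr rfl fun _ _ => by ring
      rw [← Finset.mul_sum, t2] at t1
      have t3 : 2 * c * ((√(K : ℝ))⁻¹ - (√(N : ℝ))⁻¹) ≤ 2 := by
        have : 0 ≤ (√(N : ℝ))⁻¹ := by positivity
        have : c * (√(K : ℝ))⁻¹ ≤ 1 := by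
          rw [← div_eq_mul_inv, div_le_one (by positivity)]; exact hKc
        nlinarith [mul_nonneg hc ‹0 ≤ (√(N : ℝ))⁻¹›]
      linarith [(head K).trans (hlog K le_rfl)]
  calc _ ≤ Real.exp (3 + Real.log K) := Real.exp_le_exp.2 key
    _ = Real.exp 3 * K := by rw [Real.exp_add, Real.exp_log hK0]
    _ ≤ _ := by gcongr

lemma tendsto_sum_range_of_dominated {g : ℕ → ℕ → ℝ} {G bound : ℕ → ℝ} (hb : Summable bound)
    (hg : ∀ j, Tendsto (fun n => g n j) atTop (𝓝 (G j)))
    (hle : ∀ n j, j ≤ n → |g n j| ≤ bound j) :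
    Tendsto (fun n => ∑ j ∈ Finset.range (n + 1), g n j) atTop (𝓝 (∑' j, G j)) := by
  have h0 (j : ℕ) : 0 ≤ bound j := (abs_nonneg _).trans (hle j j le_rfl)
  have : Tendsto (fun n => ∑' j, if j ≤ n then g n j else 0) atTop (𝓝 (∑' j, G j)) := by
    refine tendsto_tsum_of_dominated_convergence hb (fun j => ?_) (Eventually.of_forall fun n j => ?_)
    · refine (hg j).congr' ?_
      filter_upwards [eventually_ge_atTop j] with n hn
      rw [if_pos hn]
    · split_ifs with h
      · exact hle n j h
      · simpa using h0 j
  refine this.congr fun n => ?_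
  rw [tsum_eq_sum (s := Finset.range (n + 1))]
  · exact Finset.sum_congr rfl fun j hj => if_pos (by simpa [Nat.lt_succ_iff] using hj)
  · intro j hj
    exact if_neg (by simpa [Nat.lt_succ_iff] using hj)

lemma tendsto_sqrt_mul_sum {e : ℕ → ℕ → ℝ} {ℓ : ℕ → ℝ} {C : ℝ} (hC : 0 ≤ C)
    (he : ∀ i j, |e i j| ≤ C * (√((i : ℝ) + 1))⁻¹ * wt j)
    (hl : ∀ j, Tendsto (fun i : ℕ => √((i : ℝ) + 1) * e i j) atTop (𝓝 (ℓ j))) :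
    Tendsto (fun n : ℕ => √((n : ℝ) + 1) * ∑ j ∈ Finset.range (n + 1), e (n - j) j) atTop
      (𝓝 (∑' j, ℓ j)) := by
  have h1 : Tendsto (fun n : ℕ => ∑ j ∈ Finset.range (n + 1),
      if 2 * j ≤ n then √((n : ℝ) + 1) * e (n - j) j else 0) atTop (𝓝 (∑' j, ℓ j)) := by
    refine tendsto_sum_range_of_dominated (bound := fun j => 2 * C * wt j) (summable_wt.mul_left _)
      (fun j => ?_) fun n j _ => ?_
    · have hq : Tendsto (fun n : ℕ => √((n : ℝ) + 1) / √(((n - j : ℕ) : ℝ) + 1)) atTop (𝓝 1) := by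
        have h : Tendsto (fun n : ℕ => √(((n + j : ℕ) + 1 : ℝ) / ((n : ℝ) + 1))) atTop (𝓝 1) := by
          rw [← Real.sqrt_one]
          refine (Real.continuous_sqrt.tendsto _).comp ?_
          have : Tendsto (fun n : ℕ => 1 + (j : ℝ) * (1 / ((n : ℝ) + 1))) atTop (𝓝 (1 + j * 0)) :=
            tendsto_const_nhds.add (tendsto_const_nhds.mul tendsto_one_div_add_atTop_nhds_zero_nat)
          rw [mul_zero, add_zero] at this
          refine this.congr fun n => ?_
          have : (n : ℝ) + 1 ≠ 0 := by positivity
          push_cast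
          field_simp
          ring
        rw [← tendsto_add_atTop_iff_nat j]
        refine h.congr fun n => ?_
        rw [Nat.add_sub_cancel, Real.sqrt_div (by positivity)]
      have := hq.mul ((hl j).comp (tendsto_sub_atTop_nat j))
      rw [one_mul] at this
      refine this.congr' ?_
      filter_upwards [eventually_ge_atTop (2 * j)] with n hn
      rw [if_pos hn, Function.comp_apply]
      have : √(((n - j : ℕ) : ℝ) + 1) ≠ 0 := by positivity
      field_simp
    · split_ifs with h
      · rw [abs_mul, abs_of_nonneg (Real.sqrt_nonneg _)]
        have := sqrt_le_two_mul_sqrt (n := n) (i := n - j) (by omega)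
        calc _ ≤ (2 * √(((n - j : ℕ) : ℝ) + 1)) * (C * (√(((n - j : ℕ) : ℝ) + 1))⁻¹ * wt j) :=
              mul_le_mul this (he _ _) (abs_nonneg _) (by positivity)
          _ = _ := by
            have : √(((n - j : ℕ) : ℝ) + 1) ≠ 0 := by positivity
            field_simp
      · have := wt_pos j; simp; positivity
  have h2 : Tendsto (fun n : ℕ => ∑ j ∈ Finset.range (n + 1),
      if 2 * j ≤ n then 0 else √((n : ℝ) + 1) * e (n - j) j) atTop (𝓝 0) := by
    have hz : Tendsto (fun n : ℕ => 4 * C * (2 / √((n : ℝ) + 1))) atTop (𝓝 0) := by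
      have : Tendsto (fun n : ℕ => √((n : ℝ) + 1)) atTop atTop :=
        Real.tendsto_sqrt_atTop.comp (tendsto_natCast_atTop_atTop.atTop_add tendsto_const_nhds)
      simpa using (this.const_div_atTop 2).const_mul (4 * C)
    refine squeeze_zero_norm (fun n => ?_) hz
    refine (norm_sum_le _ _).trans ?_
    have : ∀ j ∈ Finset.range (n + 1),
        ‖if 2 * j ≤ n then 0 else √((n : ℝ) + 1) * e (n - j) j‖ ≤
        √((n : ℝ) + 1) * (C * (√(((n - j : ℕ) : ℝ) + 1))⁻¹ * (4 * wt n)) := by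
      intro j _
      have hw := wt_pos n
      split_ifs with h
      · simp; positivity
      · rw [Real.norm_eq_abs, abs_mul, abs_of_nonneg (Real.sqrt_nonneg _)]
        gcongr
        refine (he _ _).trans ?_
        gcongr
        exact wt_half (by omega)
    refine (Finset.sum_le_sum this).trans ?_
    rw [← Finset.mul_sum, ← Finset.sum_mul, ← Finset.mul_sum]
    have h3 : ∑ j ∈ Finset.range (n + 1), (√(((n - j : ℕ) : ℝ) + 1))⁻¹ =
        ∑ j ∈ Finset.range (n + 1), (√((j : ℝ) + 1))⁻¹ := by
      simpa using Finset.sum_range_reflect (fun j : ℕ => (√((j : ℝ) + 1))⁻¹) (n + 1)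
    rw [h3]
    have := mul_le_mul_of_nonneg_left (sqrt_mul_sum_inv_sqrt_mul_wt_le n)
      (show 0 ≤ 4 * C by positivity)
    refine le_trans (le_of_eq ?_) this
    ring
  have := h1.add h2
  rw [add_zero] at this
  refine this.congr fun n => ?_
  rw [← Finset.sum_add_distrib, Finset.mul_sum]
  exact Finset.sum_congr rfl fun j _ => by split_ifs <;> simp

lemma tendsto_wt_sub_div_wt (j : ℕ) :
    Tendsto (fun n => wt (n - j) / wt n) atTop (𝓝 1) := by
  rw [← tendsto_add_atTop_iff_nat j]
  have h : Tendsto (fun n : ℕ => ((n + j : ℕ) + 1 : ℝ) / ((n : ℝ) + 1)) atTop (𝓝 1) := by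
    have : Tendsto (fun n : ℕ => 1 + (j : ℝ) * (1 / ((n : ℝ) + 1))) atTop (𝓝 (1 + j * 0)) :=
      tendsto_const_nhds.add (tendsto_const_nhds.mul tendsto_one_div_add_atTop_nhds_zero_nat)
    rw [mul_zero, add_zero] at this
    refine this.congr fun n => ?_
    have : (n : ℝ) + 1 ≠ 0 := by positivity
    push_cast
    field_simp
    ring
  have h' := h.mul ((Real.continuous_sqrt.tendsto _).comp h)
  rw [Real.sqrt_one, mul_one] at h'
  refine h'.congr fun n => ?_
  rw [Nat.add_sub_cancel, wt, wt, Function.comp_apply, Real.sqrt_div (by positivity)]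
  field_simp

lemma tendsto_div_wt_sub {u : ℕ → ℝ} {L : ℝ} (hu : Tendsto (fun n => u n / wt n) atTop (𝓝 L))
    (j : ℕ) : Tendsto (fun n => u (n - j) / wt n) atTop (𝓝 L) := by
  have := (hu.comp (tendsto_sub_atTop_nat j)).mul (tendsto_wt_sub_div_wt j)
  rw [mul_one] at this
  refine this.congr fun n => ?_
  have h1 := (wt_pos (n - j)).ne'
  rw [Function.comp_apply]
  field_simp

lemma tendsto_sum_conv_div_wt {u a : ℕ → ℝ} {L M C : ℝ}
    (hu : Tendsto (fun n => u n / wt n) atTop (𝓝 L)) (ha : Tendsto (fun n => a n / wt n) atTop (𝓝 M))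
    (hub : ∀ n, |u n| ≤ C * wt n) (hab : ∀ n, |a n| ≤ C * wt n) :
    Tendsto (fun n => (∑ j ∈ Finset.range (n + 1), u (n - j) * a j) / wt n) atTop
      (𝓝 (∑' j, L * a j + ∑' j, u j * M)) := by
  have hC : 0 ≤ C := by nlinarith [hub 0, abs_nonneg (u 0), wt_pos 0]
  have h1 : Tendsto (fun n : ℕ => ∑ j ∈ Finset.range (n + 1),
      if 2 * j ≤ n then u (n - j) / wt n * a j else 0) atTop (𝓝 (∑' j, L * a j)) := by
    refine tendsto_sum_range_of_dominated (bound := fun j => 4 * C * (C * wt j))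
      ((summable_wt.mul_left _).mul_left _) (fun j => ?_) fun n j _ => ?_
    · refine ((tendsto_div_wt_sub hu j).mul_const (a j)).congr' ?_
      filter_upwards [eventually_ge_atTop (2 * j)] with n hn
      rw [if_pos hn]
    · have := wt_pos j
      split_ifs with h
      · rw [abs_mul, abs_div, abs_of_pos (wt_pos n)]
        refine mul_le_mul ?_ (hab j) (abs_nonneg _) (by positivity)
        rw [div_le_iff₀ (wt_pos n)]
        refine (hub _).trans ?_
        have := wt_half (n := n) (i := n - j) (by omega)
        nlinarith
      · simp; positivity
  have h2 : Tendsto (fun n : ℕ => ∑ j ∈ Finset.range (n + 1),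
      if 2 * j < n then u j * (a (n - j) / wt n) else 0) atTop (𝓝 (∑' j, u j * M)) := by
    refine tendsto_sum_range_of_dominated (bound := fun j => (C * wt j) * (4 * C))
      ((summable_wt.mul_left _).mul_right _) (fun j => ?_) fun n j _ => ?_
    · refine ((tendsto_div_wt_sub ha j).const_mul (u j)).congr' ?_
      filter_upwards [eventually_gt_atTop (2 * j)] with n hn
      rw [if_pos hn]
    · have := wt_pos j
      split_ifs with h
      · rw [abs_mul, abs_div, abs_of_pos (wt_pos n)]
        refine mul_le_mul (hub j) ?_ (div_nonneg (abs_nonneg _) (wt_pos n).le) (mul_nonneg hC (wt_pos j).le)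
        rw [div_le_iff₀ (wt_pos n)]
        refine (hab _).trans ?_
        have := wt_half (n := n) (i := n - j) (by omega)
        nlinarith
      · simp; positivity
  refine (h1.add h2).congr fun n => ?_
  have h3 : ∑ j ∈ Finset.range (n + 1), (if 2 * j < n then u j * (a (n - j) / wt n) else 0) =
      ∑ j ∈ Finset.range (n + 1), if 2 * j ≤ n then 0 else u (n - j) / wt n * a j := by
    rw [← Finset.sum_range_reflect]
    refine Finset.sum_congr rfl fun j hj => ?_
    have hj' : j ≤ n := by simpa [Nat.lt_succ_iff] using hj
    have e1 : n + 1 - 1 - j = n - j := by omega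
    have e2 : n - (n - j) = j := by omega
    rw [e1, e2]
    by_cases h : 2 * j ≤ n
    · rw [if_pos h, if_neg (by omega)]
    · rw [if_neg h, if_pos (by omega)]; ring
  rw [h3, ← Finset.sum_add_distrib, Finset.sum_div]
  refine Finset.sum_congr rfl fun j _ => ?_
  split_ifs <;> ring

lemma integrable_of_abs_le {α : Type*} [MeasurableSpace α] {g : α → ℝ} (hg : Measurable g) {C : ℝ}
    (hb : ∀ x, |g x| ≤ C) (μ : Measure α) [IsFiniteMeasure μ] : Integrable g μ :=
  Integrable.of_bound hg.aestronglyMeasurable C (ae_of_all _ fun x => by simpa using hb x)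

lemma abs_exp_neg_mul_abs_le_one {θ : ℝ} (hθ : 0 ≤ θ) (x : ℝ) : |Real.exp (-θ * |x|)| ≤ 1 := by
  rw [Real.abs_exp, Real.exp_le_one_iff]
  nlinarith [abs_nonneg x]

lemma integrable_exp_neg_mul_abs {θ : ℝ} (hθ : 0 ≤ θ) (μ : Measure ℝ) [IsFiniteMeasure μ] :
    Integrable (fun x => Real.exp (-θ * |x|)) μ :=
  integrable_of_abs_le (by fun_prop) (abs_exp_neg_mul_abs_le_one hθ) μ

lemma integrable_exp_neg_mul_abs_add {θ : ℝ} (hθ : 0 ≤ θ) (a : ℝ) (μ : Measure ℝ)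
    [IsFiniteMeasure μ] : Integrable (fun x => Real.exp (-θ * |x + a|)) μ :=
  integrable_of_abs_le (by fun_prop) (fun x => abs_exp_neg_mul_abs_le_one hθ (x + a)) μ

lemma integral_exp_convPow_le {F : Measure ℝ} [IsProbabilityMeasure F] {σ : ℝ}
    (hF : IsCenteredStep F σ) : ∃ C > 0, ∀ θ > 0, ∀ (n : ℕ) (a : ℝ),
      ∫ y, Real.exp (-θ * |y + a|) ∂(convPow F (n + 1)) ≤ C * (1 + 1 / θ) / √(n + 1) := by
  obtain ⟨C, hC, h⟩ := convPow_unit_interval_le hF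
  refine ⟨2 * C, by positivity, fun θ hθ n a => ?_⟩
  set μ := convPow F (n + 1)
  set q := Real.exp (-θ)
  have hq0 : 0 < q := Real.exp_pos _
  have hq1 : q < 1 := by simp only [q]; rw [Real.exp_lt_one_iff]; linarith
  have hgeo : (1 - q)⁻¹ ≤ 1 + 1 / θ := by
    have h1 : θ + 1 ≤ Real.exp θ := Real.add_one_le_exp θ
    have h2 : q * Real.exp θ = 1 := by simp only [q]; rw [← Real.exp_add]; simp
    rw [inv_eq_one_div, div_le_iff₀ (by linarith), show 1 + 1 / θ = (θ + 1) / θ by field_simp,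
      div_mul_eq_mul_div, le_div_iff₀ hθ]
    nlinarith
  set s : ℕ → Set ℝ := fun k => {y | ⌊|y + a|⌋₊ = k}
  have hμs (k : ℕ) : μ (s k) ≤ ENNReal.ofReal (2 * C / √(n + 1)) := by
    have hsub : s k ⊆ Icc (k - a) (k - a + 1) ∪ Icc (-k - a - 1) (-k - a - 1 + 1) := by
      intro y hy
      have hy' : ⌊|y + a|⌋₊ = k := hy
      have h1 : (k : ℝ) ≤ |y + a| := hy' ▸ Nat.floor_le (abs_nonneg _)
      have h2 : |y + a| < k + 1 := hy' ▸ Nat.lt_floor_add_one _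
      rcases abs_cases (y + a) with ⟨e, _⟩ | ⟨e, _⟩
      · left; constructor <;> linarith
      · right; constructor <;> linarith
    have hI (z : ℝ) : μ (Icc z (z + 1)) ≤ ENNReal.ofReal (C / √(n + 1)) := by
      rw [← ENNReal.ofReal_toReal (measure_ne_top μ _)]
      exact ENNReal.ofReal_le_ofReal (h n z)
    calc μ (s k) ≤ _ := measure_mono hsub
      _ ≤ _ := measure_union_le _ _
      _ ≤ _ := add_le_add (hI _) (hI _)
      _ = _ := by rw [← ENNReal.ofReal_add (by positivity) (by positivity)]; ring_nf
  have hsm (k : ℕ) : MeasurableSet (s k) :=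
    (Nat.measurable_floor.comp (by fun_prop : Measurable fun y : ℝ => |y + a|))
      (measurableSet_singleton k)
  have hun : (⋃ k, s k) = univ := by
    ext y; simp [s]
  have hl : ∫⁻ y, ENNReal.ofReal (Real.exp (-θ * |y + a|)) ∂μ ≤
      ENNReal.ofReal (2 * C * (1 + 1 / θ) / √(n + 1)) := by
    calc ∫⁻ y, ENNReal.ofReal (Real.exp (-θ * |y + a|)) ∂μ
        = ∫⁻ y in ⋃ k, s k, ENNReal.ofReal (Real.exp (-θ * |y + a|)) ∂μ := by
          rw [hun, Measure.restrict_univ]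
      _ ≤ ∑' k, ∫⁻ y in s k, ENNReal.ofReal (Real.exp (-θ * |y + a|)) ∂μ :=
          lintegral_iUnion_le _ _
      _ ≤ ∑' k : ℕ, ENNReal.ofReal (q ^ k) * ENNReal.ofReal (2 * C / √(n + 1)) := by
          refine ENNReal.tsum_le_tsum fun k => ?_
          calc ∫⁻ y in s k, ENNReal.ofReal (Real.exp (-θ * |y + a|)) ∂μ
              ≤ ∫⁻ _ in s k, ENNReal.ofReal (q ^ k) ∂μ := by
                refine setLIntegral_mono' (hsm k) fun y hy => ENNReal.ofReal_le_ofReal ?_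
                have hy' : ⌊|y + a|⌋₊ = k := hy
                have h1 : (k : ℝ) ≤ |y + a| := hy' ▸ Nat.floor_le (abs_nonneg _)
                simp only [q]
                rw [← Real.exp_nat_mul]
                exact Real.exp_le_exp.2 (by nlinarith)
            _ = ENNReal.ofReal (q ^ k) * μ (s k) := by simp
            _ ≤ _ := by gcongr; exact hμs k
      _ = ENNReal.ofReal ((1 - q)⁻¹) * ENNReal.ofReal (2 * C / √(n + 1)) := by
          rw [ENNReal.tsum_mul_right, ← ENNReal.ofReal_tsum_of_nonneg (fun k => by positivity)
            (summable_geometric_of_lt_one hq0.le hq1), tsum_geometric_of_lt_one hq0.le hq1]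
      _ ≤ _ := by
          rw [← ENNReal.ofReal_mul (inv_nonneg.2 (by linarith))]
          refine ENNReal.ofReal_le_ofReal ?_
          calc (1 - q)⁻¹ * (2 * C / √(n + 1)) ≤ (1 + 1 / θ) * (2 * C / √(n + 1)) := by gcongr
            _ = _ := by ring
  rw [integral_eq_lintegral_of_nonneg_ae (ae_of_all _ fun y => (Real.exp_pos _).le)
    (by fun_prop)]
  exact ENNReal.toReal_le_of_le_ofReal (by positivity) hl

lemma integral_seqConv (M N : ℕ → Measure ℝ) [∀ n, IsFiniteMeasure (M n)]
    [∀ n, IsFiniteMeasure (N n)] {g : ℝ → ℝ} (hg : Measurable g) {C : ℝ} (hb : ∀ x, |g x| ≤ C)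
    (n : ℕ) : ∫ x, g x ∂(seqConv M N n) =
      ∑ j ∈ Finset.range (n + 1), ∫ z, ∫ y, g (y + z) ∂(M (n - j)) ∂(N j) := by
  rw [seqConv, integral_finsetSum_measure (fun i _ => integrable_of_abs_le hg hb _)]
  rw [Finset.Nat.sum_antidiagonal_eq_sum_range_succ (f := fun i j => ∫ x, g x ∂((M i).conv (N j))),
    ← Finset.sum_range_reflect]
  refine Finset.sum_congr rfl fun j hj => ?_
  have hj' : j ≤ n := by simpa [Nat.lt_succ_iff] using hj
  rw [show n.succ - 1 - j = n - j by omega, show n - (n - j) = j by omega, Measure.conv_comm,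
    integral_conv (integrable_of_abs_le hg hb _)]
  simp only [add_comm]

lemma integral_integral_exp_eq {μ ν : Measure ℝ} {θ : ℝ} {s t : Set ℝ}
    (hμ : μ sᶜ = 0) (hν : ν tᶜ = 0) (h : ∀ y ∈ s, ∀ z ∈ t, |y + z| = |y| + |z|) :
    ∫ z, ∫ y, Real.exp (-θ * |y + z|) ∂μ ∂ν =
      (∫ y, Real.exp (-θ * |y|) ∂μ) * ∫ z, Real.exp (-θ * |z|) ∂ν := by
  rw [← integral_const_mul]
  refine integral_congr_ae ?_
  have hν' : ∀ᵐ z ∂ν, z ∈ t := by rwa [ae_iff]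
  have hμ' : ∀ᵐ y ∂μ, y ∈ s := by rwa [ae_iff]
  filter_upwards [hν'] with z hz
  rw [← integral_mul_const]
  refine integral_congr_ae ?_
  filter_upwards [hμ'] with y hy
  rw [h y hy z hz, mul_add, Real.exp_add]

lemma exp_neg_mul_abs_le {θ : ℝ} (hθ : 0 < θ) (y : ℝ) :
    Real.exp (-θ * |y|) ≤ (1 + 2 / θ ^ 2) / (1 + y ^ 2) := by
  rw [le_div_iff₀ (by positivity), neg_mul, Real.exp_neg, inv_mul_le_iff₀ (Real.exp_pos _)]
  have h := Real.quadratic_le_exp_of_nonneg (x := θ * |y|) (by positivity)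
  have h1 : (θ * |y|) ^ 2 = θ ^ 2 * y ^ 2 := by rw [mul_pow, sq_abs]
  have h2 : 1 ≤ Real.exp (θ * |y|) := Real.one_le_exp (by positivity)
  have h3 : y ^ 2 ≤ 2 / θ ^ 2 * Real.exp (θ * |y|) := by
    rw [div_mul_eq_mul_div, le_div_iff₀ (by positivity)]
    nlinarith [show 0 ≤ θ * |y| by positivity]
  nlinarith

/-- A sequence of measures driven by the part in `H` of the law of the random walk with step `F`
through the Sparre Andersen recursion. -/
structure IsLadderSeq (F : Measure ℝ) (H H' : Set ℝ) (M : ℕ → Measure ℝ) : Prop where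
  meas : MeasurableSet H
  convex : Convex ℝ H
  abs_add : ∀ y ∈ H, ∀ z ∈ H', |y + z| = |y| + |z|
  null : ∀ j, M j H'ᶜ = 0
  zero : M 0 = Measure.dirac 0
  deriv : ∀ n, seqDeriv M n = seqConv (fun i => (convPow F (i + 1)).restrict H) M n

section Ladder

variable {F : Measure ℝ} {σ : ℝ} {H H' : Set ℝ} {M : ℕ → Measure ℝ}

lemma IsLadderSeq.exp_zero (hM : IsLadderSeq F H H' M) (θ : ℝ) :
    ∫ z, Real.exp (-θ * |z|) ∂(M 0) = 1 := by
  rw [hM.zero]; simp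

variable [IsProbabilityMeasure F] [∀ n, IsFiniteMeasure (M n)]

lemma IsLadderSeq.integral_succ (hM : IsLadderSeq F H H' M) {g : ℝ → ℝ} (hg : Measurable g) {C : ℝ}
    (hb : ∀ x, |g x| ≤ C) (n : ℕ) : ((n : ℝ) + 1) * ∫ x, g x ∂(M (n + 1)) =
      ∑ j ∈ Finset.range (n + 1), ∫ z, ∫ y in H, g (y + z) ∂(convPow F (n - j + 1)) ∂(M j) := by
  have h := integral_seqConv (fun i => (convPow F (i + 1)).restrict H) M hg hb n
  rw [← h, ← hM.deriv, seqDeriv, integral_smul_nnreal_measure,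
    NNReal.smul_def, smul_eq_mul]
  simp

lemma IsLadderSeq.exp_succ (hM : IsLadderSeq F H H' M) {θ : ℝ} (hθ : 0 ≤ θ) (n : ℕ) :
    ((n : ℝ) + 1) * ∫ x, Real.exp (-θ * |x|) ∂(M (n + 1)) =
      ∑ j ∈ Finset.range (n + 1), (∫ y in H, Real.exp (-θ * |y|) ∂(convPow F (n - j + 1))) *
        ∫ z, Real.exp (-θ * |z|) ∂(M j) := by
  rw [hM.integral_succ (by fun_prop) (abs_exp_neg_mul_abs_le_one hθ)]
  refine Finset.sum_congr rfl fun j _ => ?_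
  refine integral_integral_exp_eq (s := H) ?_ (hM.null j) hM.abs_add
  rw [Measure.restrict_apply hM.meas.compl, compl_inter_self, measure_empty]

lemma setIntegral_exp_le_one {θ : ℝ} (hθ : 0 ≤ θ) (s : Set ℝ) (n : ℕ) :
    ∫ y in s, Real.exp (-θ * |y|) ∂(convPow F n) ≤ 1 := by
  calc _ ≤ ∫ y, Real.exp (-θ * |y|) ∂(convPow F n) :=
        setIntegral_le_integral (integrable_exp_neg_mul_abs hθ _)
          (ae_of_all _ fun _ => (Real.exp_pos _).le)
    _ ≤ ∫ _, 1 ∂(convPow F n) := integral_mono (integrable_exp_neg_mul_abs hθ _)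
        (integrable_const _) fun y => (le_abs_self _).trans (abs_exp_neg_mul_abs_le_one hθ y)
    _ = 1 := by simp

lemma integral_exp_nonneg (θ : ℝ) (μ : Measure ℝ) : 0 ≤ ∫ z, Real.exp (-θ * |z|) ∂μ :=
  integral_nonneg fun _ => (Real.exp_pos _).le

lemma IsLadderSeq.sum_exp_le (hF : IsCenteredStep F σ) (hM : IsLadderSeq F H H' M) :
    ∃ K > 0, ∀ θ > 0, ∀ N : ℕ,
      ∑ j ∈ Finset.range (N + 1), ∫ z, Real.exp (-θ * |z|) ∂(M j) ≤ K * (1 + 1 / θ) ^ 2 := by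
  obtain ⟨C, hC, h⟩ := integral_exp_convPow_le hF
  refine ⟨Real.exp 3 * (C ^ 2 + 2), by positivity, fun θ hθ N => ?_⟩
  have h1 := sum_le_exp_of_conv_eq (m := fun j => ∫ z, Real.exp (-θ * |z|) ∂(M j))
    (d := fun i => ∫ y in H, Real.exp (-θ * |y|) ∂(convPow F (i + 1)))
    (hM.exp_zero θ) (fun n => integral_exp_nonneg _ _) (fun n => integral_exp_nonneg _ _)
    (hM.exp_succ hθ.le) N
  have h2 := sum_min_div_le (c := C * (1 + 1 / θ)) (by positivity)
    (d := fun i => ∫ y in H, Real.exp (-θ * |y|) ∂(convPow F (i + 1)))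
    (fun k => setIntegral_exp_le_one hθ.le _ _)
    (fun k => (setIntegral_le_integral (integrable_exp_neg_mul_abs hθ.le _)
          (ae_of_all _ fun _ => (Real.exp_pos _).le)).trans (by simpa using h θ hθ k 0)) N
  refine (h1.trans h2).trans ?_
  rw [mul_assoc]
  gcongr
  have : 1 ≤ (1 + 1 / θ) ^ 2 := one_le_pow₀ (by simp; positivity)
  nlinarith

lemma IsLadderSeq.exp_le_div (hM : IsLadderSeq F H H' M) {θ U : ℝ} (hθ : 0 ≤ θ)
    (hU : ∀ N : ℕ, ∑ j ∈ Finset.range (N + 1), ∫ z, Real.exp (-θ * |z|) ∂(M j) ≤ U) (j : ℕ) :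
    ∫ z, Real.exp (-θ * |z|) ∂(M j) ≤ 2 * U / (j + 1) := by
  have hU1 : 1 ≤ U := by
    have := hU 0
    rwa [zero_add, Finset.sum_range_one, hM.exp_zero] at this
  cases j with
  | zero => rw [hM.exp_zero]; simp; linarith
  | succ n =>
    have h1 : ((n : ℝ) + 1) * ∫ x, Real.exp (-θ * |x|) ∂(M (n + 1)) ≤ U := by
      rw [hM.exp_succ hθ]
      refine (Finset.sum_le_sum fun j _ => ?_).trans (hU n)
      exact mul_le_of_le_one_left (integral_exp_nonneg _ _) (setIntegral_exp_le_one hθ _ _)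
    rw [le_div_iff₀ (by positivity)]
    push_cast
    have := integral_exp_nonneg θ (M (n + 1))
    nlinarith [n.cast_nonneg (α := ℝ)]

lemma IsLadderSeq.exp_le_wt (hF : IsCenteredStep F σ) (hM : IsLadderSeq F H H' M) {θ : ℝ}
    (hθ : 0 < θ) : ∃ C > 0, ∀ j, ∫ z, Real.exp (-θ * |z|) ∂(M j) ≤ C * wt j := by
  obtain ⟨C, hC, h⟩ := integral_exp_convPow_le hF
  obtain ⟨K, hK, hsum⟩ := hM.sum_exp_le hF
  set U := K * (1 + 1 / θ) ^ 2
  refine ⟨40 * (C * (1 + 1 / θ)) * U + 1, by positivity, fun j => ?_⟩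
  cases j with
  | zero => rw [hM.exp_zero]; simp [wt]; positivity
  | succ n =>
    refine (le_wt_of_conv_le (c := C * (1 + 1 / θ)) (U := U)
      (v := fun j => ∫ z, Real.exp (-θ * |z|) ∂(M j)) (p := fun j => ∫ z, Real.exp (-θ * |z|) ∂(M j))
      (by positivity) (by positivity) (fun j => integral_exp_nonneg _ _) (hsum θ hθ)
      (hM.exp_le_div hθ.le (hsum θ hθ)) (fun n => ?_) n).trans ?_
    · simp only [hM.exp_succ hθ.le]
      refine Finset.sum_le_sum fun j _ => ?_
      refine mul_le_mul_of_nonneg_right ?_ (integral_exp_nonneg _ _)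
      rw [← div_eq_mul_inv]
      exact (setIntegral_le_integral (integrable_exp_neg_mul_abs hθ.le _)
          (ae_of_all _ fun _ => (Real.exp_pos _).le)).trans (by simpa using h θ hθ (n - j) 0)
    · nlinarith [wt_pos (n + 1)]

lemma IsLadderSeq.tendsto_setIntegral (hF : IsCenteredStep F σ) (hM : IsLadderSeq F H H' M)
    {θ C : ℝ} (hθ : 0 < θ) {f : ℝ → ℝ} (hf : Continuous f)
    (hb : ∀ x, |f x| ≤ C * Real.exp (-θ * |x|)) {I : Set ℝ} (hI : MeasurableSet I)
    (hIc : Convex ℝ I) :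
    ∃ L, Tendsto (fun n => (∫ x in I, f x ∂(M n)) / wt n) atTop (𝓝 L) := by
  have hC : 0 ≤ C := by simpa using (abs_nonneg _).trans (hb 0)
  obtain ⟨K, hK, hK'⟩ := integral_exp_convPow_le hF
  obtain ⟨K₂, hK₂, hK₂'⟩ := hM.exp_le_wt hF hθ
  set c := K * (1 + 1 / θ)
  have hc : 0 < c := by positivity
  set g : ℝ → ℝ := I.indicator f
  have hg : Measurable g := hf.measurable.indicator hI
  have hgb (x : ℝ) : |g x| ≤ C * Real.exp (-θ * |x|) := by
    by_cases hx : x ∈ I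
    · simpa [g, hx] using hb x
    · simp [g, hx]; positivity
  have hgC (x : ℝ) : |g x| ≤ C := (hgb x).trans (mul_le_of_le_one_right hC
    ((le_abs_self _).trans (abs_exp_neg_mul_abs_le_one hθ.le x)))
  set inner : ℕ → ℝ → ℝ := fun i z => ∫ y in H, g (y + z) ∂(convPow F (i + 1))
  have inner_le (i : ℕ) (z : ℝ) : |inner i z| ≤
      C * ∫ y in H, Real.exp (-θ * |y + z|) ∂(convPow F (i + 1)) := by
    rw [← integral_const_mul]
    exact norm_integral_le_of_norm_le ((integrable_exp_neg_mul_abs_add hθ.le z _).const_mul C)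
      (ae_of_all _ fun y => (Real.norm_eq_abs _).trans_le (hgb (y + z)))
  have inner_le' (i : ℕ) (z : ℝ) : |inner i z| ≤ C * (c / √(i + 1)) :=
    (inner_le i z).trans (mul_le_mul_of_nonneg_left
      ((setIntegral_le_integral (integrable_exp_neg_mul_abs_add hθ.le z _)
          (ae_of_all _ fun _ => (Real.exp_pos _).le)).trans (hK' θ hθ i z)) hC)
  have inner_meas (i : ℕ) : StronglyMeasurable (inner i) := by
    have : StronglyMeasurable (Function.uncurry fun z y => g (y + z)) :=
      (hg.comp (by fun_prop : Measurable fun p : ℝ × ℝ => p.2 + p.1)).stronglyMeasurable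
    exact this.integral_prod_right
  set e : ℕ → ℕ → ℝ := fun i j => ∫ z, inner i z ∂(M j)
  have he (i j : ℕ) : |e i j| ≤ (C * c * K₂) * (√((i : ℝ) + 1))⁻¹ * wt j := by
    have h1 : |e i j| ≤ C * ∫ z, ∫ y in H, Real.exp (-θ * |y + z|) ∂(convPow F (i + 1)) ∂(M j) := by
      rw [← integral_const_mul]
      refine norm_integral_le_of_norm_le (Integrable.const_mul ?_ C)
        (ae_of_all _ fun z => (Real.norm_eq_abs _).trans_le (inner_le i z))
      refine integrable_of_abs_le ?_ (C := 1) (fun z => ?_) _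
      · have : StronglyMeasurable (Function.uncurry fun z y : ℝ => Real.exp (-θ * |y + z|)) :=
          (by fun_prop : Measurable fun p : ℝ × ℝ => Real.exp (-θ * |p.2 + p.1|)).stronglyMeasurable
        exact this.integral_prod_right.measurable
      · rw [abs_of_nonneg (integral_nonneg fun _ => (Real.exp_pos _).le)]
        calc _ ≤ ∫ y, Real.exp (-θ * |y + z|) ∂(convPow F (i + 1)) :=
              setIntegral_le_integral (integrable_exp_neg_mul_abs_add hθ.le z _)
                (ae_of_all _ fun _ => (Real.exp_pos _).le)
          _ ≤ ∫ _, 1 ∂(convPow F (i + 1)) := integral_mono (integrable_exp_neg_mul_abs_add hθ.le z _)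
              (integrable_const _) fun y => (le_abs_self _).trans (abs_exp_neg_mul_abs_le_one hθ.le _)
          _ = 1 := by simp
    rw [integral_integral_exp_eq (s := H) (t := H') (by
      rw [Measure.restrict_apply hM.meas.compl, compl_inter_self, measure_empty]) (hM.null j) hM.abs_add] at h1
    have h2 : ∫ y in H, Real.exp (-θ * |y|) ∂(convPow F (i + 1)) ≤ c / √(i + 1) :=
      (setIntegral_le_integral (integrable_exp_neg_mul_abs hθ.le _)
          (ae_of_all _ fun _ => (Real.exp_pos _).le)).trans (by simpa [c] using hK' θ hθ i 0)
    calc |e i j| ≤ _ := h1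
      _ ≤ C * ((c / √(i + 1)) * (K₂ * wt j)) := by
          gcongr
          exact hK₂' j
      _ = _ := by rw [div_eq_mul_inv]; ring
  have hl (j : ℕ) : ∃ ℓ, Tendsto (fun i : ℕ => √((i : ℝ) + 1) * e i j) atTop (𝓝 ℓ) := by
    refine ⟨∫ z, ((σ * √(2 * Real.pi))⁻¹ * ∫ y in H ∩ {y | y + z ∈ I}, f (y + z)) ∂(M j), ?_⟩
    simp only [e]
    simp_rw [← integral_const_mul (√_) (inner _)]
    refine tendsto_integral_of_dominated_convergence (μ := M j)
      (F := fun i z => √((i : ℝ) + 1) * inner i z)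
      (f := fun z => (σ * √(2 * Real.pi))⁻¹ * ∫ y in H ∩ {y | y + z ∈ I}, f (y + z))
      (fun _ => C * c)
      (fun i => ((inner_meas i).const_mul _).aestronglyMeasurable) (integrable_const _)
      (fun i => ae_of_all _ fun z => ?_) (ae_of_all _ fun z => ?_)
    · rw [norm_mul, Real.norm_of_nonneg (Real.sqrt_nonneg _)]
      have h0 : 0 < √((i : ℝ) + 1) := by positivity
      calc _ ≤ √((i : ℝ) + 1) * (C * (c / √(i + 1))) :=
            mul_le_mul_of_nonneg_left (inner_le' i z) h0.le
        _ = C * c := by field_simp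
    · have hJ : MeasurableSet {y | y + z ∈ I} := (measurable_add_const z) hI
      have hJc : Convex ℝ {y | y + z ∈ I} := by
        have := hIc.translate_preimage_left z
        exact this
      have := tendsto_sqrt_mul_setIntegral_convPow hF (f := fun y => f (y + z))
        (s := H ∩ {y | y + z ∈ I}) (C := C * (Real.exp (θ * |z|) * (1 + 2 / θ ^ 2)))
        (by fun_prop) (fun y => ?_) (hM.meas.inter hJ)
        ((hM.convex.inter hJc).addHaar_frontier volume)
      · refine ((tendsto_add_atTop_iff_nat 1).2 this).congr fun i => ?_
        push_cast
        congr 1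
        simp only [inner, g]
        rw [← setIntegral_indicator hJ]
        rfl
      · refine (hb _).trans ?_
        rw [mul_div_assoc, mul_div_assoc]
        gcongr
        calc Real.exp (-θ * |y + z|) ≤ Real.exp (θ * |z|) * Real.exp (-θ * |y|) := by
              rw [← Real.exp_add, Real.exp_le_exp]
              have : |y| ≤ |y + z| + |z| := by
                simpa using abs_sub (y + z) z
              nlinarith
          _ ≤ _ := by gcongr; exact exp_neg_mul_abs_le hθ y
  choose ℓ hℓ using hl
  refine ⟨∑' j, ℓ j, ?_⟩
  have main := tendsto_sqrt_mul_sum (by positivity) he hℓ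
  have h1 : Tendsto (fun n => (∫ x in I, f x ∂(M (n + 1))) / wt n) atTop (𝓝 (∑' j, ℓ j)) := by
    refine main.congr fun n => ?_
    rw [← hM.integral_succ hg hgC, wt, integral_indicator hI]
    field_simp
  rw [← tendsto_add_atTop_iff_nat 1]
  have h2 := (tendsto_add_atTop_iff_nat 1).2 (tendsto_wt_sub_div_wt 1)
  have := h1.mul h2
  rw [mul_one] at this
  refine this.congr fun n => ?_
  have := (wt_pos n).ne'
  rw [Nat.add_sub_cancel]
  field_simp

end Ladder

section Ladder

variable {F : Measure ℝ} {σ : ℝ}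

lemma negLaw_zero : negLaw F 0 = Measure.dirac 0 := rfl

/-- The exponential moment over `[0, ∞)` of the law of the walk started from `x` and kept
below its starting point. -/
def shiftExp (F : Measure ℝ) (θ x : ℝ) (i : ℕ) : ℝ :=
  ∫ v in Ici (-x), Real.exp (-θ * |v + x|) ∂(negLaw F i)

lemma shiftExp_nonneg (θ x : ℝ) (i : ℕ) : 0 ≤ shiftExp F θ x i :=
  integral_nonneg fun _ => (Real.exp_pos _).le

variable [IsProbabilityMeasure F]

variable (F) in
lemma isLadderSeq_posLaw : IsLadderSeq F (Ici 0) (Ici 0) (posLaw F) where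
  meas := measurableSet_Ici
  convex := convex_Ici 0
  abs_add y hy z hz := by
    rw [abs_of_nonneg (mem_Ici.1 hy), abs_of_nonneg (mem_Ici.1 hz),
      abs_of_nonneg (add_nonneg (mem_Ici.1 hy) (mem_Ici.1 hz))]
  null := posLaw_null F
  zero := rfl
  deriv n := (wienerHopf_deriv F n).1

variable (F) in
lemma isLadderSeq_negLaw : IsLadderSeq F (Iio 0) (Iic 0) (negLaw F) where
  meas := measurableSet_Iio
  convex := convex_Iio 0
  abs_add y hy z hz := by
    rw [abs_of_neg (mem_Iio.1 hy), abs_of_nonpos (mem_Iic.1 hz),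
      abs_of_neg (add_neg_of_neg_of_nonpos (mem_Iio.1 hy) (mem_Iic.1 hz))]
    ring
  null := negLaw_null F
  zero := rfl
  deriv n := (wienerHopf_deriv F n).2

lemma shiftExp_le_wt (hF : IsCenteredStep F σ) {θ : ℝ} (hθ : 0 < θ) :
    ∃ C > 0, ∀ x, 0 ≤ x → ∀ i, shiftExp F θ x i ≤ C * (1 + x) ^ 2 * wt i := by
  obtain ⟨C, hC, h⟩ := integral_exp_convPow_le hF
  have hM := isLadderSeq_negLaw F
  obtain ⟨K, hK, hsum⟩ := hM.sum_exp_le hF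
  set c := C * (1 + 1 / θ) with hc
  have hc0 : 0 < c := by positivity
  refine ⟨40 * c * (Real.exp 1 * K * 4) + 1, by positivity, fun x hx i => ?_⟩
  have hx1 : 1 ≤ (1 + x) ^ 2 := one_le_pow₀ (by linarith)
  cases i with
  | zero =>
    have h1 : shiftExp F θ x 0 ≤ 1 := by
      calc _ ≤ ∫ v, Real.exp (-θ * |v + x|) ∂(negLaw F 0) :=
            setIntegral_le_integral (integrable_exp_neg_mul_abs_add hθ.le x _)
              (ae_of_all _ fun _ => (Real.exp_pos _).le)
        _ = Real.exp (-θ * |0 + x|) := by simp only [negLaw_zero]; rw [integral_dirac]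
        _ ≤ 1 := (le_abs_self _).trans (abs_exp_neg_mul_abs_le_one hθ.le _)
    refine h1.trans ?_
    have h2 : 0 < 40 * c * (Real.exp 1 * K * 4) := by positivity
    simp only [wt]
    norm_num
    nlinarith
  | succ n =>
    set τ := 1 / (1 + x) with hτ
    have hτ0 : 0 < τ := by positivity
    set m : ℕ → ℝ := fun j => ∫ z, Real.exp (-τ * |z|) ∂(negLaw F j)
    set U := Real.exp 1 * (K * (1 + 1 / τ) ^ 2) with hU
    have hU' : U ≤ Real.exp 1 * K * 4 * (1 + x) ^ 2 := by
      have h1 : 1 / τ = 1 + x := by simp [hτ]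
      have h2 : (1 + (1 + x)) ^ 2 ≤ 4 * (1 + x) ^ 2 := by nlinarith
      calc U = Real.exp 1 * K * (1 + (1 + x)) ^ 2 := by rw [hU, h1]; ring
        _ ≤ Real.exp 1 * K * (4 * (1 + x) ^ 2) := by gcongr
        _ = _ := by ring
    set g : ℝ → ℝ := (Ici (-x)).indicator fun v => Real.exp (-θ * |v + x|)
    have hg : Measurable g := (by fun_prop : Measurable fun v => Real.exp (-θ * |v + x|)).indicator
      measurableSet_Ici
    have hg0 (v : ℝ) : 0 ≤ g v := indicator_nonneg (fun _ _ => (Real.exp_pos _).le) v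
    have hgle (v : ℝ) : g v ≤ Real.exp (-θ * |v + x|) :=
      indicator_le_self' (fun _ _ => (Real.exp_pos _).le) v
    have hgb (v : ℝ) : |g v| ≤ 1 := by
      rw [abs_of_nonneg (hg0 v)]
      exact (hgle v).trans ((le_abs_self _).trans (abs_exp_neg_mul_abs_le_one hθ.le _))
    have inner_le (k : ℕ) (z : ℝ) (hz : z ≤ 0) :
        ∫ y in Iio 0, g (y + z) ∂(convPow F (k + 1)) ≤
          c * (√((k : ℝ) + 1))⁻¹ * (Real.exp 1 * Real.exp (-τ * |z|)) := by
      by_cases hzx : z < -x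
      · rw [setIntegral_eq_zero_of_forall_eq_zero]
        · positivity
        · intro y hy
          refine indicator_of_notMem (fun hmem => ?_) _
          rw [mem_Ici] at hmem
          rw [mem_Iio] at hy
          linarith
      · have h1 : 1 ≤ Real.exp 1 * Real.exp (-τ * |z|) := by
          rw [← Real.exp_add, Real.one_le_exp_iff, abs_of_nonpos hz, hτ]
          have : 1 / (1 + x) * (-z) ≤ 1 := by
            rw [one_div, inv_mul_le_iff₀ (by linarith)]; linarith
          linarith
        calc _ ≤ ∫ y, Real.exp (-θ * |y + (z + x)|) ∂(convPow F (k + 1)) := by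
              refine (setIntegral_le_integral
                (integrable_of_abs_le (hg.comp (measurable_add_const z)) (fun y => hgb (y + z)) _)
                (ae_of_all _ fun y => hg0 (y + z))).trans ?_
              refine integral_mono
                (integrable_of_abs_le (hg.comp (measurable_add_const z)) (fun y => hgb (y + z)) _)
                (integrable_exp_neg_mul_abs_add hθ.le _ _) fun y => ?_
              have := hgle (y + z)
              rwa [add_assoc] at this
          _ ≤ c / √(k + 1) := h θ hθ k (z + x)
          _ = c * (√((k : ℝ) + 1))⁻¹ := div_eq_mul_inv _ _
          _ ≤ _ := le_mul_of_one_le_right (by positivity) h1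
    have key := le_wt_of_conv_le (v := shiftExp F θ x) (p := fun j => Real.exp 1 * m j) (c := c)
      (U := U) hc0.le (by positivity)
      (fun j => mul_nonneg (Real.exp_pos _).le (integral_exp_nonneg _ _))
      (fun n => by
        rw [← Finset.mul_sum]
        exact mul_le_mul_of_nonneg_left (hsum τ hτ0 n) (Real.exp_pos _).le)
      (fun j => by
        calc _ ≤ Real.exp 1 * (2 * (K * (1 + 1 / τ) ^ 2) / (j + 1)) := by
              gcongr
              exact hM.exp_le_div hτ0.le (hsum τ hτ0) j
          _ = _ := by rw [hU]; ring)
      (fun n => by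
        have h1 : shiftExp F θ x (n + 1) = ∫ v, g v ∂(negLaw F (n + 1)) := by
          rw [shiftExp, integral_indicator measurableSet_Ici]
        rw [h1, hM.integral_succ hg hgb]
        refine Finset.sum_le_sum fun j _ => ?_
        rw [← mul_assoc (c * _), ← integral_const_mul]
        refine integral_mono_of_nonneg (ae_of_all _ fun z => integral_nonneg fun y => hg0 _)
          ((integrable_exp_neg_mul_abs hτ0.le _).const_mul _) ?_
        have hz : ∀ᵐ z ∂(negLaw F j), z ∈ Iic (0 : ℝ) := by
          rw [ae_iff]; exact negLaw_null F j
        filter_upwards [hz] with z hz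
        rw [mul_assoc (c * _)]
        exact inner_le (n - j) z hz) n
    refine key.trans ?_
    have := wt_pos (n + 1)
    gcongr ?_ * wt (n + 1)
    calc 40 * c * U ≤ 40 * c * (Real.exp 1 * K * 4 * (1 + x) ^ 2) := by gcongr
      _ ≤ _ := by nlinarith

lemma tendsto_shiftExp (hF : IsCenteredStep F σ) {θ : ℝ} (hθ : 0 < θ) (x : ℝ) :
    ∃ L, Tendsto (fun i => shiftExp F θ x i / wt i) atTop (𝓝 L) := by
  refine (isLadderSeq_negLaw F).tendsto_setIntegral hF hθ (C := Real.exp (θ * |x|)) (by fun_prop)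
    (fun v => ?_) measurableSet_Ici (convex_Ici _)
  rw [Real.abs_exp, ← Real.exp_add, Real.exp_le_exp]
  have : |v| ≤ |v + x| + |x| := by simpa using abs_sub (v + x) x
  nlinarith

/-- The exponential moment of the law of the walk started from `x` and killed on entering the
negative half-line factorises over the time of the last minimum. -/
lemma integral_exp_killed {θ x : ℝ} (hθ : 0 ≤ θ) (hx : 0 ≤ x) (n : ℕ) :
    ∫ z, Real.exp (-θ * |z|) ∂(killed F (Ici 0) (.dirac x) n) =
      ∑ j ∈ Finset.range (n + 1),
        shiftExp F θ x (n - j) * ∫ z, Real.exp (-θ * |z|) ∂(posLaw F j) := by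
  rw [killed_dirac_eq F hx, integral_seqConv _ _ (by fun_prop) (abs_exp_neg_mul_abs_le_one hθ)]
  refine Finset.sum_congr rfl fun j _ => ?_
  rw [integral_integral_exp_eq (s := Ici 0) (t := Ici 0) (by
    rw [Measure.restrict_apply measurableSet_Ici.compl, compl_inter_self, measure_empty])
    (posLaw_null F j) (isLadderSeq_posLaw F).abs_add]
  congr 1
  rw [Measure.dirac_conv, shiftExp, setIntegral_map measurableSet_Ici (by fun_prop) (by fun_prop)]
  simp only [add_comm x]
  congr 2
  ext v
  simp [neg_le_iff_add_nonneg]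

lemma integral_exp_killed_le (hF : IsCenteredStep F σ) {θ : ℝ} (hθ : 0 < θ) :
    ∃ C > 0, ∀ x, 0 ≤ x → ∀ n, ∫ z, Real.exp (-θ * |z|) ∂(killed F (Ici 0) (.dirac x) n) ≤
      C * (1 + x) ^ 2 * wt n := by
  obtain ⟨C₁, hC₁, h₁⟩ := shiftExp_le_wt hF hθ
  obtain ⟨C₂, hC₂, h₂⟩ := (isLadderSeq_posLaw F).exp_le_wt hF hθ
  obtain ⟨C₃, hC₃, h₃⟩ := sum_wt_mul_wt_le
  refine ⟨C₁ * C₂ * C₃, by positivity, fun x hx n => ?_⟩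
  rw [integral_exp_killed hθ.le hx]
  calc _ ≤ ∑ j ∈ Finset.range (n + 1), C₁ * C₂ * (1 + x) ^ 2 * (wt j * wt (n - j)) := by
        refine Finset.sum_le_sum fun j _ => ?_
        calc _ ≤ (C₁ * (1 + x) ^ 2 * wt (n - j)) * (C₂ * wt j) :=
              mul_le_mul (h₁ x hx _) (h₂ j) (integral_exp_nonneg _ _)
                (mul_nonneg (by positivity) (wt_pos _).le)
          _ = _ := by ring
    _ ≤ C₁ * C₂ * (1 + x) ^ 2 * (C₃ * wt n) := by
        rw [← Finset.mul_sum]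
        exact mul_le_mul_of_nonneg_left (h₃ n) (by positivity)
    _ = _ := by ring

lemma tendsto_integral_exp_killed (hF : IsCenteredStep F σ) {θ x : ℝ} (hθ : 0 < θ) (hx : 0 ≤ x) :
    ∃ L, Tendsto (fun n => (∫ z, Real.exp (-θ * |z|) ∂(killed F (Ici 0) (.dirac x) n)) / wt n)
      atTop (𝓝 L) := by
  obtain ⟨C₁, hC₁, h₁⟩ := shiftExp_le_wt hF hθ
  obtain ⟨C₂, hC₂, h₂⟩ := (isLadderSeq_posLaw F).exp_le_wt hF hθ
  obtain ⟨L, hL⟩ := tendsto_shiftExp hF hθ x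
  obtain ⟨M, hM⟩ := (isLadderSeq_posLaw F).tendsto_setIntegral hF hθ (C := 1)
    (f := fun z => Real.exp (-θ * |z|)) (by fun_prop) (fun z => by rw [Real.abs_exp, one_mul])
    (I := (univ : Set ℝ)) MeasurableSet.univ convex_univ
  simp only [Measure.restrict_univ] at hM
  simp only [integral_exp_killed hθ.le hx]
  refine ⟨_, tendsto_sum_conv_div_wt hL hM (C := C₁ * (1 + x) ^ 2 + C₂) (fun n => ?_) fun n => ?_⟩
  · rw [abs_of_nonneg (shiftExp_nonneg _ _ _)]
    refine (h₁ x hx n).trans ?_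
    gcongr
    · exact (wt_pos n).le
    · linarith
  · rw [abs_of_nonneg (integral_exp_nonneg _ _)]
    refine (h₂ n).trans ?_
    gcongr
    · exact (wt_pos n).le
    · nlinarith [sq_nonneg (1 + x)]

lemma abs_integral_exp_mul_killed_le (hF : IsCenteredStep F σ) :
    ∃ C > 0, ∀ (g : ℝ → ℝ) (B : ℝ), (∀ z, |g z| ≤ B) → ∀ x, 0 ≤ x → ∀ n,
      |∫ z, Real.exp (-|z|) * g z ∂(killed F (Ici 0) (.dirac x) n)| ≤
        C * B * (1 + x) ^ 2 * wt n := by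
  obtain ⟨C, hC, h⟩ := integral_exp_killed_le hF one_pos
  refine ⟨C, hC, fun g B hB x hx n => ?_⟩
  have hB0 : 0 ≤ B := (abs_nonneg _).trans (hB 0)
  have h0 := integrable_exp_neg_mul_abs zero_le_one (killed F (Ici 0) (.dirac x) n)
  calc |∫ z, Real.exp (-|z|) * g z ∂(killed F (Ici 0) (.dirac x) n)|
      ≤ ∫ z, B * Real.exp (-1 * |z|) ∂(killed F (Ici 0) (.dirac x) n) := by
        rw [← Real.norm_eq_abs]
        refine norm_integral_le_of_norm_le (h0.const_mul B) (ae_of_all _ fun z => ?_)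
        rw [norm_mul, Real.norm_eq_abs, Real.abs_exp, Real.norm_eq_abs, neg_one_mul, mul_comm]
        gcongr
        exact hB z
    _ ≤ B * (C * (1 + x) ^ 2 * wt n) := by
        rw [integral_const_mul]; exact mul_le_mul_of_nonneg_left (h x hx n) hB0
    _ = _ := by ring

lemma tendsto_integral_polynomial_killed (hF : IsCenteredStep F σ) {x : ℝ} (hx : 0 ≤ x)
    (p : Polynomial ℝ) :
    ∃ L, Tendsto (fun n => (∫ z, Real.exp (-|z|) * p.eval (Real.exp (-|z|))
      ∂(killed F (Ici 0) (.dirac x) n)) / wt n) atTop (𝓝 L) := by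
  choose L hL using fun k : ℕ =>
    tendsto_integral_exp_killed hF (θ := k + 1) (x := x) (by positivity) hx
  refine ⟨∑ k ∈ Finset.range (p.natDegree + 1), p.coeff k * L k, ?_⟩
  refine (tendsto_finsetSum _ fun k _ => (hL k).const_mul (p.coeff k)).congr fun n => ?_
  have h1 (z : ℝ) : Real.exp (-|z|) * p.eval (Real.exp (-|z|)) =
      ∑ k ∈ Finset.range (p.natDegree + 1), p.coeff k * Real.exp (-((k : ℝ) + 1) * |z|) := by
    rw [Polynomial.eval_eq_sum_range, Finset.mul_sum]
    refine Finset.sum_congr rfl fun k _ => ?_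
    rw [← Real.exp_nat_mul, mul_left_comm, ← Real.exp_add]
    ring_nf
  simp_rw [h1]
  rw [integral_finsetSum _ fun k _ => (integrable_exp_neg_mul_abs (by positivity) _).const_mul _]
  rw [Finset.sum_div]
  refine Finset.sum_congr rfl fun k _ => ?_
  rw [integral_const_mul, mul_div_assoc]

lemma tendsto_integral_exp_mul_killed (hF : IsCenteredStep F σ) {x : ℝ} (hx : 0 ≤ x) {h : ℝ → ℝ}
    (hh : ContinuousOn h (Icc 0 1)) :
    ∃ L, Tendsto (fun n => (∫ z, Real.exp (-|z|) * h (Real.exp (-|z|))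
      ∂(killed F (Ici 0) (.dirac x) n)) / wt n) atTop (𝓝 L) := by
  obtain ⟨C, hC, hb⟩ := abs_integral_exp_mul_killed_le hF
  have hmem (z : ℝ) : Real.exp (-|z|) ∈ Icc (0 : ℝ) 1 :=
    ⟨(Real.exp_pos _).le, Real.exp_le_one_iff.2 (by simp)⟩
  have hcont : Continuous fun z => h (Real.exp (-|z|)) :=
    hh.comp_continuous (by fun_prop) hmem
  have h_intble (g : ℝ → ℝ) (hg : ContinuousOn g (Icc 0 1)) (n : ℕ) :
      Integrable (fun z => Real.exp (-|z|) * g (Real.exp (-|z|)))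
        (killed F (Ici 0) (.dirac x) n) := by
    obtain ⟨B, hB⟩ := isCompact_Icc.exists_bound_of_continuousOn hg
    refine integrable_of_abs_le (C := B) ?_ (fun z => ?_) _
    · have : Continuous fun z => g (Real.exp (-|z|)) := hg.comp_continuous (by fun_prop) hmem
      exact (Continuous.mul (by fun_prop) this).measurable
    · rw [abs_mul, Real.abs_exp]
      have := hB _ (hmem z)
      rw [Real.norm_eq_abs] at this
      nlinarith [(hmem z).1, (hmem z).2, abs_nonneg (g (Real.exp (-|z|)))]
  refine cauchySeq_tendsto_of_complete (Metric.cauchySeq_iff'.2 fun ε hε => ?_)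
  set δ := ε / (4 * (C * (1 + x) ^ 2)) with hδ
  have hδ0 : 0 < δ := by positivity
  obtain ⟨p, hp⟩ := exists_polynomial_near_of_continuousOn 0 1 h hh δ hδ0
  obtain ⟨L, hL⟩ := tendsto_integral_polynomial_killed hF hx p
  obtain ⟨N, hN⟩ := Metric.cauchySeq_iff'.1 hL.cauchySeq (ε / 2) (by positivity)
  have hdiff (n : ℕ) : |(∫ z, Real.exp (-|z|) * h (Real.exp (-|z|))
      ∂(killed F (Ici 0) (.dirac x) n)) / wt n - (∫ z, Real.exp (-|z|) * p.eval (Real.exp (-|z|))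
      ∂(killed F (Ici 0) (.dirac x) n)) / wt n| ≤ ε / 4 := by
    rw [← sub_div, ← integral_sub (h_intble h hh n) (h_intble _ p.continuousOn n), abs_div,
      abs_of_pos (wt_pos n), div_le_iff₀ (wt_pos n)]
    simp_rw [← mul_sub]
    refine (hb _ δ (fun z => ?_) x hx n).trans (le_of_eq ?_)
    · rw [abs_sub_comm]; exact (hp _ (hmem z)).le
    · rw [hδ]; field_simp
  refine ⟨N, fun n hn => ?_⟩
  have h1 := hN n hn
  have h2 := hdiff n
  have h3 := hdiff N
  rw [Real.dist_eq] at h1 ⊢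
  rw [abs_le] at h2 h3
  rw [abs_lt] at h1 ⊢
  constructor <;> linarith [h1.1, h1.2, h2.1, h2.2, h3.1, h3.2]

lemma wt_antitone : Antitone wt := fun m n h => by
  unfold wt
  have : (m : ℝ) ≤ n := by exact_mod_cast h
  gcongr

lemma le_integral_exp_posLaw (hF : IsCenteredStep F σ) :
    ∃ c > 0, ∀ᶠ n in atTop, c * wt n ≤ ∫ z, Real.exp (-|z|) ∂(posLaw F n) := by
  have hM := isLadderSeq_posLaw F
  have hlim := tendsto_sqrt_mul_setIntegral_convPow hF (f := fun y => Real.exp (-1 * |y|))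
    (s := Ici 0) (C := 1 + 2 / 1 ^ 2) (by fun_prop) (fun y => by
      rw [Real.abs_exp]; exact exp_neg_mul_abs_le one_pos y) measurableSet_Ici
    ((convex_Ici (0 : ℝ)).addHaar_frontier volume)
  set c := (σ * √(2 * Real.pi))⁻¹ * ∫ y in Ici 0, Real.exp (-1 * |y|)
  have hc : 0 < c := by
    refine mul_pos (inv_pos.2 (mul_pos hF.pos (by positivity))) ?_
    have : ∫ y in Ici (0 : ℝ), Real.exp (-1 * |y|) = 1 := by
      rw [integral_Ici_eq_integral_Ioi]
      refine Eq.trans ?_ integral_exp_neg_Ioi_zero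
      refine setIntegral_congr_fun measurableSet_Ioi fun y hy => ?_
      rw [abs_of_pos hy, neg_one_mul]
    rw [this]; exact one_pos
  refine ⟨c / 2, by positivity, ?_⟩
  rw [← map_add_atTop_eq_nat 1, eventually_map]
  filter_upwards [((tendsto_add_atTop_iff_nat 1).2 hlim).eventually_const_le
    (show c / 2 < c by linarith)] with n hn
  have h1 := hM.exp_succ zero_le_one n
  have h2 : ∫ y in Ici 0, Real.exp (-1 * |y|) ∂(convPow F (n + 1)) ≤
      ((n : ℝ) + 1) * ∫ x, Real.exp (-1 * |x|) ∂(posLaw F (n + 1)) := by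
    rw [h1]
    have := Finset.single_le_sum (f := fun j =>
      (∫ y in Ici 0, Real.exp (-1 * |y|) ∂(convPow F (n - j + 1))) *
        ∫ z, Real.exp (-1 * |z|) ∂(posLaw F j))
      (fun j _ => mul_nonneg (integral_exp_nonneg _ _) (integral_exp_nonneg _ _))
      (Finset.mem_range.2 (Nat.succ_pos n))
    rwa [hM.exp_zero, mul_one] at this
  push_cast at hn
  simp only [neg_one_mul] at h2 hn
  refine (mul_le_mul_of_nonneg_left (wt_antitone n.le_succ) (by positivity)).trans ?_
  rw [wt, ← div_eq_mul_inv, div_le_iff₀ (by positivity)]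
  have h3 := mul_le_mul_of_nonneg_left h2 (Real.sqrt_nonneg ((n : ℝ) + 1))
  linarith

end Ladder

section Path

/-- The value at time `n` of the walk whose increments are the first coordinates. -/
def pathSum (n : ℕ) (ω : ℕ → ℝ × ℝ) : ℝ := ∑ i ∈ Finset.range n, (ω i).1

/-- Follow `ω` during `i` steps and `ω'` afterwards. -/
def concat (i : ℕ) (ω ω' : ℕ → ℝ × ℝ) : ℕ → ℝ × ℝ := fun j => if j < i then ω j else ω' (j - i)

/-- The walk started from `x` is nonnegative up to time `n`. -/
def aboveSet (n : ℕ) (x : ℝ) : Set (ℕ → ℝ × ℝ) := {ω | ∀ j ≤ n, 0 ≤ x + pathSum j ω}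

/-- The law of a sequence of independent variables with law `ν`. -/
abbrev pathLaw (ν : Measure (ℝ × ℝ)) [IsProbabilityMeasure ν] : Measure (ℕ → ℝ × ℝ) :=
  Measure.infinitePi fun _ => ν

@[simp] lemma pathSum_zero (ω : ℕ → ℝ × ℝ) : pathSum 0 ω = 0 := by simp [pathSum]

lemma pathSum_succ (n : ℕ) (ω : ℕ → ℝ × ℝ) : pathSum (n + 1) ω = pathSum n ω + (ω n).1 :=
  Finset.sum_range_succ _ _

@[fun_prop] lemma measurable_pathSum (n : ℕ) : Measurable (pathSum n) := by
  unfold pathSum; fun_prop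

lemma measurableSet_aboveSet (n : ℕ) (x : ℝ) : MeasurableSet (aboveSet n x) := by
  simp only [aboveSet, ofPred_forall]
  exact MeasurableSet.iInter fun j => MeasurableSet.iInter fun _ =>
    measurableSet_le measurable_const (by fun_prop)

lemma aboveSet_anti {m n : ℕ} (h : m ≤ n) (x : ℝ) : aboveSet n x ⊆ aboveSet m x :=
  fun _ hω j hj => hω j (hj.trans h)

lemma aboveSet_mono (n : ℕ) {x y : ℝ} (h : x ≤ y) : aboveSet n x ⊆ aboveSet n y :=
  fun _ hω j hj => (hω j hj).trans (by linarith)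

lemma concat_of_lt {i j : ℕ} (h : j < i) (ω ω' : ℕ → ℝ × ℝ) : concat i ω ω' j = ω j := if_pos h

@[simp] lemma concat_add (i j : ℕ) (ω ω' : ℕ → ℝ × ℝ) : concat i ω ω' (i + j) = ω' j := by
  simp [concat]

lemma pathSum_concat_of_le {i j : ℕ} (h : j ≤ i) (ω ω' : ℕ → ℝ × ℝ) :
    pathSum j (concat i ω ω') = pathSum j ω :=
  Finset.sum_congr rfl fun k hk => by
    rw [concat_of_lt ((Finset.mem_range.1 hk).trans_le h)]

lemma pathSum_concat_add (i j : ℕ) (ω ω' : ℕ → ℝ × ℝ) :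
    pathSum (i + j) (concat i ω ω') = pathSum i ω + pathSum j ω' := by
  induction j with
  | zero => simp [pathSum_concat_of_le le_rfl]
  | succ j ih => rw [← add_assoc, pathSum_succ, ih, pathSum_succ, concat_add, add_assoc]

lemma concat_mem_aboveSet (i j : ℕ) (x : ℝ) (ω ω' : ℕ → ℝ × ℝ) :
    concat i ω ω' ∈ aboveSet (i + j) x ↔
      ω ∈ aboveSet i x ∧ ω' ∈ aboveSet j (x + pathSum i ω) := by
  refine ⟨fun h => ⟨fun k hk => ?_, fun k hk => ?_⟩, fun ⟨h1, h2⟩ k hk => ?_⟩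
  · rw [← pathSum_concat_of_le hk ω ω']; exact h k (by omega)
  · rw [add_assoc, ← pathSum_concat_add]; exact h _ (by omega)
  · rcases le_total k i with hki | hki
    · rw [pathSum_concat_of_le hki]; exact h1 k hki
    · obtain ⟨l, rfl⟩ := Nat.exists_eq_add_of_le hki
      rw [pathSum_concat_add, ← add_assoc]
      exact h2 l (by omega)

@[fun_prop] lemma measurable_concat (i : ℕ) :
    Measurable fun p : (ℕ → ℝ × ℝ) × (ℕ → ℝ × ℝ) => concat i p.1 p.2 := by
  refine measurable_pi_lambda _ fun j => ?_
  unfold concat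
  split_ifs <;> fun_prop

variable (ν : Measure (ℝ × ℝ)) [IsProbabilityMeasure ν]

lemma map_concat (i : ℕ) :
    ((pathLaw ν).prod (pathLaw ν)).map (fun p => concat i p.1 p.2) = pathLaw ν := by
  refine Measure.eq_infinitePi _ fun s t ht => ?_
  have hpi (u : Finset ℕ) (t : ℕ → Set (ℝ × ℝ)) (ht : ∀ i, MeasurableSet (t i)) :
      MeasurableSet (Set.pi (u : Set ℕ) t) :=
    MeasurableSet.pi u.countable_toSet fun i _ => ht i
  set s₁ := s.filter (· < i)
  set s₂ := (s.filter (¬ · < i)).image (· - i)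
  have hpre : (fun p : (ℕ → ℝ × ℝ) × (ℕ → ℝ × ℝ) => concat i p.1 p.2) ⁻¹' (Set.pi (s : Set ℕ) t) =
      (Set.pi (s₁ : Set ℕ) t) ×ˢ (Set.pi (s₂ : Set ℕ) fun j => t (j + i)) := by
    ext ⟨ω, ω'⟩
    simp only [mem_preimage, Set.mem_pi, mem_prod, s₁, s₂, Finset.coe_filter,
      Finset.coe_image, mem_ofPred_eq, Finset.mem_coe, mem_image, concat]
    refine ⟨fun h => ⟨fun j hj => ?_, ?_⟩, fun ⟨h1, h2⟩ j hj => ?_⟩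
    · simpa [hj.2] using h j hj.1
    · rintro _ ⟨j, hj, rfl⟩
      simpa [hj.2, Nat.sub_add_cancel (not_lt.1 hj.2)] using h j hj.1
    · by_cases hji : j < i
      · simpa [hji] using h1 j ⟨hj, hji⟩
      · simpa [hji, Nat.sub_add_cancel (not_lt.1 hji)] using h2 (j - i) ⟨j, ⟨hj, hji⟩, rfl⟩
  rw [Measure.map_apply (by fun_prop) (hpi s t ht), hpre, Measure.prod_prod,
    Measure.infinitePi_pi _ fun i _ => ht i, Measure.infinitePi_pi _ fun j _ => ht (j + i),
    Finset.prod_image, ← Finset.prod_filter_mul_prod_filter_not s (· < i)]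
  · congr 1
    refine Finset.prod_congr rfl fun j hj => ?_
    rw [Nat.sub_add_cancel (not_lt.1 (Finset.mem_filter.1 hj).2)]
  · intro a ha b hb hab
    simp only [Finset.coe_filter, mem_ofPred_eq, not_lt] at ha hb
    simp only at hab
    omega

lemma integral_concat {f : (ℕ → ℝ × ℝ) → ℝ} (hf : Integrable f (pathLaw ν)) (i : ℕ) :
    ∫ ω, f ω ∂(pathLaw ν) = ∫ ω, ∫ ω', f (concat i ω ω') ∂(pathLaw ν) ∂(pathLaw ν) := by
  have hf' := hf
  rw [← map_concat ν i] at hf'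
  have h := hf'.comp_measurable (measurable_concat i)
  conv_lhs => rw [← map_concat ν i]
  rw [integral_map (measurable_concat i).aemeasurable hf'.aestronglyMeasurable]
  exact integral_prod _ h

lemma map_restrict_aboveSet {x : ℝ} (hx : 0 ≤ x) (n : ℕ) :
    ((pathLaw ν).restrict (aboveSet n x)).map (fun ω => x + pathSum n ω) =
      killed (ν.map Prod.fst) (Ici 0) (.dirac x) n := by
  induction n with
  | zero =>
    have : aboveSet 0 x = univ := by ext ω; simp [aboveSet, hx]
    simp [this, killed]
  | succ n ih =>
    have hstep : ν.map Prod.fst = (pathLaw ν).map fun ω => (ω 0).1 := by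
      conv_lhs => rw [← Measure.infinitePi_map_eval (fun _ : ℕ => ν) 0]
      rw [Measure.map_map (by fun_prop) (by fun_prop)]
      rfl
    rw [killed, ← ih]
    conv_rhs => rw [hstep]
    rw [Measure.conv, Measure.map_prod_map _ _ (by fun_prop) (by fun_prop),
      Measure.map_map (by fun_prop) (by fun_prop)]
    have h1 : ((pathLaw ν).restrict (aboveSet n x)).prod (pathLaw ν) =
        ((pathLaw ν).prod (pathLaw ν)).restrict (aboveSet n x ×ˢ univ) := by
      rw [← Measure.prod_restrict, Measure.restrict_univ]
    rw [h1]
    ext A hA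
    rw [Measure.restrict_apply hA, Measure.map_apply (by fun_prop) hA,
      Measure.map_apply (by fun_prop) (hA.inter measurableSet_Ici),
      Measure.restrict_apply ((by fun_prop : Measurable fun ω => x + pathSum (n + 1) ω) hA),
      Measure.restrict_apply (by
        exact (by fun_prop : Measurable ((fun p : ℝ × ℝ => p.1 + p.2) ∘
          Prod.map (fun ω => x + pathSum n ω) fun ω : ℕ → ℝ × ℝ => (ω 0).1))
            (hA.inter measurableSet_Ici))]
    conv_lhs => rw [← map_concat ν n]
    rw [Measure.map_apply (by fun_prop) (((by fun_prop : Measurable fun ω =>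
      x + pathSum (n + 1) ω) hA).inter (measurableSet_aboveSet _ _))]
    congr 1
    ext ⟨ω, ω'⟩
    have h2 : ω' ∈ aboveSet 1 (x + pathSum n ω) ↔
        0 ≤ x + pathSum n ω ∧ 0 ≤ x + pathSum n ω + (ω' 0).1 := by
      refine ⟨fun h => ⟨by simpa using h 0 zero_le_one, by
        simpa [pathSum_succ] using h 1 le_rfl⟩, fun ⟨h0, h1⟩ j hj => ?_⟩
      interval_cases j
      · simpa using h0
      · simpa [pathSum_succ] using h1
    simp only [mem_inter_iff, mem_preimage, concat_mem_aboveSet, pathSum_concat_add, h2, mem_prod,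
      mem_univ, Function.comp_apply, Prod.map_apply, mem_Ici, and_true]
    simp only [pathSum_succ, pathSum_zero, zero_add, ← add_assoc]
    have h3 : ω ∈ aboveSet n x → 0 ≤ x + pathSum n ω := fun h => h n le_rfl
    tauto

lemma setIntegral_aboveSet {x : ℝ} (hx : 0 ≤ x) (n : ℕ) {g : ℝ → ℝ} (hg : Measurable g) :
    ∫ ω in aboveSet n x, g (x + pathSum n ω) ∂(pathLaw ν) =
      ∫ z, g z ∂(killed (ν.map Prod.fst) (Ici 0) (.dirac x) n) := by
  rw [← map_restrict_aboveSet ν hx, integral_map (by fun_prop) hg.aestronglyMeasurable]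

end Path

section Path

variable {ν : Measure (ℝ × ℝ)} [IsProbabilityMeasure ν] {σ : ℝ}

variable (ν) in
lemma integrableOn_of_abs_le {s : Set (ℕ → ℝ × ℝ)} (hs : MeasurableSet s) {f : (ℕ → ℝ × ℝ) → ℝ}
    (hf : Measurable f) {C : ℝ} (hb : ∀ ω ∈ s, |f ω| ≤ C) : IntegrableOn f s (pathLaw ν) :=
  Integrable.of_bound hf.aestronglyMeasurable C
    ((ae_restrict_iff' hs).2 (ae_of_all _ fun ω hω => by simpa using hb ω hω))

lemma exp_neg_pathSum_le {n j : ℕ} (hj : j ≤ n) {x : ℝ} {ω : ℕ → ℝ × ℝ} (hω : ω ∈ aboveSet n x) :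
    Real.exp (-pathSum j ω) ≤ Real.exp x := by
  rw [Real.exp_le_exp]
  linarith [hω j hj]

variable (ν) in
lemma integrableOn_exp_pathSum {θ : ℝ} (hθ : 0 ≤ θ) (n : ℕ) (x : ℝ) :
    IntegrableOn (fun ω => Real.exp (-θ * pathSum n ω)) (aboveSet n x) (pathLaw ν) := by
  refine integrableOn_of_abs_le ν (measurableSet_aboveSet n x) (by fun_prop)
    (C := Real.exp (θ * x)) fun ω hω => ?_
  rw [Real.abs_exp, Real.exp_le_exp]
  nlinarith [hω n le_rfl]

lemma setIntegral_exp_pathSum_le (hF : IsCenteredStep (ν.map Prod.fst) σ) {θ : ℝ} (hθ : 0 < θ) :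
    ∃ C > 0, ∀ x, 0 ≤ x → ∀ n, ∫ ω in aboveSet n x, Real.exp (-θ * pathSum n ω) ∂(pathLaw ν) ≤
      C * Real.exp (θ * x) * (1 + x) ^ 2 * wt n := by
  have : IsProbabilityMeasure (ν.map Prod.fst) :=
    Measure.isProbabilityMeasure_map measurable_fst.aemeasurable
  obtain ⟨C, hC, h⟩ := integral_exp_killed_le hF hθ
  refine ⟨C, hC, fun x hx n => ?_⟩
  calc _ = ∫ ω in aboveSet n x, Real.exp (θ * x) * Real.exp (-θ * |x + pathSum n ω|)
        ∂(pathLaw ν) := by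
        refine setIntegral_congr_fun (measurableSet_aboveSet n x) fun ω hω => ?_
        rw [← Real.exp_add, abs_of_nonneg (hω n le_rfl)]
        ring_nf
    _ = Real.exp (θ * x) * ∫ z, Real.exp (-θ * |z|)
          ∂(killed (ν.map Prod.fst) (Ici 0) (.dirac x) n) := by
        rw [integral_const_mul, setIntegral_aboveSet ν hx n (g := fun z => Real.exp (-θ * |z|))
          (by fun_prop)]
    _ ≤ Real.exp (θ * x) * (C * (1 + x) ^ 2 * wt n) :=
        mul_le_mul_of_nonneg_left (h x hx n) (Real.exp_pos _).le
    _ = _ := by ring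

lemma one_add_sq_le_exp {z : ℝ} (hz : 0 ≤ z) : (1 + z) ^ 2 ≤ 16 * Real.exp (z / 2) := by
  have h1 := Real.add_one_le_exp (z / 4)
  have h2 : Real.exp (z / 2) = Real.exp (z / 4) ^ 2 := by rw [← Real.exp_nat_mul]; congr 1; ring
  rw [h2]
  have h3 : 1 + z ≤ 4 * Real.exp (z / 4) := by linarith
  nlinarith

lemma setIntegral_exp_mul_exp_le (hF : IsCenteredStep (ν.map Prod.fst) σ) {x : ℝ} (hx : 0 ≤ x) :
    ∃ C > 0, ∀ i j : ℕ, ∫ ω in aboveSet (i + j) x,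
      Real.exp (-pathSum i ω) * Real.exp (-pathSum (i + j) ω) ∂(pathLaw ν) ≤
        C * (wt i * wt j) := by
  obtain ⟨C₁, hC₁, h₁⟩ := setIntegral_exp_pathSum_le hF one_pos
  obtain ⟨C₂, hC₂, h₂⟩ := setIntegral_exp_pathSum_le hF one_half_pos
  set D := C₁ * (16 * Real.exp (3 * x / 2)) with hD
  refine ⟨D * (C₂ * Real.exp (1 / 2 * x) * (1 + x) ^ 2), by positivity, fun i j => ?_⟩
  have h_intble : IntegrableOn (fun ω => Real.exp (-pathSum i ω) * Real.exp (-pathSum (i + j) ω))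
      (aboveSet (i + j) x) (pathLaw ν) := by
    refine integrableOn_of_abs_le ν (measurableSet_aboveSet _ x) (by fun_prop)
      (C := Real.exp x * Real.exp x) fun ω hω => ?_
    rw [abs_mul, Real.abs_exp, Real.abs_exp]
    exact mul_le_mul (exp_neg_pathSum_le (by omega) hω) (exp_neg_pathSum_le le_rfl hω)
      (Real.exp_pos _).le (Real.exp_pos _).le
  rw [← integral_indicator (measurableSet_aboveSet _ _),
    integral_concat ν (h_intble.integrable_indicator (measurableSet_aboveSet _ _)) i]
  have hin (ω : ℕ → ℝ × ℝ) : ∫ ω', (aboveSet (i + j) x).indicator (fun ω =>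
        Real.exp (-pathSum i ω) * Real.exp (-pathSum (i + j) ω)) (concat i ω ω') ∂(pathLaw ν) ≤
      (aboveSet i x).indicator (fun ω => D * wt j * Real.exp (-(1 / 2) * pathSum i ω)) ω := by
    by_cases hω : ω ∈ aboveSet i x
    · rw [indicator_of_mem hω]
      have h0 : 0 ≤ x + pathSum i ω := hω i le_rfl
      calc _ = ∫ ω', (aboveSet j (x + pathSum i ω)).indicator (fun ω' =>
            Real.exp (-2 * pathSum i ω) * Real.exp (-1 * pathSum j ω')) ω' ∂(pathLaw ν) := by
            refine integral_congr_ae (ae_of_all _ fun ω' => ?_)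
            by_cases hω' : ω' ∈ aboveSet j (x + pathSum i ω)
            · simp only
              rw [indicator_of_mem ((concat_mem_aboveSet i j x ω ω').2 ⟨hω, hω'⟩),
                indicator_of_mem hω', pathSum_concat_of_le le_rfl, pathSum_concat_add,
                ← Real.exp_add, ← Real.exp_add]
              ring_nf
            · simp only
              rw [indicator_of_notMem (fun h => hω' ((concat_mem_aboveSet i j x ω ω').1 h).2),
                indicator_of_notMem hω']
        _ = Real.exp (-2 * pathSum i ω) * ∫ ω' in aboveSet j (x + pathSum i ω),
              Real.exp (-1 * pathSum j ω') ∂(pathLaw ν) := by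
            rw [integral_indicator (measurableSet_aboveSet _ _), integral_const_mul]
        _ ≤ Real.exp (-2 * pathSum i ω) * (C₁ * Real.exp (1 * (x + pathSum i ω)) *
              (1 + (x + pathSum i ω)) ^ 2 * wt j) :=
            mul_le_mul_of_nonneg_left (h₁ _ h0 j) (Real.exp_pos _).le
        _ ≤ Real.exp (-2 * pathSum i ω) * (C₁ * Real.exp (1 * (x + pathSum i ω)) *
              (16 * Real.exp ((x + pathSum i ω) / 2)) * wt j) := by
            have := (wt_pos j).le
            gcongr
            exact one_add_sq_le_exp h0
        _ = _ := by
            have : Real.exp (-2 * pathSum i ω) * Real.exp (1 * (x + pathSum i ω)) *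
                Real.exp ((x + pathSum i ω) / 2) =
                Real.exp (3 * x / 2) * Real.exp (-(1 / 2) * pathSum i ω) := by
              rw [← Real.exp_add, ← Real.exp_add, ← Real.exp_add]; ring_nf
            rw [hD]
            linear_combination C₁ * 16 * wt j * this
    · rw [indicator_of_notMem hω]
      refine (integral_eq_zero_of_ae (ae_of_all _ fun ω' => ?_)).le
      exact indicator_of_notMem (fun h => hω ((concat_mem_aboveSet i j x ω ω').1 h).1) _
  calc _ ≤ ∫ ω, (aboveSet i x).indicator
        (fun ω => D * wt j * Real.exp (-(1 / 2) * pathSum i ω)) ω ∂(pathLaw ν) := by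
        refine integral_mono_of_nonneg (ae_of_all _ fun ω => integral_nonneg fun ω' =>
          indicator_nonneg (fun _ _ => by positivity) _) ?_ (ae_of_all _ hin)
        exact (integrable_indicator_iff (measurableSet_aboveSet _ _)).2
          ((integrableOn_exp_pathSum ν (θ := 1 / 2) (by norm_num) i x).const_mul _)
    _ = D * wt j * ∫ ω in aboveSet i x, Real.exp (-(1 / 2) * pathSum i ω) ∂(pathLaw ν) := by
        rw [integral_indicator (measurableSet_aboveSet _ _), integral_const_mul]
    _ ≤ D * wt j * (C₂ * Real.exp (1 / 2 * x) * (1 + x) ^ 2 * wt i) := by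
        have := (wt_pos j).le
        gcongr
        exact h₂ x hx i
    _ = _ := by ring

/-- A function dominated by `exp (-S_n + 2 min_{i ≤ n} S_i)` has a small integral over the paths
whose minimum is low. -/
lemma exists_tail_bound (hF : IsCenteredStep (ν.map Prod.fst) σ) {ℓ : ℝ}
    (hℓ : ∀ᵐ ω ∂(pathLaw ν), ∀ i, ℓ ≤ (ω i).1) :
    ∃ ε : ℕ → ℝ, Tendsto ε atTop (𝓝 0) ∧ ∀ (C : ℝ) (f : (ℕ → ℝ × ℝ) → ℝ) (n K : ℕ), 0 ≤ C →
      (∀ᵐ ω ∂(pathLaw ν), 0 ≤ f ω) →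
      (∀ᵐ ω ∂(pathLaw ν), ∀ i ≤ n,
        f ω ≤ C * (Real.exp (-pathSum n ω) * Real.exp (2 * pathSum i ω))) →
      ∫ ω in (aboveSet n K)ᶜ, f ω ∂(pathLaw ν) ≤ C * ε K * wt n := by
  obtain ⟨C₁, hC₁, h₁⟩ := setIntegral_exp_pathSum_le hF one_pos
  set q := Real.exp (-(1 / 2)) with hq
  have hq0 : 0 < q := Real.exp_pos _
  have hq1 : q < 1 := by rw [hq, Real.exp_lt_one_iff]; norm_num
  set B := C₁ * (16 * Real.exp (3 / 2)) with hB
  refine ⟨fun K => B * (q ^ K / (1 - q)), ?_, fun C f n K hC hf0 hf => ?_⟩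
  · have := ((tendsto_pow_atTop_nhds_zero_of_lt_one hq0.le hq1).div_const (1 - q)).const_mul B
    simpa using this
  obtain ⟨N, hN⟩ := exists_nat_ge ((n : ℝ) * |ℓ|)
  have hN' : ∀ᵐ ω ∂(pathLaw ν), ω ∈ aboveSet n N := by
    filter_upwards [hℓ] with ω hω j hj
    have h1 : (j : ℝ) * ℓ ≤ pathSum j ω := by
      have := Finset.card_nsmul_le_sum (Finset.range j) (fun i => (ω i).1) ℓ fun i _ => hω i
      simpa [pathSum] using this
    have h2 : (j : ℝ) ≤ n := by exact_mod_cast hj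
    have h3 : (j : ℝ) * |ℓ| ≤ n * |ℓ| := by gcongr
    have h4 : -((j : ℝ) * |ℓ|) ≤ j * ℓ := by
      rw [← mul_neg]; exact mul_le_mul_of_nonneg_left (neg_abs_le ℓ) j.cast_nonneg
    linarith
  have h_intble (j : ℕ) : Integrable ((aboveSet n ((j : ℝ) + 1)).indicator fun ω =>
      C * Real.exp (-2 * j) * Real.exp (-1 * pathSum n ω)) (pathLaw ν) :=
    (integrable_indicator_iff (measurableSet_aboveSet _ _)).2
      ((integrableOn_exp_pathSum ν zero_le_one n _).const_mul _)
  rw [← integral_indicator (measurableSet_aboveSet _ _).compl]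
  calc _ ≤ ∫ ω, ∑ j ∈ Finset.Ico K N, (aboveSet n ((j : ℝ) + 1)).indicator (fun ω =>
        C * Real.exp (-2 * j) * Real.exp (-1 * pathSum n ω)) ω ∂(pathLaw ν) := by
        refine integral_mono_of_nonneg ?_ (integrable_finsetSum _ fun j _ => h_intble j) ?_
        · filter_upwards [hf0] with ω hω
          exact indicator_apply_nonneg fun _ => hω
        · filter_upwards [hf, hN'] with ω hω hωN
          have hterm (j : ℕ) : 0 ≤ (aboveSet n ((j : ℝ) + 1)).indicator (fun ω =>
              C * Real.exp (-2 * j) * Real.exp (-1 * pathSum n ω)) ω :=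
            indicator_nonneg (fun _ _ => by positivity) _
          by_cases hK : ω ∈ aboveSet n K
          · rw [indicator_of_notMem (by simpa using hK)]
            exact Finset.sum_nonneg fun j _ => hterm j
          rw [indicator_of_mem (by simpa using hK)]
          classical
          have hex : ∃ M : ℕ, ω ∈ aboveSet n (M : ℝ) := ⟨N, hωN⟩
          set M := Nat.find hex
          have hM : ω ∈ aboveSet n (M : ℝ) := Nat.find_spec hex
          have hMN : M ≤ N := Nat.find_min' hex hωN
          have hKM : K < M := by
            by_contra h
            exact hK (aboveSet_mono n (by exact_mod_cast not_lt.1 h) hM)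
          obtain ⟨k, hk⟩ := Nat.exists_eq_succ_of_ne_zero (by omega : M ≠ 0)
          have hk' : ω ∉ aboveSet n (k : ℝ) := Nat.find_min hex (by omega : k < M)
          simp only [aboveSet, mem_ofPred_eq, not_forall, not_le] at hk'
          obtain ⟨i, hi, hik⟩ := hk'
          refine le_trans ?_ (Finset.single_le_sum (fun j _ => hterm j)
            (Finset.mem_Ico.2 ⟨by omega, by omega⟩ : k ∈ Finset.Ico K N))
          rw [indicator_of_mem (by
            have : (M : ℝ) = k + 1 := by rw [hk]; push_cast; ring
            rwa [← this])]
          refine (hω i hi).trans ?_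
          rw [mul_assoc C, mul_comm (Real.exp (-pathSum n ω)), neg_one_mul]
          have h2 : Real.exp (2 * pathSum i ω) ≤ Real.exp (-2 * (k : ℝ)) :=
            Real.exp_le_exp.2 (by linarith)
          gcongr
    _ = ∑ j ∈ Finset.Ico K N, C * Real.exp (-2 * j) * ∫ ω in aboveSet n ((j : ℝ) + 1),
          Real.exp (-1 * pathSum n ω) ∂(pathLaw ν) := by
        rw [integral_finsetSum _ fun j _ => h_intble j]
        refine Finset.sum_congr rfl fun j _ => ?_
        rw [integral_indicator (measurableSet_aboveSet _ _), integral_const_mul]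
    _ ≤ ∑ j ∈ Finset.Ico K N, C * B * wt n * q ^ j := by
        refine Finset.sum_le_sum fun j _ => ?_
        have h2 := h₁ ((j : ℝ) + 1) (by positivity) n
        have h3 := one_add_sq_le_exp (z := (j : ℝ) + 1) (by positivity)
        have hw := (wt_pos n).le
        calc _ ≤ C * Real.exp (-2 * j) * (C₁ * Real.exp (1 * ((j : ℝ) + 1)) *
              (16 * Real.exp (((j : ℝ) + 1) / 2)) * wt n) := by
              gcongr
              exact h2.trans (by gcongr)
          _ = C * C₁ * 16 * wt n * (Real.exp (-2 * j) * Real.exp (1 * ((j : ℝ) + 1)) *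
              Real.exp (((j : ℝ) + 1) / 2)) := by ring
          _ = C * C₁ * 16 * wt n * (Real.exp (3 / 2) * q ^ j) := by
              rw [hq, ← Real.exp_nat_mul, ← Real.exp_add, ← Real.exp_add, ← Real.exp_add]
              ring_nf
          _ = _ := by rw [hB]; ring
    _ ≤ C * B * wt n * (q ^ K / (1 - q)) := by
        rw [← Finset.mul_sum]
        have hw := (wt_pos n).le
        gcongr
        exact geom_sum_Ico_le_of_lt_one hq0.le hq1
    _ = _ := by ring

lemma map_fst_eq_map_pathLaw (ν : Measure (ℝ × ℝ)) [IsProbabilityMeasure ν] (i : ℕ) :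
    ν.map Prod.fst = (pathLaw ν).map fun ω => (ω i).1 := by
  conv_lhs => rw [← Measure.infinitePi_map_eval (fun _ : ℕ => ν) i]
  rw [Measure.map_map (by fun_prop) (by fun_prop)]
  rfl

lemma memLp_coord (hF : IsCenteredStep (ν.map Prod.fst) σ) (i : ℕ) :
    MemLp (fun ω : ℕ → ℝ × ℝ => (ω i).1) 2 (pathLaw ν) := by
  have hm : Measurable fun ω : ℕ → ℝ × ℝ => (ω i).1 := by fun_prop
  rw [memLp_two_iff_integrable_sq hm.aestronglyMeasurable]
  have h := hF.sq_int
  rw [map_fst_eq_map_pathLaw ν i] at h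
  exact (integrable_map_measure (by fun_prop) hm.aemeasurable).1 h

lemma memLp_pathSum (hF : IsCenteredStep (ν.map Prod.fst) σ) (n : ℕ) :
    MemLp (pathSum n) 2 (pathLaw ν) := by
  induction n with
  | zero =>
    have : pathSum 0 = fun _ => 0 := by ext; simp
    rw [this]; exact memLp_const 0
  | succ n ih =>
    have : pathSum (n + 1) = fun ω => pathSum n ω + (ω n).1 := by ext; rw [pathSum_succ]
    rw [this]; exact ih.add (memLp_coord hF n)

lemma integrable_one_add_pathSum_sq (hF : IsCenteredStep (ν.map Prod.fst) σ) (n : ℕ) (x : ℝ) :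
    Integrable (fun ω => (1 + (x + pathSum n ω)) ^ 2) (pathLaw ν) := by
  have h3 : MemLp (fun ω : ℕ → ℝ × ℝ => 1 + (x + pathSum n ω)) 2 (pathLaw ν) :=
    (memLp_const (1 : ℝ)).add ((memLp_const x).add (memLp_pathSum hF n))
  exact (memLp_two_iff_integrable_sq h3.1).1 h3
end Path

section Path

variable {ν : Measure (ℝ × ℝ)} [IsProbabilityMeasure ν] {σ : ℝ}

/-- Convergence of normalised integrals of functionals depending on the first `J` steps, on the
final steps and on the position of the walk in between. -/
lemma tendsto_setIntegral_block (hF : IsCenteredStep (ν.map Prod.fst) σ)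
    {A : Set (ℕ → ℝ × ℝ)} (hA : ∀ᵐ ω ∂(pathLaw ν), ω ∈ A)
    {Ψ : (ℕ → ℝ × ℝ) → (ℕ → ℝ × ℝ) → ℝ → ℝ}
    (hΨ : Measurable fun p : ((ℕ → ℝ × ℝ) × (ℕ → ℝ × ℝ)) × ℝ => Ψ p.1.1 p.1.2 p.2) {B : ℝ}
    (hB : ∀ ω₁ ∈ A, ∀ ω₃ ∈ A, ∀ u ∈ Icc (0 : ℝ) 1, |Ψ ω₁ ω₃ u| ≤ B)
    (hc : ∀ ω₁ ∈ A, ∀ ω₃ ∈ A, ContinuousOn (Ψ ω₁ ω₃) (Icc 0 1)) (J : ℕ) (K : ℝ)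
    {f : ℕ → (ℕ → ℝ × ℝ) → ℝ}
    (hfi : ∀ m, IntegrableOn (f m) (aboveSet (J + m) K) (pathLaw ν))
    (hf : ∀ m, ∀ ω₁ ∈ A, ∀ ω₂ ∈ A, ∀ ω₃ ∈ A, concat J ω₁ ω₂ ∈ aboveSet (J + m) K →
      f m (concat (J + m) (concat J ω₁ ω₂) ω₃) =
        Real.exp (-(K + pathSum J ω₁ + pathSum m ω₂)) *
          Ψ ω₁ ω₃ (Real.exp (-(K + pathSum J ω₁ + pathSum m ω₂)))) :
    ∃ L, Tendsto (fun m => (∫ ω in aboveSet (J + m) K, f m ω ∂(pathLaw ν)) / wt m)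
      atTop (𝓝 L) := by
  classical
  have : IsProbabilityMeasure (ν.map Prod.fst) :=
    Measure.isProbabilityMeasure_map measurable_fst.aemeasurable
  obtain ⟨C, hC, hbd⟩ := abs_integral_exp_mul_killed_le hF
  set g : (ℕ → ℝ × ℝ) → (ℕ → ℝ × ℝ) → ℝ → ℝ := fun ω₁ ω₃ z =>
    Real.exp (-|z|) * Ψ ω₁ ω₃ (Real.exp (-|z|)) with hg
  have hexp (z : ℝ) : Real.exp (-|z|) ∈ Icc (0 : ℝ) 1 :=
    ⟨(Real.exp_pos _).le, Real.exp_le_one_iff.2 (by simp)⟩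
  have hgm : Measurable fun p : ((ℕ → ℝ × ℝ) × (ℕ → ℝ × ℝ)) × ℝ => g p.1.1 p.1.2 p.2 := by
    have h1 : Measurable fun p : ((ℕ → ℝ × ℝ) × (ℕ → ℝ × ℝ)) × ℝ =>
        Ψ p.1.1 p.1.2 (Real.exp (-|p.2|)) :=
      hΨ.comp (by fun_prop : Measurable fun p : ((ℕ → ℝ × ℝ) × (ℕ → ℝ × ℝ)) × ℝ =>
        (p.1, Real.exp (-|p.2|)))
    exact (by fun_prop : Measurable fun p : ((ℕ → ℝ × ℝ) × (ℕ → ℝ × ℝ)) × ℝ =>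
      Real.exp (-|p.2|)).mul h1
  set G : ℕ → ((ℕ → ℝ × ℝ) × (ℕ → ℝ × ℝ)) × (ℕ → ℝ × ℝ) → ℝ := fun m =>
    {p | concat J p.1.1 p.2 ∈ aboveSet (J + m) K}.indicator
      fun p => g p.1.1 p.1.2 (K + pathSum J p.1.1 + pathSum m p.2) with hG
  have hGm (m : ℕ) : Measurable (G m) := by
    refine Measurable.indicator ?_ ?_
    · exact hgm.comp (by fun_prop : Measurable
        fun p : ((ℕ → ℝ × ℝ) × (ℕ → ℝ × ℝ)) × (ℕ → ℝ × ℝ) =>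
          (p.1, K + pathSum J p.1.1 + pathSum m p.2))
    · exact (measurable_concat J).comp (by fun_prop : Measurable
        fun p : ((ℕ → ℝ × ℝ) × (ℕ → ℝ × ℝ)) × (ℕ → ℝ × ℝ) => (p.1.1, p.2))
          (measurableSet_aboveSet _ _)
  have hGb (m : ℕ) {ω₁ ω₃ : ℕ → ℝ × ℝ} (h1 : ω₁ ∈ A) (h3 : ω₃ ∈ A) (ω₂ : ℕ → ℝ × ℝ) :
      |G m ((ω₁, ω₃), ω₂)| ≤ B := by
    have hB0 : 0 ≤ B := (abs_nonneg _).trans (hB ω₁ h1 ω₃ h3 0 (by simp))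
    rw [hG]
    simp only [indicator_apply]
    split_ifs
    · rw [hg]
      simp only [abs_mul, Real.abs_exp]
      calc _ ≤ 1 * B := mul_le_mul (hexp _).2 (hB ω₁ h1 ω₃ h3 _ (hexp _)) (abs_nonneg _)
            zero_le_one
        _ = B := one_mul B
    · simpa using hB0
  set H : ℕ → (ℕ → ℝ × ℝ) × (ℕ → ℝ × ℝ) → ℝ := fun m p => ∫ ω₂, G m (p, ω₂) ∂(pathLaw ν) with hH
  have hHm (m : ℕ) : StronglyMeasurable (H m) :=
    StronglyMeasurable.integral_prod_right (f := fun p ω₂ => G m (p, ω₂))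
      (hGm m).stronglyMeasurable
  have hHeq (m : ℕ) {ω₁ : ℕ → ℝ × ℝ} (ω₃ : ℕ → ℝ × ℝ) (h1 : ω₁ ∈ aboveSet J K) :
      H m (ω₁, ω₃) = ∫ z, Real.exp (-|z|) * Ψ ω₁ ω₃ (Real.exp (-|z|))
        ∂(killed (ν.map Prod.fst) (Ici 0) (.dirac (K + pathSum J ω₁)) m) := by
    have hgm' : Measurable (g ω₁ ω₃) := hgm.comp
      (by fun_prop : Measurable fun z : ℝ => ((ω₁, ω₃), z))
    rw [← setIntegral_aboveSet ν (h1 J le_rfl) m hgm',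
      ← integral_indicator (measurableSet_aboveSet _ _)]
    refine integral_congr_ae (ae_of_all _ fun ω₂ => ?_)
    simp only [hG, indicator_apply, mem_ofPred_eq, concat_mem_aboveSet, h1, true_and]
  have hHzero (m : ℕ) {ω₁ : ℕ → ℝ × ℝ} (ω₃ : ℕ → ℝ × ℝ) (h1 : ω₁ ∉ aboveSet J K) :
      H m (ω₁, ω₃) = 0 := by
    refine integral_eq_zero_of_ae (ae_of_all _ fun ω₂ => ?_)
    simp only [hG, indicator_apply, mem_ofPred_eq, concat_mem_aboveSet, h1, false_and, if_false,
      Pi.zero_apply]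
  have hHb (m : ℕ) {ω₁ ω₃ : ℕ → ℝ × ℝ} (h1 : ω₁ ∈ A) (h3 : ω₃ ∈ A) :
      |H m (ω₁, ω₃)| ≤ C * B * (1 + (K + pathSum J ω₁)) ^ 2 * wt m := by
    have hB0 : 0 ≤ B := (abs_nonneg _).trans (hB ω₁ h1 ω₃ h3 0 (by simp))
    have := (wt_pos m).le
    by_cases h : ω₁ ∈ aboveSet J K
    · rw [hHeq m ω₃ h]
      exact hbd (fun z => Ψ ω₁ ω₃ (Real.exp (-|z|))) B
        (fun z => hB ω₁ h1 ω₃ h3 _ (hexp z)) _ (h J le_rfl) m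
    · rw [hHzero m ω₃ h, abs_zero]
      positivity
  have hAA : ∀ᵐ p ∂((pathLaw ν).prod (pathLaw ν)), p.1 ∈ A ∧ p.2 ∈ A :=
    (Measure.quasiMeasurePreserving_fst.ae hA).and (Measure.quasiMeasurePreserving_snd.ae hA)
  have hdom : Integrable (fun p : (ℕ → ℝ × ℝ) × (ℕ → ℝ × ℝ) =>
      C * B * (1 + (K + pathSum J p.1)) ^ 2) ((pathLaw ν).prod (pathLaw ν)) :=
    ((integrable_one_add_pathSum_sq hF J K).const_mul (C * B)).comp_fst _
  have hHi (m : ℕ) : Integrable (H m) ((pathLaw ν).prod (pathLaw ν)) := by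
    refine (hdom.mul_const (wt m)).mono' (hHm m).aestronglyMeasurable ?_
    filter_upwards [hAA] with p hp
    exact hHb m hp.1 hp.2
  have hmain (m : ℕ) : ∫ ω in aboveSet (J + m) K, f m ω ∂(pathLaw ν) =
      ∫ p, H m p ∂((pathLaw ν).prod (pathLaw ν)) := by
    have hfi' := (integrable_indicator_iff (measurableSet_aboveSet (J + m) K)).2 (hfi m)
    set φ := (aboveSet (J + m) K).indicator (f m) with hφ
    have hfi2 : Integrable (fun ω => ∫ ω₃, φ (concat (J + m) ω ω₃) ∂(pathLaw ν))
        (pathLaw ν) := by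
      have h := hfi'
      rw [← map_concat ν (J + m)] at h
      exact (h.comp_measurable (measurable_concat (J + m))).integral_prod_left
    rw [← integral_indicator (measurableSet_aboveSet _ _), integral_concat ν hfi' (J + m),
      integral_concat ν hfi2 J, integral_prod _ (hHi m)]
    refine integral_congr_ae ?_
    filter_upwards [hA] with ω₁ h1
    have hswap : Integrable (Function.uncurry fun ω₃ ω₂ => G m ((ω₁, ω₃), ω₂))
        ((pathLaw ν).prod (pathLaw ν)) := by
      refine Integrable.of_bound (C := B) ?_ ?_
      · exact ((hGm m).comp (by fun_prop : Measurable fun p : (ℕ → ℝ × ℝ) × (ℕ → ℝ × ℝ) =>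
          ((ω₁, p.1), p.2))).aestronglyMeasurable
      · filter_upwards [hAA] with p hp
        exact hGb m h1 hp.1 p.2
    rw [hH]
    simp only
    rw [integral_integral_swap hswap]
    refine integral_congr_ae ?_
    filter_upwards [hA] with ω₂ h2
    refine integral_congr_ae ?_
    filter_upwards [hA] with ω₃ h3
    have hiff : concat (J + m) (concat J ω₁ ω₂) ω₃ ∈ aboveSet (J + m) K ↔
        concat J ω₁ ω₂ ∈ aboveSet (J + m) K := by
      simp only [aboveSet, mem_ofPred_eq]
      exact forall₂_congr fun j hj => by rw [pathSum_concat_of_le hj]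
    simp only [hφ, hG, indicator_apply, mem_ofPred_eq, hiff]
    split_ifs with h
    · rw [hf m ω₁ h1 ω₂ h2 ω₃ h3 h, hg]
      have h0 := h (J + m) le_rfl
      rw [pathSum_concat_add, ← add_assoc] at h0
      simp only [abs_of_nonneg h0]
    · rfl
  have hlim : ∀ p : (ℕ → ℝ × ℝ) × (ℕ → ℝ × ℝ), ∃ l, p.1 ∈ A ∧ p.2 ∈ A →
      Tendsto (fun m => H m p / wt m) atTop (𝓝 l) := by
    rintro ⟨ω₁, ω₃⟩
    by_cases h : ω₁ ∈ A ∧ ω₃ ∈ A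
    · by_cases h1 : ω₁ ∈ aboveSet J K
      · obtain ⟨l, hl⟩ := tendsto_integral_exp_mul_killed hF (h1 J le_rfl) (hc ω₁ h.1 ω₃ h.2)
        exact ⟨l, fun _ => by simpa only [hHeq _ ω₃ h1] using hl⟩
      · exact ⟨0, fun _ => by simp only [hHzero _ ω₃ h1, zero_div, tendsto_const_nhds]⟩
    · exact ⟨0, fun h' => absurd h' h⟩
  choose l hl using hlim
  refine ⟨∫ p, l p ∂((pathLaw ν).prod (pathLaw ν)), ?_⟩
  simp only [hmain, ← integral_div]
  refine tendsto_integral_of_dominated_convergence (F := fun m p => H m p / wt m) (f := l)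
    (μ := (pathLaw ν).prod (pathLaw ν)) _
    (fun m => ((hHm m).measurable.div_const _).aestronglyMeasurable) hdom ?_ ?_
  · intro m
    filter_upwards [hAA] with p hp
    rw [Real.norm_eq_abs, abs_div, abs_of_pos (wt_pos m), div_le_iff₀ (wt_pos m)]
    exact hHb m hp.1 hp.2
  · filter_upwards [hAA] with p hp
    exact hl p hp

end Path

section Denominators

/-- The factor by which the survival probabilities are multiplied after an exponential tilt with
parameter `lam` at a generation of scale `h`. -/
def tiltDen (lam h b r : ℝ) : ℝ :=
  r + b * Real.exp (-(lam * h)) + b * ((1 - Real.exp (-(lam * h))) / h) * r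

lemma one_sub_exp_le {lam h : ℝ} : 1 - Real.exp (-(lam * h)) ≤ lam * h := by
  linarith [Real.add_one_le_exp (-(lam * h))]

lemma le_one_sub_exp {x : ℝ} : x * Real.exp (-x) ≤ 1 - Real.exp (-x) := by
  have h1 := Real.add_one_le_exp x
  have h2 : Real.exp x * Real.exp (-x) = 1 := by rw [← Real.exp_add]; simp
  nlinarith [Real.exp_pos (-x)]

lemma one_sub_exp_div_le {lam h : ℝ} (hh : 0 < h) : (1 - Real.exp (-(lam * h))) / h ≤ lam := by
  rw [div_le_iff₀ hh]
  exact one_sub_exp_le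

lemma le_one_sub_exp_div {lam h : ℝ} (hh : 0 < h) :
    lam * Real.exp (-(lam * h)) ≤ (1 - Real.exp (-(lam * h))) / h := by
  rw [le_div_iff₀ hh]
  linarith [le_one_sub_exp (x := lam * h)]

lemma sub_one_sub_exp_div_le {lam h : ℝ} (hlam : 0 ≤ lam) (hh : 0 < h) :
    lam - (1 - Real.exp (-(lam * h))) / h ≤ lam ^ 2 * h := by
  have h1 := le_one_sub_exp_div (lam := lam) hh
  nlinarith [one_sub_exp_le (lam := lam) (h := h)]

variable {χ lam h b b₀ r r₀ M : ℝ}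

lemma mul_add_le_tiltDen (hχ : 0 < χ) (hχ1 : χ ≤ 1) (hlam : 0 ≤ lam) (hh : 0 < h) (hb : 0 ≤ b)
    (hr : χ * h ≤ r) : χ * (r + b) ≤ tiltDen lam h b r := by
  unfold tiltDen
  set e := Real.exp (-(lam * h))
  have he : e ≤ 1 := Real.exp_le_one_iff.2 (by nlinarith)
  have he0 : 0 < e := Real.exp_pos _
  have h1 : χ * (1 - e) ≤ (1 - e) / h * r := by
    rw [div_mul_eq_mul_div, le_div_iff₀ hh]
    nlinarith
  have h2 : b * (χ * (1 - e)) ≤ b * ((1 - e) / h) * r := by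
    rw [mul_assoc]; exact mul_le_mul_of_nonneg_left h1 hb
  have hr0 : 0 ≤ r := (by positivity : 0 ≤ χ * h).trans hr
  have h3 : b * (χ * e) ≤ b * e := mul_le_mul_of_nonneg_left (by nlinarith) hb
  nlinarith

lemma tiltDen_mono (hlam : 0 ≤ lam) (hh : 0 < h) (hb : 0 ≤ b) (hr : r ≤ r₀) :
    tiltDen lam h b r ≤ tiltDen lam h b r₀ := by
  unfold tiltDen
  have he : Real.exp (-(lam * h)) ≤ 1 := Real.exp_le_one_iff.2 (by nlinarith)
  have : 0 ≤ b * ((1 - Real.exp (-(lam * h))) / h) :=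
    mul_nonneg hb (div_nonneg (by linarith) hh.le)
  gcongr

lemma mul_exp_le_tiltDen (hh : 0 < h) (hb : 0 ≤ b) (hr : 0 ≤ r) :
    b * lam * Real.exp (-(lam * h)) * r ≤ tiltDen lam h b r := by
  unfold tiltDen
  have h1 := le_one_sub_exp_div (lam := lam) hh
  have h2 : b * (lam * Real.exp (-(lam * h))) * r ≤
      b * ((1 - Real.exp (-(lam * h))) / h) * r := by gcongr
  have h3 : 0 ≤ b * Real.exp (-(lam * h)) := mul_nonneg hb (Real.exp_pos _).le
  nlinarith

lemma abs_inv_tiltDen_sub_inv_le (hχ : 0 < χ) (hχ1 : χ ≤ 1) (hlam : 0 ≤ lam) (hh : 0 < h)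
    (hM : Real.exp (lam * h) ≤ M) (hb₀ : χ ≤ b₀) (hb : b₀ ≤ b) (hr₀ : 0 ≤ r₀) (hr : r₀ ≤ r)
    (hrh : χ * h ≤ r) :
    |(tiltDen lam h b r)⁻¹ - (r₀ + b₀ + lam * b₀ * r₀)⁻¹| ≤
      (1 / χ ^ 3 + lam / χ ^ 2 + lam * M / χ) * (h + (b - b₀) + (r - r₀)) := by
  have hb0 : 0 < b := hχ.trans_le (hb₀.trans hb)
  have hr0 : 0 ≤ r := hr₀.trans hr
  have hDχ := mul_add_le_tiltDen (b := b) hχ hχ1 hlam hh hb0.le hrh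
  have hDlam := mul_exp_le_tiltDen (lam := lam) hh hb0.le hr0
  set D := tiltDen lam h b r with hD
  set D₀ := r₀ + b₀ + lam * b₀ * r₀ with hD₀
  set e := Real.exp (-(lam * h)) with he
  set g := (1 - e) / h with hg
  have he1 : e ≤ 1 := Real.exp_le_one_iff.2 (by nlinarith)
  have he2 : 1 - e ≤ lam * h := one_sub_exp_le
  have hg1 : g ≤ lam := one_sub_exp_div_le hh
  have hg2 : lam - g ≤ lam ^ 2 * h := sub_one_sub_exp_div_le hlam hh
  have hg0 : 0 ≤ g := div_nonneg (by linarith) hh.le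
  have hb₀0 : 0 < b₀ := hχ.trans_le hb₀
  have hlb : 0 ≤ lam * b₀ * r₀ := by positivity
  have hD₀b : b₀ ≤ D₀ := by linarith
  have hD₀χ : χ ≤ D₀ := hb₀.trans hD₀b
  have hDb : χ * b ≤ D := by nlinarith
  have hDχ2 : χ ^ 2 ≤ D := by nlinarith
  have hDr : r ≤ D := by
    have : 0 ≤ b * e := mul_nonneg hb0.le (Real.exp_pos _).le
    have : 0 ≤ b * g * r := by positivity
    rw [hD, tiltDen]; linarith
  have hD0 : 0 < D := (by positivity : 0 < χ ^ 2).trans_le hDχ2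
  have hD₀0 : 0 < D₀ := hχ.trans_le hD₀χ
  have hDM : b * lam * r ≤ M * D := by
    have h1 : e * Real.exp (lam * h) = 1 := by rw [he, ← Real.exp_add]; simp
    calc b * lam * r = (b * lam * e * r) * Real.exp (lam * h) := by
          linear_combination (-(b * lam * r)) * h1
      _ ≤ D * M := mul_le_mul hDlam hM (Real.exp_pos _).le hD0.le
      _ = _ := mul_comm _ _
  have hdiff : |D₀ - D| ≤ (r - r₀) + (b - b₀) + b * lam * h + b * r * lam * (lam * h)
      + lam * r * (b - b₀) + lam * b₀ * (r - r₀) := by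
    have hexp : D - D₀ = (r - r₀) + (b - b₀) - b * (1 - e) - b * r * (lam - g)
        + lam * r * (b - b₀) + lam * b₀ * (r - r₀) := by
      rw [hD, hD₀, tiltDen]; ring
    have e1 : b * (1 - e) ≤ b * (lam * h) := by gcongr
    have e2 : b * r * (lam - g) ≤ b * r * (lam ^ 2 * h) := by gcongr
    have e3 : 0 ≤ b * (1 - e) := mul_nonneg hb0.le (by linarith)
    have e4 : 0 ≤ b * r * (lam - g) := mul_nonneg (by positivity) (by linarith)
    have e5 : 0 ≤ lam * r * (b - b₀) := mul_nonneg (by positivity) (by linarith)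
    have e6 : 0 ≤ lam * b₀ * (r - r₀) :=
      mul_nonneg (mul_nonneg hlam (hχ.le.trans hb₀)) (by linarith)
    rw [abs_le]
    constructor <;> nlinarith
  rw [inv_sub_inv hD0.ne' hD₀0.ne', abs_div, abs_of_pos (mul_pos hD0 hD₀0),
    div_le_iff₀ (mul_pos hD0 hD₀0)]
  refine hdiff.trans ?_
  have hM0 : 0 ≤ M := (Real.exp_pos _).le.trans hM
  have t1 : 1 ≤ 1 / χ ^ 3 * (D * D₀) := by
    rw [div_mul_eq_mul_div, one_mul, le_div_iff₀ (by positivity), one_mul]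
    calc χ ^ 3 = χ ^ 2 * χ := by ring
      _ ≤ D * D₀ := mul_le_mul hDχ2 hD₀χ hχ.le hD0.le
  have t2 : b * lam ≤ lam / χ ^ 2 * (D * D₀) := by
    rw [div_mul_eq_mul_div, le_div_iff₀ (by positivity)]
    calc b * lam * χ ^ 2 = lam * ((χ * b) * χ) := by ring
      _ ≤ lam * (D * D₀) := by gcongr
  have t3 : b * r * lam * lam ≤ lam * M / χ * (D * D₀) := by
    rw [div_mul_eq_mul_div, le_div_iff₀ (by positivity)]
    calc b * r * lam * lam * χ = lam * ((b * lam * r) * χ) := by ring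
      _ ≤ lam * ((M * D) * D₀) := by gcongr
      _ = _ := by ring
  have t4 : lam * r ≤ lam / χ ^ 2 * (D * D₀) := by
    rw [div_mul_eq_mul_div, le_div_iff₀ (by positivity)]
    calc lam * r * χ ^ 2 ≤ lam * r * χ := by gcongr; nlinarith
      _ = lam * (r * χ) := by ring
      _ ≤ lam * (D * D₀) := by gcongr
  have t5 : lam * b₀ ≤ lam / χ ^ 2 * (D * D₀) := by
    rw [div_mul_eq_mul_div, le_div_iff₀ (by positivity)]
    calc lam * b₀ * χ ^ 2 = lam * (χ ^ 2 * b₀) := by ring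
      _ ≤ lam * (D * D₀) := by gcongr
  have hP : 0 < D * D₀ := mul_pos hD0 hD₀0
  have p1 : 0 ≤ lam * M / χ * (D * D₀) := by positivity
  have p2 : 0 ≤ lam / χ ^ 2 * (D * D₀) := by positivity
  have p3 : 0 ≤ 1 / χ ^ 3 * (D * D₀) := by positivity
  have a1 : 0 ≤ b - b₀ := sub_nonneg.2 hb
  have a2 : 0 ≤ r - r₀ := sub_nonneg.2 hr
  calc _ = h * (b * lam + b * r * lam * lam) + (b - b₀) * (1 + lam * r)
        + (r - r₀) * (1 + lam * b₀) := by ring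
    _ ≤ h * ((1 / χ ^ 3 + lam / χ ^ 2 + lam * M / χ) * (D * D₀))
        + (b - b₀) * ((1 / χ ^ 3 + lam / χ ^ 2 + lam * M / χ) * (D * D₀))
        + (r - r₀) * ((1 / χ ^ 3 + lam / χ ^ 2 + lam * M / χ) * (D * D₀)) := by
        gcongr <;> linarith
    _ = _ := by ring

lemma abs_inv_tiltDen_sub_inv_add_le (hχ : 0 < χ) (hχ1 : χ ≤ 1) (hlam : 0 ≤ lam) (hh : 0 < h)
    (hM : h ≤ M) (hb : χ ≤ b) (hrh : χ * h ≤ r) :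
    |(tiltDen lam h b r)⁻¹ - (r + b)⁻¹| ≤ lam * (M / χ ^ 2 + 1 / χ) := by
  have hb0 : 0 < b := hχ.trans_le hb
  have hr0 : 0 ≤ r := (by positivity : 0 ≤ χ * h).trans hrh
  have hDχ := mul_add_le_tiltDen (b := b) hχ hχ1 hlam hh hb0.le hrh
  set D := tiltDen lam h b r with hD
  set e := Real.exp (-(lam * h)) with he
  set g := (1 - e) / h with hg
  have he1 : e ≤ 1 := Real.exp_le_one_iff.2 (by nlinarith)
  have he2 : 1 - e ≤ lam * h := one_sub_exp_le
  have hg1 : g ≤ lam := one_sub_exp_div_le hh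
  have hg0 : 0 ≤ g := div_nonneg (by linarith) hh.le
  have hD0 : 0 < D := (by positivity : 0 < χ * (r + b)).trans_le hDχ
  have hD₀0 : 0 < r + b := by positivity
  rw [inv_sub_inv hD0.ne' hD₀0.ne', abs_div, abs_of_pos (mul_pos hD0 hD₀0),
    div_le_iff₀ (mul_pos hD0 hD₀0)]
  have hdiff : |r + b - D| ≤ lam * b * M + lam * b * r := by
    have hexp : r + b - D = b * (1 - e) - b * r * g := by rw [hD, tiltDen]; ring
    have e1 : b * (1 - e) ≤ b * (lam * M) := by
      gcongr
      exact he2.trans (by gcongr)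
    have e2 : b * r * g ≤ b * r * lam := by gcongr
    have e3 : 0 ≤ b * (1 - e) := mul_nonneg hb0.le (by linarith)
    have e4 : 0 ≤ b * r * g := by positivity
    rw [hexp, abs_le]
    constructor <;> nlinarith
  refine hdiff.trans ?_
  have hbD : b ≤ D / χ := by rw [le_div_iff₀ hχ]; nlinarith
  have hM0 : 0 ≤ M := hh.le.trans hM
  calc lam * b * M + lam * b * r ≤ lam * (D / χ) * (M * ((r + b) / χ)) +
        lam * (D / χ) * (r + b) := by
        have : 1 ≤ (r + b) / χ := by rw [le_div_iff₀ hχ]; linarith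
        gcongr
        · exact le_mul_of_one_le_right hM0 this
        · linarith
    _ = _ := by field_simp

lemma abs_mul_inv_sub_le {e w D D' D₀ D₀' δ δ' : ℝ} (hχ : 0 < χ) (he : e ≤ 1) (hw : 0 ≤ w)
    (hD : χ ^ 2 ≤ D) (hD' : χ ^ 2 ≤ D') (hD₀ : χ ≤ D₀) (hδ : |D⁻¹ - D₀⁻¹| ≤ δ)
    (hδ' : |D'⁻¹ - D₀'⁻¹| ≤ δ') :
    |e * w / (D * D') - w / (D₀ * D₀')| ≤
      w * ((1 - e) / χ ^ 4 + δ / χ ^ 2 + δ' / χ) := by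
  have hDi : D⁻¹ ≤ (χ ^ 2)⁻¹ := inv_anti₀ (by positivity) hD
  have hDi' : D'⁻¹ ≤ (χ ^ 2)⁻¹ := inv_anti₀ (by positivity) hD'
  have hD₀i : D₀⁻¹ ≤ χ⁻¹ := inv_anti₀ hχ hD₀
  have h0 : 0 < D := (by positivity : 0 < χ ^ 2).trans_le hD
  have h0' : 0 < D' := (by positivity : 0 < χ ^ 2).trans_le hD'
  have h00 : 0 < D₀ := hχ.trans_le hD₀
  have hsplit : e * w / (D * D') - w / (D₀ * D₀') =
      w * (-((1 - e) * (D⁻¹ * D'⁻¹)) + (D⁻¹ - D₀⁻¹) * D'⁻¹ + (D'⁻¹ - D₀'⁻¹) * D₀⁻¹) := by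
    rw [div_eq_mul_inv, div_eq_mul_inv, mul_inv, mul_inv]; ring
  rw [hsplit, abs_mul, abs_of_nonneg hw]
  refine mul_le_mul_of_nonneg_left ?_ hw
  refine (abs_add_three _ _ _).trans ?_
  have hχ2 : 0 ≤ (χ ^ 2)⁻¹ := by positivity
  simp only [abs_neg, abs_mul]
  rw [abs_of_nonneg (sub_nonneg.2 he), abs_of_pos (inv_pos.2 h0), abs_of_pos (inv_pos.2 h0'),
    abs_of_pos (inv_pos.2 h00)]
  have t1 : (1 - e) * (D⁻¹ * D'⁻¹) ≤ (1 - e) * ((χ ^ 2)⁻¹ * (χ ^ 2)⁻¹) := by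
    have := (inv_pos.2 h0').le
    gcongr
  have t2 : |D⁻¹ - D₀⁻¹| * D'⁻¹ ≤ δ * (χ ^ 2)⁻¹ :=
    mul_le_mul hδ hDi' (inv_pos.2 h0').le ((abs_nonneg _).trans hδ)
  have t3 : |D'⁻¹ - D₀'⁻¹| * D₀⁻¹ ≤ δ' * χ⁻¹ :=
    mul_le_mul hδ' hD₀i (inv_pos.2 h00).le ((abs_nonneg _).trans hδ')
  have : (χ ^ 2)⁻¹ * (χ ^ 2)⁻¹ = (χ ^ 4)⁻¹ := by rw [← mul_inv]; ring_nf
  rw [this] at t1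
  simp only [div_eq_mul_inv]
  linarith

end Denominators

section Weights

/-- The environments satisfying the ellipticity bounds at every generation. -/
def goodSet (χ : ℝ) : Set (ℕ → ℝ × ℝ) :=
  {ω | ∀ i, χ ≤ (ω i).2 ∧ χ ≤ Real.exp (-(ω i).1) + (ω i).2 - 1 ∧
    Real.exp (-(ω i).1) + (ω i).2 ≤ χ⁻¹}

/-- The partial sums `∑ η_{l+1} exp (-S_l)` over `i ≤ l < j`. -/
def potential (i j : ℕ) (ω : ℕ → ℝ × ℝ) : ℝ :=
  ∑ l ∈ Finset.Ico i j, (ω l).2 * Real.exp (-pathSum l ω)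

/-- The increment of the reciprocal survival probability at generation `n`. -/
def lastIncr (n : ℕ) (ω : ℕ → ℝ × ℝ) : ℝ :=
  (Real.exp (-(ω n).1) + (ω n).2 - 1) * Real.exp (-pathSum n ω)

/-- The quenched value of `E[exp (-lam * Y_k); T = n + 1]`. -/
def tiltWeight (lam : ℝ) (k n : ℕ) (ω : ℕ → ℝ × ℝ) : ℝ :=
  Real.exp (-(lam * Real.exp (-pathSum k ω))) * lastIncr n ω /
    (tiltDen lam (Real.exp (-pathSum k ω)) (potential 0 k ω)
        (Real.exp (-pathSum n ω) + potential k n ω) *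
      tiltDen lam (Real.exp (-pathSum k ω)) (potential 0 k ω)
        (Real.exp (-pathSum n ω) + potential k n ω + lastIncr n ω))

/-- The approximation of `tiltWeight` which ignores all but the first and last `J` generations. -/
def blockWeight (lam : ℝ) (J n : ℕ) (ω : ℕ → ℝ × ℝ) : ℝ :=
  lastIncr n ω /
    ((Real.exp (-pathSum n ω) + potential (n - J) n ω + potential 0 J ω +
        lam * potential 0 J ω * (Real.exp (-pathSum n ω) + potential (n - J) n ω)) *
      (Real.exp (-pathSum n ω) + potential (n - J) n ω + lastIncr n ω + potential 0 J ω +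
        lam * potential 0 J ω *
          (Real.exp (-pathSum n ω) + potential (n - J) n ω + lastIncr n ω)))

@[fun_prop] lemma measurable_potential (i j : ℕ) : Measurable (potential i j) := by
  unfold potential; fun_prop

@[fun_prop] lemma measurable_lastIncr (n : ℕ) : Measurable (lastIncr n) := by
  unfold lastIncr; fun_prop

lemma measurable_tiltWeight (lam : ℝ) (k n : ℕ) : Measurable (tiltWeight lam k n) := by
  unfold tiltWeight tiltDen; fun_prop

lemma measurable_blockWeight (lam : ℝ) (J n : ℕ) : Measurable (blockWeight lam J n) := by
  unfold blockWeight; fun_prop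

variable {χ : ℝ} {ω : ℕ → ℝ × ℝ}

lemma potential_add {i j k : ℕ} (hij : i ≤ j) (hjk : j ≤ k) (ω : ℕ → ℝ × ℝ) :
    potential i j ω + potential j k ω = potential i k ω :=
  Finset.sum_Ico_consecutive _ hij hjk

lemma potential_nonneg (hχ : 0 < χ) (hω : ω ∈ goodSet χ) (i j : ℕ) : 0 ≤ potential i j ω :=
  Finset.sum_nonneg fun l _ => mul_nonneg (hχ.le.trans (hω l).1) (Real.exp_pos _).le

lemma le_potential (hχ : 0 < χ) (hω : ω ∈ goodSet χ) {i j l : ℕ} (hil : i ≤ l) (hlj : l < j) :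
    χ * Real.exp (-pathSum l ω) ≤ potential i j ω :=
  (mul_le_mul_of_nonneg_right (hω l).1 (Real.exp_pos _).le).trans
    (Finset.single_le_sum (f := fun l => (ω l).2 * Real.exp (-pathSum l ω))
      (fun l _ => mul_nonneg (hχ.le.trans (hω l).1) (Real.exp_pos _).le)
      (Finset.mem_Ico.2 ⟨hil, hlj⟩))

lemma potential_le (hω : ω ∈ goodSet χ) (i j : ℕ) :
    potential i j ω ≤ χ⁻¹ * ∑ l ∈ Finset.Ico i j, Real.exp (-pathSum l ω) := by
  rw [Finset.mul_sum]
  exact Finset.sum_le_sum fun l _ => mul_le_mul_of_nonneg_right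
    (by linarith [(hω l).2.2, Real.exp_pos (-(ω l).1)]) (Real.exp_pos _).le

lemma exp_neg_pathSum_le_pow (hχ : 0 < χ) (hω : ω ∈ goodSet χ) (n : ℕ) :
    Real.exp (-pathSum n ω) ≤ χ⁻¹ ^ n := by
  induction n with
  | zero => simp
  | succ n ih =>
    rw [pathSum_succ, neg_add, Real.exp_add, pow_succ]
    exact mul_le_mul ih (by linarith [(hω n).1, (hω n).2.2]) (Real.exp_pos _).le (by positivity)

lemma le_lastIncr (hω : ω ∈ goodSet χ) (n : ℕ) :
    χ * Real.exp (-pathSum n ω) ≤ lastIncr n ω :=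
  mul_le_mul_of_nonneg_right (hω n).2.1 (Real.exp_pos _).le

lemma lastIncr_pos (hχ : 0 < χ) (hω : ω ∈ goodSet χ) (n : ℕ) : 0 < lastIncr n ω :=
  (by positivity : 0 < χ * Real.exp (-pathSum n ω)).trans_le (le_lastIncr hω n)

lemma lastIncr_le (hω : ω ∈ goodSet χ) (n : ℕ) :
    lastIncr n ω ≤ χ⁻¹ * Real.exp (-pathSum n ω) :=
  mul_le_mul_of_nonneg_right (by linarith [(hω n).2.2]) (Real.exp_pos _).le

lemma le_potential_zero (hχ : 0 < χ) (hω : ω ∈ goodSet χ) {k : ℕ} (hk : 0 < k) :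
    χ ≤ potential 0 k ω := by
  simpa using le_potential hχ hω le_rfl hk

lemma mul_exp_le_add_potential (hχ : 0 < χ) (hχ1 : χ ≤ 1) (hω : ω ∈ goodSet χ) {i j n : ℕ}
    (hji : j ≤ i) (hin : i ≤ n) :
    χ * Real.exp (-pathSum i ω) ≤ Real.exp (-pathSum n ω) + potential j n ω := by
  rcases hin.eq_or_lt with rfl | h
  · nlinarith [potential_nonneg hχ hω j i, Real.exp_pos (-pathSum i ω)]
  · linarith [le_potential hχ hω hji h, Real.exp_pos (-pathSum n ω)]

lemma sq_mul_exp_le_tiltDen (hχ : 0 < χ) (hχ1 : χ ≤ 1) (hω : ω ∈ goodSet χ) {lam : ℝ}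
    (hlam : 0 ≤ lam) {i k n : ℕ} (hkn : k ≤ n) (hi : i ≤ n) :
    χ ^ 2 * Real.exp (-pathSum i ω) ≤ tiltDen lam (Real.exp (-pathSum k ω)) (potential 0 k ω)
      (Real.exp (-pathSum n ω) + potential k n ω) := by
  have h1 := mul_add_le_tiltDen (b := potential 0 k ω) hχ hχ1 hlam (Real.exp_pos (-pathSum k ω))
    (potential_nonneg hχ hω 0 k) (mul_exp_le_add_potential hχ hχ1 hω le_rfl hkn)
  have h2 := mul_exp_le_add_potential hχ hχ1 hω (zero_le : 0 ≤ i) hi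
  rw [← potential_add (zero_le : 0 ≤ k) hkn] at h2
  calc _ = χ * (χ * Real.exp (-pathSum i ω)) := by ring
    _ ≤ _ := (mul_le_mul_of_nonneg_left (by linarith) hχ.le).trans h1

lemma tiltDen_le_tiltDen_add (hχ : 0 < χ) (hω : ω ∈ goodSet χ) {lam : ℝ}
    (hlam : 0 ≤ lam) (k n : ℕ) :
    tiltDen lam (Real.exp (-pathSum k ω)) (potential 0 k ω)
      (Real.exp (-pathSum n ω) + potential k n ω) ≤
    tiltDen lam (Real.exp (-pathSum k ω)) (potential 0 k ω)
      (Real.exp (-pathSum n ω) + potential k n ω + lastIncr n ω) :=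
  tiltDen_mono hlam (Real.exp_pos _) (potential_nonneg hχ hω 0 k)
    (by linarith [lastIncr_pos hχ hω n])

lemma exp_neg_mul_exp_le_one {lam : ℝ} (hlam : 0 ≤ lam) (x : ℝ) :
    Real.exp (-(lam * Real.exp x)) ≤ 1 :=
  Real.exp_le_one_iff.2 (neg_nonpos.2 (by positivity))

lemma tiltWeight_nonneg (hχ : 0 < χ) (hχ1 : χ ≤ 1) (hω : ω ∈ goodSet χ) {lam : ℝ}
    (hlam : 0 ≤ lam) {k n : ℕ} (hkn : k ≤ n) : 0 ≤ tiltWeight lam k n ω := by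
  have h1 := sq_mul_exp_le_tiltDen hχ hχ1 hω hlam hkn (zero_le : 0 ≤ n)
  have h2 := tiltDen_le_tiltDen_add hχ hω hlam k n
  have h3 : 0 ≤ χ ^ 2 * Real.exp (-pathSum 0 ω) := by positivity
  have := (lastIncr_pos hχ hω n).le
  exact div_nonneg (mul_nonneg (Real.exp_pos _).le this)
    (mul_nonneg (h3.trans h1) ((h3.trans h1).trans h2))

lemma tiltWeight_le (hχ : 0 < χ) (hχ1 : χ ≤ 1) (hω : ω ∈ goodSet χ) {lam : ℝ}
    (hlam : 0 ≤ lam) {i k n : ℕ} (hkn : k ≤ n) (hi : i ≤ n) :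
    tiltWeight lam k n ω ≤
      χ⁻¹ ^ 5 * (Real.exp (-pathSum n ω) * Real.exp (2 * pathSum i ω)) := by
  have h1 := sq_mul_exp_le_tiltDen hχ hχ1 hω hlam hkn hi
  have h2 := h1.trans (tiltDen_le_tiltDen_add hχ hω hlam k n)
  have hE := exp_neg_mul_exp_le_one hlam (-pathSum k ω)
  have hw := lastIncr_pos hχ hω n
  have hw' := lastIncr_le hω n
  unfold tiltWeight
  have h0 : 0 < χ ^ 2 * Real.exp (-pathSum i ω) := by positivity
  have hD := h0.le.trans h1
  calc _ ≤ 1 * (χ⁻¹ * Real.exp (-pathSum n ω)) /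
        ((χ ^ 2 * Real.exp (-pathSum i ω)) * (χ ^ 2 * Real.exp (-pathSum i ω))) := by
        gcongr
    _ = χ⁻¹ ^ 5 * Real.exp (-pathSum n ω) *
        (Real.exp (-pathSum i ω) * Real.exp (-pathSum i ω))⁻¹ := by field_simp
    _ = _ := by
        rw [← Real.exp_add, ← Real.exp_neg, mul_assoc]
        ring_nf

lemma tiltWeight_le_sqrt (hχ : 0 < χ) (hχ1 : χ ≤ 1) (hω : ω ∈ goodSet χ) {lam : ℝ}
    (hlam : 0 < lam) {k n : ℕ} (hk : 0 < k) (hkn : k ≤ n) :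
    tiltWeight lam k n ω ≤ √(χ⁻¹ ^ 9 / lam) * Real.exp (-(1 / 2) * pathSum n ω) := by
  have h1 := sq_mul_exp_le_tiltDen hχ hχ1 hω hlam.le hkn (zero_le : 0 ≤ n)
  have h2 := h1.trans (tiltDen_le_tiltDen_add hχ hω hlam.le k n)
  have h3 := mul_exp_le_tiltDen (lam := lam) (Real.exp_pos (-pathSum k ω))
    (potential_nonneg hχ hω 0 k) (r := Real.exp (-pathSum n ω) + potential k n ω)
    (add_nonneg (Real.exp_pos _).le (potential_nonneg hχ hω k n))
  have hE := exp_neg_mul_exp_le_one hlam.le (-pathSum k ω)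
  have hw := lastIncr_pos hχ hω n
  have hw' := lastIncr_le hω n
  have hb := le_potential_zero hχ hω hk
  have hφ := tiltWeight_nonneg hχ hχ1 hω hlam.le hkn
  simp only [pathSum_zero, neg_zero, Real.exp_zero, mul_one] at h1 h2
  refine (pow_le_pow_iff_left₀ hφ (by positivity) two_ne_zero).1 ?_
  rw [mul_pow, Real.sq_sqrt (by positivity), ← Real.exp_nat_mul]
  unfold tiltWeight
  set D := tiltDen lam (Real.exp (-pathSum k ω)) (potential 0 k ω)
    (Real.exp (-pathSum n ω) + potential k n ω) with hD
  set D' := tiltDen lam (Real.exp (-pathSum k ω)) (potential 0 k ω)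
    (Real.exp (-pathSum n ω) + potential k n ω + lastIncr n ω) with hD'
  set e := Real.exp (-(lam * Real.exp (-pathSum k ω))) with he
  have he0 : 0 < e := Real.exp_pos _
  have h4 : χ * lam * e * Real.exp (-pathSum n ω) ≤ D := by
    have hb0 : 0 < potential 0 k ω := hχ.trans_le hb
    refine le_trans ?_ h3
    gcongr
    linarith [potential_nonneg hχ hω k n]
  have h5 : 0 < Real.exp (-pathSum n ω) := Real.exp_pos _
  calc (e * lastIncr n ω / (D * D')) ^ 2
      = e ^ 2 * lastIncr n ω ^ 2 / ((D * D) * D' ^ 2) := by rw [div_pow]; ring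
    _ ≤ e ^ 2 * (χ⁻¹ * Real.exp (-pathSum n ω)) ^ 2 /
        ((χ ^ 2 * (χ * lam * e * Real.exp (-pathSum n ω))) * (χ ^ 2) ^ 2) := by
        have : 0 ≤ D := (by positivity : 0 ≤ χ ^ 2).trans h1
        gcongr
    _ = e * (χ⁻¹ ^ 9 / lam * Real.exp (-pathSum n ω)) := by field_simp
    _ ≤ 1 * (χ⁻¹ ^ 9 / lam * Real.exp (-pathSum n ω)) := by gcongr
    _ = _ := by rw [one_mul]; congr 2; push_cast; ring

lemma abs_tiltWeight_sub_blockWeight_le (hχ : 0 < χ) (hχ1 : χ ≤ 1) {lam : ℝ} (hlam : 0 ≤ lam)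
    (K : ℝ) : ∃ C, 0 ≤ C ∧ ∀ J k n : ℕ, 0 < J → J ≤ k → k < n - J → ∀ ω ∈ goodSet χ,
      ω ∈ aboveSet n K → |tiltWeight lam k n ω - blockWeight lam J n ω| ≤
        C * ∑ i ∈ Finset.Ico J (n - J), Real.exp (-pathSum i ω) * Real.exp (-pathSum n ω) := by
  set C₁ := 1 / χ ^ 3 + lam / χ ^ 2 + lam * Real.exp (lam * Real.exp K) / χ with hC₁
  have hC₁0 : 0 ≤ C₁ := by positivity
  refine ⟨χ⁻¹ * (lam / χ ^ 4 + C₁ * (1 + χ⁻¹) / χ ^ 2 + C₁ * (1 + χ⁻¹) / χ), by positivity,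
    fun J k n hJ hJk hkn ω hω hωK => ?_⟩
  have hh : Real.exp (-pathSum k ω) ≤ Real.exp K := exp_neg_pathSum_le (by omega) hωK
  have hM : Real.exp (lam * Real.exp (-pathSum k ω)) ≤ Real.exp (lam * Real.exp K) := by gcongr
  have hw := lastIncr_pos hχ hω n
  have hw' := lastIncr_le hω n
  have hE : 0 < Real.exp (-pathSum n ω) := Real.exp_pos _
  have hb₀ := le_potential_zero hχ hω hJ
  have hbb := potential_add (zero_le : 0 ≤ J) hJk ω
  have hrr := potential_add hkn.le (Nat.sub_le n J) ω
  have hP1 := potential_nonneg hχ hω J k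
  have hP2 := potential_nonneg hχ hω k (n - J)
  have hP3 := potential_nonneg hχ hω (n - J) n
  have hrh := mul_exp_le_add_potential hχ hχ1 hω (le_refl k) (by omega : k ≤ n)
  have hδ := abs_inv_tiltDen_sub_inv_le hχ hχ1 hlam (Real.exp_pos (-pathSum k ω)) hM hb₀
    (by linarith : potential 0 J ω ≤ potential 0 k ω)
    (by linarith : 0 ≤ Real.exp (-pathSum n ω) + potential (n - J) n ω)
    (by linarith : _ ≤ Real.exp (-pathSum n ω) + potential k n ω) hrh
  have hδ' := abs_inv_tiltDen_sub_inv_le hχ hχ1 hlam (Real.exp_pos (-pathSum k ω)) hM hb₀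
    (by linarith : potential 0 J ω ≤ potential 0 k ω)
    (by linarith : 0 ≤ Real.exp (-pathSum n ω) + potential (n - J) n ω + lastIncr n ω)
    (by linarith : _ ≤ Real.exp (-pathSum n ω) + potential k n ω + lastIncr n ω)
    (by linarith)
  set Δ := ∑ i ∈ Finset.Ico J (n - J), Real.exp (-pathSum i ω) with hΔ
  have hhΔ : Real.exp (-pathSum k ω) ≤ Δ :=
    Finset.single_le_sum (f := fun i => Real.exp (-pathSum i ω))
      (fun i _ => (Real.exp_pos _).le) (Finset.mem_Ico.2 ⟨hJk, hkn⟩)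
  have hPΔ : potential J k ω + potential k (n - J) ω ≤ χ⁻¹ * Δ := by
    rw [potential_add hJk hkn.le]
    exact potential_le hω J (n - J)
  have hsum : Real.exp (-pathSum k ω) + (potential 0 k ω - potential 0 J ω) +
      (Real.exp (-pathSum n ω) + potential k n ω -
        (Real.exp (-pathSum n ω) + potential (n - J) n ω)) ≤ (1 + χ⁻¹) * Δ := by linarith
  have hsum' : Real.exp (-pathSum k ω) + (potential 0 k ω - potential 0 J ω) +
      (Real.exp (-pathSum n ω) + potential k n ω + lastIncr n ω -
        (Real.exp (-pathSum n ω) + potential (n - J) n ω + lastIncr n ω)) ≤ (1 + χ⁻¹) * Δ := by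
    linarith
  have hD := sq_mul_exp_le_tiltDen hχ hχ1 hω hlam (by omega : k ≤ n) (zero_le : 0 ≤ n)
  have hD' := hD.trans (tiltDen_le_tiltDen_add hχ hω hlam k n)
  simp only [pathSum_zero, neg_zero, Real.exp_zero, mul_one] at hD hD'
  have hD₀ : χ ≤ Real.exp (-pathSum n ω) + potential (n - J) n ω + potential 0 J ω +
      lam * potential 0 J ω * (Real.exp (-pathSum n ω) + potential (n - J) n ω) := by
    have : 0 ≤ lam * potential 0 J ω * (Real.exp (-pathSum n ω) + potential (n - J) n ω) :=
      mul_nonneg (mul_nonneg hlam (hχ.le.trans hb₀)) (by linarith)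
    linarith
  have hmain := abs_mul_inv_sub_le hχ (exp_neg_mul_exp_le_one hlam (-pathSum k ω)) hw.le hD hD'
    hD₀ (hδ.trans (mul_le_mul_of_nonneg_left hsum hC₁0))
    (hδ'.trans (mul_le_mul_of_nonneg_left hsum' hC₁0))
  refine hmain.trans ?_
  rw [← Finset.sum_mul]
  have hΔ0 : 0 ≤ Δ := (Real.exp_pos _).le.trans hhΔ
  calc _ ≤ (χ⁻¹ * Real.exp (-pathSum n ω)) * (lam * Δ / χ ^ 4 + C₁ * ((1 + χ⁻¹) * Δ) / χ ^ 2 +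
        C₁ * ((1 + χ⁻¹) * Δ) / χ) := by
        gcongr
        · have := one_sub_exp_le (lam := lam) (h := Real.exp (-pathSum k ω))
          have h2 := exp_neg_mul_exp_le_one hlam (-pathSum k ω)
          have : 0 ≤ (1 - Real.exp (-(lam * Real.exp (-pathSum k ω)))) / χ ^ 4 :=
            div_nonneg (by linarith) (by positivity)
          positivity
        · exact one_sub_exp_le.trans (by gcongr)
    _ = _ := by ring

lemma abs_tiltWeight_sub_tiltWeight_zero_le (hχ : 0 < χ) (hχ1 : χ ≤ 1) (K : ℝ) :
    ∃ C, 0 ≤ C ∧ ∀ lam, 0 ≤ lam → ∀ k n : ℕ, 0 < k → k ≤ n → ∀ ω ∈ goodSet χ,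
      ω ∈ aboveSet n K → |tiltWeight lam k n ω - tiltWeight 0 k n ω| ≤
        lam * C * Real.exp (-pathSum n ω) := by
  set C₁ := Real.exp K / χ ^ 2 + 1 / χ with hC₁
  have hC₁0 : 0 ≤ C₁ := by positivity
  refine ⟨χ⁻¹ * (Real.exp K / χ ^ 4 + C₁ / χ ^ 2 + C₁ / χ), by positivity,
    fun lam hlam k n hk hkn ω hω hωK => ?_⟩
  have hh : Real.exp (-pathSum k ω) ≤ Real.exp K := exp_neg_pathSum_le hkn hωK
  have hw := lastIncr_pos hχ hω n
  have hw' := lastIncr_le hω n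
  have hE : 0 < Real.exp (-pathSum n ω) := Real.exp_pos _
  have hb := le_potential_zero hχ hω hk
  have hP := potential_nonneg hχ hω k n
  have hrh := mul_exp_le_add_potential hχ hχ1 hω (le_refl k) hkn
  have hδ := abs_inv_tiltDen_sub_inv_add_le hχ hχ1 hlam (Real.exp_pos (-pathSum k ω)) hh hb hrh
  have hδ' := abs_inv_tiltDen_sub_inv_add_le hχ hχ1 hlam (Real.exp_pos (-pathSum k ω)) hh hb
    (hrh.trans (le_add_of_nonneg_right hw.le))
  have hD := sq_mul_exp_le_tiltDen hχ hχ1 hω hlam hkn (zero_le : 0 ≤ n)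
  have hD' := hD.trans (tiltDen_le_tiltDen_add hχ hω hlam k n)
  simp only [pathSum_zero, neg_zero, Real.exp_zero, mul_one] at hD hD'
  have hmain := abs_mul_inv_sub_le hχ (exp_neg_mul_exp_le_one hlam (-pathSum k ω)) hw.le hD hD'
    (by linarith) hδ hδ'
  have h0 : tiltWeight 0 k n ω = lastIncr n ω / ((Real.exp (-pathSum n ω) + potential k n ω +
      potential 0 k ω) * (Real.exp (-pathSum n ω) + potential k n ω + lastIncr n ω +
      potential 0 k ω)) := by
    simp [tiltWeight, tiltDen]
  rw [h0]
  refine hmain.trans ?_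
  calc _ ≤ (χ⁻¹ * Real.exp (-pathSum n ω)) * (lam * Real.exp K / χ ^ 4 + lam * C₁ / χ ^ 2 +
        lam * C₁ / χ) := by
        gcongr
        · have h2 := exp_neg_mul_exp_le_one hlam (-pathSum k ω)
          have : 0 ≤ (1 - Real.exp (-(lam * Real.exp (-pathSum k ω)))) / χ ^ 4 :=
            div_nonneg (by linarith) (by positivity)
          positivity
        · exact one_sub_exp_le.trans (by gcongr)
    _ = _ := by ring

lemma blockWeight_nonneg (hχ : 0 < χ) (hω : ω ∈ goodSet χ) {lam : ℝ} (hlam : 0 ≤ lam)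
    (J n : ℕ) : 0 ≤ blockWeight lam J n ω := by
  have h1 := (lastIncr_pos hχ hω n).le
  have h2 := potential_nonneg hχ hω (n - J) n
  have h3 := potential_nonneg hχ hω 0 J
  unfold blockWeight
  positivity

lemma blockWeight_le_div_sq (hχ : 0 < χ) (hω : ω ∈ goodSet χ) {lam : ℝ} (hlam : 0 ≤ lam)
    (J n : ℕ) {x : ℝ} (hx : 0 < x)
    (h : x ≤ Real.exp (-pathSum n ω) + potential (n - J) n ω + potential 0 J ω) :
    blockWeight lam J n ω ≤ χ⁻¹ * Real.exp (-pathSum n ω) / (x * x) := by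
  have h1 := (lastIncr_pos hχ hω n).le
  have h1' := lastIncr_le hω n
  have h2 := potential_nonneg hχ hω (n - J) n
  have h3 := potential_nonneg hχ hω 0 J
  have hE : 0 < Real.exp (-pathSum n ω) := Real.exp_pos _
  unfold blockWeight
  have h4 : 0 ≤ lam * potential 0 J ω * (Real.exp (-pathSum n ω) + potential (n - J) n ω) := by
    positivity
  have h5 : 0 ≤ lam * potential 0 J ω *
      (Real.exp (-pathSum n ω) + potential (n - J) n ω + lastIncr n ω) := by positivity
  gcongr <;> linarith

lemma blockWeight_le (hχ : 0 < χ) (hω : ω ∈ goodSet χ) {lam : ℝ} (hlam : 0 ≤ lam) {J : ℕ}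
    (hJ : 0 < J) (n : ℕ) : blockWeight lam J n ω ≤ χ⁻¹ ^ 3 * Real.exp (-pathSum n ω) := by
  have h2 := potential_nonneg hχ hω (n - J) n
  have h3 := le_potential_zero hχ hω hJ
  refine (blockWeight_le_div_sq hχ hω hlam J n hχ
    (by linarith [Real.exp_pos (-pathSum n ω)])).trans_eq ?_
  field_simp

lemma blockWeight_le_of_notMem (hχ : 0 < χ) (hχ1 : χ ≤ 1) (hω : ω ∈ goodSet χ) {lam : ℝ}
    (hlam : 0 ≤ lam) {J n : ℕ} {K : ℝ} (h1 : ω ∈ aboveSet (n - J) K) (h2 : ω ∉ aboveSet n K)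
    {i : ℕ} (hi : i ≤ n) :
    blockWeight lam J n ω ≤
      χ⁻¹ ^ 3 * (Real.exp (-pathSum n ω) * Real.exp (2 * pathSum i ω)) := by
  have hx : χ * Real.exp (-pathSum i ω) ≤
      Real.exp (-pathSum n ω) + potential (n - J) n ω := by
    rcases le_total (n - J) i with h | h
    · exact mul_exp_le_add_potential hχ hχ1 hω h hi
    · simp only [aboveSet, mem_ofPred_eq, not_forall, not_le] at h2
      obtain ⟨l, hl, hlK⟩ := h2
      have hJl : n - J ≤ l := by
        by_contra h'
        exact absurd (h1 l (by omega)) (not_le.2 hlK)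
      refine le_trans ?_ (mul_exp_le_add_potential hχ hχ1 hω hJl hl)
      have := h1 i h
      gcongr
      linarith
  have h3 := potential_nonneg hχ hω 0 J
  refine (blockWeight_le_div_sq hχ hω hlam J n (by positivity)
    (hx.trans (le_add_of_nonneg_right h3))).trans_eq ?_
  calc _ = χ⁻¹ ^ 3 * Real.exp (-pathSum n ω) *
        (Real.exp (-pathSum i ω) * Real.exp (-pathSum i ω))⁻¹ := by field_simp
    _ = _ := by
        rw [← Real.exp_add, ← Real.exp_neg, mul_assoc]
        ring_nf

lemma le_tiltWeight_zero (hχ : 0 < χ) (hχ1 : χ ≤ 1) (hω : ω ∈ goodSet χ) {k n : ℕ}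
    (hkn : k ≤ n) (hn : 0 < n) (hωn : ω ∈ aboveSet n 0) {M : ℝ} (hM : 0 < M) :
    χ ^ 3 / 9 / M ^ 2 * (Real.exp (-pathSum n ω) -
      (∑ i ∈ Finset.range n, Real.exp (-pathSum i ω) * Real.exp (-pathSum n ω)) / M) ≤
        tiltWeight 0 k n ω := by
  have hw := lastIncr_pos hχ hω n
  have hw1 := le_lastIncr hω n
  have hw' := lastIncr_le hω n
  have hE : 0 < Real.exp (-pathSum n ω) := Real.exp_pos _
  have hE1 : Real.exp (-pathSum n ω) ≤ 1 := by
    simpa using exp_neg_pathSum_le le_rfl hωn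
  have hP := potential_nonneg hχ hω 0 n
  have hadd := potential_add (zero_le : 0 ≤ k) hkn ω
  have hPle := potential_le hω 0 n
  rw [← Finset.range_eq_Ico] at hPle
  rw [← Finset.sum_mul]
  set s := ∑ i ∈ Finset.range n, Real.exp (-pathSum i ω) with hs
  have hs1 : 1 ≤ s := by
    have := Finset.single_le_sum (f := fun i => Real.exp (-pathSum i ω))
      (fun i _ => (Real.exp_pos _).le) (Finset.mem_range.2 hn)
    simpa using this
  have hi1 : 1 ≤ χ⁻¹ := (one_le_inv₀ hχ).2 hχ1
  have h0 : tiltWeight 0 k n ω = lastIncr n ω / ((Real.exp (-pathSum n ω) + potential 0 n ω) *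
      (Real.exp (-pathSum n ω) + potential 0 n ω + lastIncr n ω)) := by
    rw [← hadd]
    simp only [tiltWeight, tiltDen, zero_mul, neg_zero, Real.exp_zero, one_mul, sub_self, zero_div,
      mul_zero, add_zero, mul_one]
    congr 2 <;> ring
  rw [h0]
  have hb1 : Real.exp (-pathSum n ω) + potential 0 n ω + lastIncr n ω ≤ 3 * χ⁻¹ * s := by
    nlinarith
  have hb2 : Real.exp (-pathSum n ω) + potential 0 n ω ≤ 3 * χ⁻¹ * s := by linarith
  calc _ = χ ^ 3 / 9 * Real.exp (-pathSum n ω) * ((1 - s / M) / M ^ 2) := by ring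
    _ ≤ χ ^ 3 / 9 * Real.exp (-pathSum n ω) * (1 / s ^ 2) := by
        have hs0 : 0 < s := by linarith
        refine mul_le_mul_of_nonneg_left ?_ (by positivity)
        rw [div_le_div_iff₀ (by positivity) (by positivity), one_mul]
        rcases le_total s M with h | h
        · have : 0 ≤ s / M := by positivity
          have : s ^ 2 ≤ M ^ 2 := by gcongr
          nlinarith [sq_nonneg s]
        · have : 1 ≤ s / M := (one_le_div₀ hM).2 h
          nlinarith [sq_nonneg s, sq_nonneg M]
    _ = χ * Real.exp (-pathSum n ω) / ((3 * χ⁻¹ * s) * (3 * χ⁻¹ * s)) := by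
        field_simp; norm_num
    _ ≤ _ := by gcongr

end Weights

section Limits

lemma potential_concat_of_le {i j : ℕ} (h : j ≤ i) (a : ℕ) (ω ω' : ℕ → ℝ × ℝ) :
    potential a j (concat i ω ω') = potential a j ω :=
  Finset.sum_congr rfl fun l hl => by
    have := (Finset.mem_Ico.1 hl).2
    rw [concat_of_lt (by omega), pathSum_concat_of_le (by omega)]

lemma potential_concat_add (i j : ℕ) (ω ω' : ℕ → ℝ × ℝ) :
    potential i (i + j) (concat i ω ω') = Real.exp (-pathSum i ω) * potential 0 j ω' := by
  unfold potential
  rw [Finset.sum_Ico_eq_sum_range, Finset.mul_sum, add_tsub_cancel_left, ← Finset.range_eq_Ico]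
  refine Finset.sum_congr rfl fun l _ => ?_
  rw [concat_add, pathSum_concat_add, neg_add, Real.exp_add]
  ring

lemma lastIncr_concat_add (i j : ℕ) (ω ω' : ℕ → ℝ × ℝ) :
    lastIncr (i + j) (concat i ω ω') = Real.exp (-pathSum i ω) * lastIncr j ω' := by
  unfold lastIncr
  rw [concat_add, pathSum_concat_add, neg_add, Real.exp_add]
  ring

variable {ν : Measure (ℝ × ℝ)} [IsProbabilityMeasure ν] {σ χ : ℝ}

lemma le_fst_of_mem_goodSet (hχ : 0 < χ) {ω : ℕ → ℝ × ℝ} (hω : ω ∈ goodSet χ) (i : ℕ) :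
    Real.log χ ≤ (ω i).1 := by
  have h : Real.exp (-(ω i).1) ≤ χ⁻¹ := by linarith [(hω i).1, (hω i).2.2]
  rw [Real.exp_neg] at h
  exact (Real.log_le_iff_le_exp hχ).2 ((inv_le_inv₀ (Real.exp_pos _) hχ).1 h)

lemma integrable_blockWeight (hχ : 0 < χ) (hgood : ∀ᵐ ω ∂(pathLaw ν), ω ∈ goodSet χ) {lam : ℝ}
    (hlam : 0 ≤ lam) {J : ℕ} (hJ : 0 < J) (n : ℕ) :
    Integrable (blockWeight lam J n) (pathLaw ν) := by
  refine Integrable.of_bound (measurable_blockWeight lam J n).aestronglyMeasurable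
    (χ⁻¹ ^ 3 * χ⁻¹ ^ n) (hgood.mono fun ω hω => ?_)
  rw [Real.norm_of_nonneg (blockWeight_nonneg hχ hω hlam J n)]
  exact (blockWeight_le hχ hω hlam hJ n).trans
    (mul_le_mul_of_nonneg_left (exp_neg_pathSum_le_pow hχ hω n) (by positivity))

lemma integrable_tiltWeight (hχ : 0 < χ) (hχ1 : χ ≤ 1)
    (hgood : ∀ᵐ ω ∂(pathLaw ν), ω ∈ goodSet χ) {lam : ℝ} (hlam : 0 ≤ lam) {k n : ℕ} (hkn : k ≤ n) :
    Integrable (tiltWeight lam k n) (pathLaw ν) := by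
  refine Integrable.of_bound (measurable_tiltWeight lam k n).aestronglyMeasurable
    (χ⁻¹ ^ 5 * (χ⁻¹ ^ n * 1)) (hgood.mono fun ω hω => ?_)
  rw [Real.norm_of_nonneg (tiltWeight_nonneg hχ hχ1 hω hlam hkn)]
  refine (tiltWeight_le hχ hχ1 hω hlam hkn (zero_le : 0 ≤ n)).trans ?_
  simp only [pathSum_zero, mul_zero, Real.exp_zero]
  have := exp_neg_pathSum_le_pow hχ hω n
  gcongr

/-- Convergence of the block approximations. -/
lemma exists_tendsto_blockWeight (hF : IsCenteredStep (ν.map Prod.fst) σ) (hχ : 0 < χ)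
    (hgood : ∀ᵐ ω ∂(pathLaw ν), ω ∈ goodSet χ) {lam : ℝ} (hlam : 0 ≤ lam) {J : ℕ} (hJ : 0 < J)
    (K : ℝ) : ∃ L, Tendsto (fun n =>
      (∫ ω in aboveSet (n - J) K, blockWeight lam J n ω ∂(pathLaw ν)) / wt n) atTop (𝓝 L) := by
  set A : (ℕ → ℝ × ℝ) → ℝ := fun ω => Real.exp (-pathSum J ω) + potential 0 J ω with hA
  set Ψ : (ℕ → ℝ × ℝ) → (ℕ → ℝ × ℝ) → ℝ → ℝ := fun ω₁ ω₃ u =>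
    Real.exp K * lastIncr J ω₃ /
      ((Real.exp K * u * A ω₃ + potential 0 J ω₁ +
          lam * potential 0 J ω₁ * (Real.exp K * u * A ω₃)) *
        (Real.exp K * u * (A ω₃ + lastIncr J ω₃) + potential 0 J ω₁ +
          lam * potential 0 J ω₁ * (Real.exp K * u * (A ω₃ + lastIncr J ω₃)))) with hΨ
  have hden {ω₁ ω₃ : ℕ → ℝ × ℝ} (h₁ : ω₁ ∈ goodSet χ) {u x : ℝ} (hu : 0 ≤ u) (hx : 0 ≤ x) :
      χ ≤ Real.exp K * u * x + potential 0 J ω₁ + lam * potential 0 J ω₁ * (Real.exp K * u * x) := by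
    have h2 := le_potential_zero hχ h₁ hJ
    have h3 : 0 ≤ potential 0 J ω₁ := hχ.le.trans h2
    have : 0 ≤ Real.exp K * u * x + lam * potential 0 J ω₁ * (Real.exp K * u * x) := by positivity
    linarith
  have hA0 {ω : ℕ → ℝ × ℝ} (h : ω ∈ goodSet χ) : 0 ≤ A ω :=
    add_nonneg (Real.exp_pos _).le (potential_nonneg hχ h 0 J)
  have hAq {ω : ℕ → ℝ × ℝ} (h : ω ∈ goodSet χ) : 0 ≤ A ω + lastIncr J ω :=
    add_nonneg (hA0 h) (lastIncr_pos hχ h J).le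
  suffices h : ∃ L, Tendsto (fun m => (∫ ω in aboveSet (J + m) K,
      blockWeight lam J (J + m + J) ω ∂(pathLaw ν)) / wt m) atTop (𝓝 L) by
    obtain ⟨L, hL⟩ := h
    refine ⟨L, ?_⟩
    have h := tendsto_div_wt_sub hL (J + J)
    refine h.congr' ?_
    filter_upwards [eventually_ge_atTop (J + J)] with n hn
    rw [show J + (n - (J + J)) + J = n by omega, show J + (n - (J + J)) = n - J by omega]
  refine tendsto_setIntegral_block hF hgood (Ψ := Ψ)
    (B := Real.exp K * (χ⁻¹ * χ⁻¹ ^ J) / (χ * χ)) (J := J) (K := K)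
    (f := fun m => blockWeight lam J (J + m + J)) (by rw [hΨ, hA]; fun_prop) ?_ ?_
    (fun m => (integrable_blockWeight hχ hgood hlam hJ _).integrableOn) ?_
  · intro ω₁ h₁ ω₃ h₃ u hu
    have h4 := hden (ω₃ := ω₃) h₁ hu.1 (hA0 h₃)
    have h5 := hden (ω₃ := ω₃) h₁ hu.1 (hAq h₃)
    have h6 := lastIncr_pos hχ h₃ J
    have h7 : lastIncr J ω₃ ≤ χ⁻¹ * χ⁻¹ ^ J := (lastIncr_le h₃ J).trans
      (mul_le_mul_of_nonneg_left (exp_neg_pathSum_le_pow hχ h₃ J) (by positivity))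
    simp only [hΨ]
    rw [abs_of_nonneg (div_nonneg (by positivity)
      (mul_nonneg (hχ.le.trans h4) (hχ.le.trans h5)))]
    have h8 := hχ.le.trans h4
    gcongr
  · intro ω₁ h₁ ω₃ h₃
    refine ContinuousOn.div (by fun_prop) (by fun_prop) fun u hu => ?_
    have h4 := hden (ω₃ := ω₃) h₁ hu.1 (hA0 h₃)
    have h5 := hden (ω₃ := ω₃) h₁ hu.1 (hAq h₃)
    exact (mul_pos (hχ.trans_le h4) (hχ.trans_le h5)).ne'
  · intro m ω₁ h₁ ω₂ h₂ ω₃ h₃ _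
    have hp : Real.exp (-(pathSum J ω₁ + pathSum m ω₂)) =
        Real.exp K * Real.exp (-(K + pathSum J ω₁ + pathSum m ω₂)) := by
      rw [← Real.exp_add]; congr 1; ring
    unfold blockWeight
    rw [Nat.add_sub_cancel, potential_concat_add, lastIncr_concat_add,
      potential_concat_of_le (Nat.le_add_right J m), potential_concat_of_le le_rfl,
      pathSum_concat_add (J + m) J, pathSum_concat_add J m, neg_add (_ + _) (pathSum J ω₃),
      Real.exp_add, hp]
    simp only [hΨ, hA]
    rw [← mul_div_assoc]
    congr 1 <;> ring

lemma exists_tendsto_of_approx {a : ℕ → ℝ}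
    (h : ∀ δ > 0, ∃ b : ℕ → ℝ, (∃ L, Tendsto b atTop (𝓝 L)) ∧ ∀ᶠ n in atTop, |a n - b n| ≤ δ) :
    ∃ L, Tendsto a atTop (𝓝 L) := by
  refine cauchySeq_tendsto_of_complete (Metric.cauchySeq_iff'.2 fun ε hε => ?_)
  obtain ⟨b, ⟨L, hL⟩, hb⟩ := h (ε / 5) (by positivity)
  have h1 : ∀ᶠ n in atTop, |b n - L| < ε / 5 := by
    simpa [Real.dist_eq] using (Metric.tendsto_nhds.1 hL (ε / 5) (by positivity))
  obtain ⟨N, hN⟩ := eventually_atTop.1 (hb.and h1)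
  refine ⟨N, fun n hn => ?_⟩
  have h2 := hN n hn
  have h3 := hN N le_rfl
  rw [Real.dist_eq]
  simp only [abs_le, abs_lt] at *
  constructor <;> linarith [h2.1.1, h2.1.2, h2.2.1, h2.2.2, h3.1.1, h3.1.2, h3.2.1, h3.2.2]

lemma sum_wt_mul_wt_Ico_le {J n : ℕ} (hJ : J ≤ n) :
    ∑ i ∈ Finset.Ico J (n - J), wt i * wt (n - i) ≤ 8 * wt n * ∑' i, wt (i + J) := by
  have hs : Summable fun i => wt (i + J) := (summable_nat_add_iff J).2 summable_wt
  have hI (s : Finset ℕ) (hs' : ∀ i ∈ s, J ≤ i) : ∑ i ∈ s, wt i ≤ ∑' i, wt (i + J) := by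
    have : ∑ i ∈ s, wt i = ∑ i ∈ s.image (· - J), wt (i + J) := by
      rw [Finset.sum_image fun a ha b hb hab => by
        have := hs' a ha; have := hs' b hb; omega]
      exact Finset.sum_congr rfl fun i hi => by rw [Nat.sub_add_cancel (hs' i hi)]
    rw [this]
    exact hs.sum_le_tsum _ fun i _ => (wt_pos _).le
  have h1 := hI (Finset.Ico J (n - J)) fun i hi => (Finset.mem_Ico.1 hi).1
  have h2 : ∑ i ∈ Finset.Ico J (n - J), wt (n - i) ≤ ∑' i, wt (i + J) := by
    have : ∑ i ∈ Finset.Ico J (n - J), wt (n - i) =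
        ∑ i ∈ (Finset.Ico J (n - J)).image (n - ·), wt i := by
      rw [Finset.sum_image fun a ha b hb hab => by
        have := Finset.mem_Ico.1 ha; have := Finset.mem_Ico.1 hb; omega]
    rw [this]
    refine hI _ fun i hi => ?_
    obtain ⟨a, ha, rfl⟩ := Finset.mem_image.1 hi
    have := Finset.mem_Ico.1 ha
    omega
  calc _ ≤ ∑ i ∈ Finset.Ico J (n - J), 4 * wt n * (wt i + wt (n - i)) := by
        refine Finset.sum_le_sum fun i hi => ?_
        have := Finset.mem_Ico.1 hi
        have h := wt_mul_wt_le i (n - i)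
        rwa [Nat.add_sub_cancel' (by omega)] at h
    _ = 4 * wt n * (∑ i ∈ Finset.Ico J (n - J), wt i +
        ∑ i ∈ Finset.Ico J (n - J), wt (n - i)) := by
        rw [← Finset.mul_sum, Finset.sum_add_distrib]
    _ ≤ 4 * wt n * (∑' i, wt (i + J) + ∑' i, wt (i + J)) := by
        have := wt_pos n
        gcongr
    _ = _ := by ring

lemma abs_integral_sub_setIntegral_tiltWeight_le (hF : IsCenteredStep (ν.map Prod.fst) σ)
    (hχ : 0 < χ) (hχ1 : χ ≤ 1) (hgood : ∀ᵐ ω ∂(pathLaw ν), ω ∈ goodSet χ) :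
    ∃ ε : ℕ → ℝ, Tendsto ε atTop (𝓝 0) ∧ (∀ lam, 0 ≤ lam → ∀ k n K : ℕ, k ≤ n →
      |∫ ω, tiltWeight lam k n ω ∂(pathLaw ν) -
        ∫ ω in aboveSet n K, tiltWeight lam k n ω ∂(pathLaw ν)| ≤ ε K * wt n) ∧
      ∀ lam, 0 ≤ lam → ∀ J n K : ℕ, 0 < J →
      |∫ ω in aboveSet n K, blockWeight lam J n ω ∂(pathLaw ν) -
        ∫ ω in aboveSet (n - J) K, blockWeight lam J n ω ∂(pathLaw ν)| ≤ ε K * wt n := by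
  obtain ⟨ε, hε, h⟩ := exists_tail_bound hF
    (hgood.mono fun ω hω i => le_fst_of_mem_goodSet hχ hω i)
  have hχi : 1 ≤ χ⁻¹ := (one_le_inv₀ hχ).2 hχ1
  refine ⟨fun K => χ⁻¹ ^ 5 * ε K, by simpa only [mul_zero] using hε.const_mul (χ⁻¹ ^ 5),
    fun lam hlam k n K hkn => ?_, fun lam hlam J n K hJ => ?_⟩
  · have hi := integrable_tiltWeight hχ hχ1 hgood hlam hkn
    rw [← integral_add_compl (measurableSet_aboveSet n K) hi, add_sub_cancel_left,
      abs_of_nonneg (integral_nonneg_of_ae (ae_restrict_of_ae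
        (hgood.mono fun ω hω => tiltWeight_nonneg hχ hχ1 hω hlam hkn)))]
    exact h _ _ n K (by positivity)
      (hgood.mono fun ω hω => tiltWeight_nonneg hχ hχ1 hω hlam hkn)
      (hgood.mono fun ω hω i hi => tiltWeight_le hχ hχ1 hω hlam hkn hi)
  · have hi := integrable_blockWeight hχ hgood hlam hJ n
    have hm := measurableSet_aboveSet n (K : ℝ)
    have hsub := aboveSet_anti (Nat.sub_le n J) (K : ℝ)
    set f : (ℕ → ℝ × ℝ) → ℝ :=
      (aboveSet (n - J) K \ aboveSet n K).indicator (blockWeight lam J n) with hf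
    have hf0 : ∀ᵐ ω ∂(pathLaw ν), 0 ≤ f ω := hgood.mono fun ω hω =>
      indicator_apply_nonneg fun _ => blockWeight_nonneg hχ hω hlam J n
    have hfe : ∫ ω in (aboveSet n K)ᶜ, f ω ∂(pathLaw ν) =
        ∫ ω in aboveSet (n - J) K \ aboveSet n K, blockWeight lam J n ω ∂(pathLaw ν) := by
      rw [hf, setIntegral_indicator ((measurableSet_aboveSet _ _).diff hm)]
      congr 2
      ext ω; simp
    rw [← integral_inter_add_sdiff (s := aboveSet (n - J) (K : ℝ)) hm hi.integrableOn,
      inter_eq_self_of_subset_right hsub, sub_add_cancel_left, abs_neg, ← hfe,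
      abs_of_nonneg (integral_nonneg_of_ae (ae_restrict_of_ae hf0))]
    refine h _ _ n K (by positivity) hf0 (hgood.mono fun ω hω i hi => ?_)
    by_cases hω' : ω ∈ aboveSet (n - J) (K : ℝ) \ aboveSet n K
    · rw [hf, indicator_of_mem hω']
      refine (blockWeight_le_of_notMem hχ hχ1 hω hlam hω'.1 hω'.2 hi).trans ?_
      exact mul_le_mul_of_nonneg_right (pow_le_pow_right₀ hχi (by norm_num)) (by positivity)
    · rw [hf, indicator_of_notMem hω']
      positivity

lemma setIntegral_abs_tiltWeight_sub_blockWeight_le (hF : IsCenteredStep (ν.map Prod.fst) σ)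
    (hχ : 0 < χ) (hχ1 : χ ≤ 1) (hgood : ∀ᵐ ω ∂(pathLaw ν), ω ∈ goodSet χ) {lam : ℝ}
    (hlam : 0 ≤ lam) (K : ℕ) : ∃ C, 0 ≤ C ∧ ∀ J k n : ℕ, 0 < J → J ≤ k → k < n - J →
      |∫ ω in aboveSet n K, tiltWeight lam k n ω ∂(pathLaw ν) -
        ∫ ω in aboveSet n K, blockWeight lam J n ω ∂(pathLaw ν)| ≤
      C * (∑' i, wt (i + J)) * wt n := by
  obtain ⟨C₁, hC₁, h₁⟩ := abs_tiltWeight_sub_blockWeight_le hχ hχ1 hlam (K : ℝ)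
  obtain ⟨C₂, hC₂, h₂⟩ := setIntegral_exp_mul_exp_le hF (x := K) K.cast_nonneg
  refine ⟨C₁ * (C₂ * 8), by positivity, fun J k n hJ hJk hkn => ?_⟩
  have hm := measurableSet_aboveSet n (K : ℝ)
  have h_intble (i : ℕ) (hi : i ≤ n) : IntegrableOn (fun ω => Real.exp (-pathSum i ω) *
      Real.exp (-pathSum n ω)) (aboveSet n K) (pathLaw ν) := by
    refine integrableOn_of_abs_le ν hm (by fun_prop) (C := Real.exp K * Real.exp K)
      fun ω hω => ?_
    rw [abs_mul, Real.abs_exp, Real.abs_exp]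
    exact mul_le_mul (exp_neg_pathSum_le hi hω) (exp_neg_pathSum_le le_rfl hω)
      (Real.exp_pos _).le (Real.exp_pos _).le
  rw [← integral_sub (integrable_tiltWeight hχ hχ1 hgood hlam (by omega)).integrableOn
    (integrable_blockWeight hχ hgood hlam hJ n).integrableOn]
  have h_intble' : IntegrableOn (fun ω => C₁ * ∑ i ∈ Finset.Ico J (n - J),
      Real.exp (-pathSum i ω) * Real.exp (-pathSum n ω)) (aboveSet n K) (pathLaw ν) :=
    (integrable_finsetSum _ fun i hi => h_intble i (by
      have := Finset.mem_Ico.1 hi; omega)).const_mul _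
  rw [← Real.norm_eq_abs]
  refine (norm_integral_le_of_norm_le h_intble' ?_).trans ?_
  · filter_upwards [ae_restrict_of_ae hgood, ae_restrict_mem hm] with ω hω hωK
    exact h₁ J k n hJ hJk hkn ω hω hωK
  · rw [integral_const_mul, integral_finsetSum _ fun i hi => h_intble i (by
      have := Finset.mem_Ico.1 hi; omega), mul_assoc, mul_assoc]
    refine mul_le_mul_of_nonneg_left ?_ hC₁
    calc _ ≤ ∑ i ∈ Finset.Ico J (n - J), C₂ * (wt i * wt (n - i)) := by
          refine Finset.sum_le_sum fun i hi => ?_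
          have := Finset.mem_Ico.1 hi
          have h := h₂ i (n - i)
          rwa [Nat.add_sub_cancel' (by omega)] at h
      _ ≤ C₂ * (8 * wt n * ∑' i, wt (i + J)) := by
          rw [← Finset.mul_sum]
          exact mul_le_mul_of_nonneg_left (sum_wt_mul_wt_Ico_le (by omega)) hC₂.le
      _ = _ := by ring

variable {k : ℕ → ℕ}

lemma exists_tendsto_integral_tiltWeight (hF : IsCenteredStep (ν.map Prod.fst) σ)
    (hχ : 0 < χ) (hχ1 : χ ≤ 1) (hgood : ∀ᵐ ω ∂(pathLaw ν), ω ∈ goodSet χ)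
    (hk : Tendsto k atTop atTop) (hk' : Tendsto (fun n => n - k n) atTop atTop) {lam : ℝ}
    (hlam : 0 ≤ lam) :
    ∃ L, Tendsto (fun n => (∫ ω, tiltWeight lam (k n) n ω ∂(pathLaw ν)) / wt n) atTop (𝓝 L) := by
  obtain ⟨ε, hε, h₁, h₂⟩ := abs_integral_sub_setIntegral_tiltWeight_le hF hχ hχ1 hgood
  refine exists_tendsto_of_approx fun δ hδ => ?_
  obtain ⟨K, hK⟩ := (hε.eventually (gt_mem_nhds (show 0 < δ / 3 by positivity))).exists
  obtain ⟨C, hC, h₃⟩ := setIntegral_abs_tiltWeight_sub_blockWeight_le hF hχ hχ1 hgood hlam K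
  have hJ : Tendsto (fun J => C * ∑' i, wt (i + J)) atTop (𝓝 0) := by
    simpa using (tendsto_sum_nat_add wt).const_mul C
  obtain ⟨J, hJδ, hJ0⟩ := ((hJ.eventually (gt_mem_nhds (show 0 < δ / 3 by positivity))).and
    (eventually_gt_atTop 0)).exists
  refine ⟨_, exists_tendsto_blockWeight hF hχ hgood hlam hJ0 K, ?_⟩
  filter_upwards [hk.eventually_ge_atTop J, hk'.eventually_gt_atTop J] with n hn hn'
  have hw := wt_pos n
  rw [← sub_div, abs_div, abs_of_pos hw, div_le_iff₀ hw]
  have e₁ := h₁ lam hlam (k n) n K (by omega)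
  have e₂ := h₂ lam hlam J n K hJ0
  have e₃ := h₃ J (k n) n hJ0 hn (by omega)
  have e₄ := mul_le_mul_of_nonneg_right hK.le hw.le
  have e₅ := mul_le_mul_of_nonneg_right hJδ.le hw.le
  have := abs_sub_le (∫ ω, tiltWeight lam (k n) n ω ∂(pathLaw ν))
    (∫ ω in aboveSet n K, tiltWeight lam (k n) n ω ∂(pathLaw ν))
    (∫ ω in aboveSet (n - J) K, blockWeight lam J n ω ∂(pathLaw ν))
  have := abs_sub_le (∫ ω in aboveSet n K, tiltWeight lam (k n) n ω ∂(pathLaw ν))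
    (∫ ω in aboveSet n K, blockWeight lam J n ω ∂(pathLaw ν))
    (∫ ω in aboveSet (n - J) K, blockWeight lam J n ω ∂(pathLaw ν))
  linarith

end Limits

section LimitProperties

variable {ν : Measure (ℝ × ℝ)} [IsProbabilityMeasure ν] {σ χ : ℝ} {k : ℕ → ℕ}

lemma setIntegral_exp_neg_pathSum_le (hF : IsCenteredStep (ν.map Prod.fst) σ) :
    ∀ θ : ℝ, 0 < θ → ∀ K : ℕ, ∃ D, 0 ≤ D ∧ ∀ n,
      ∫ ω in aboveSet n K, Real.exp (-θ * pathSum n ω) ∂(pathLaw ν) ≤ D * wt n := by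
  intro θ hθ K
  obtain ⟨C, hC, h⟩ := setIntegral_exp_pathSum_le hF hθ
  exact ⟨C * Real.exp (θ * K) * (1 + K) ^ 2, by positivity, h K K.cast_nonneg⟩

lemma exists_abs_integral_tiltWeight_sub_le (hF : IsCenteredStep (ν.map Prod.fst) σ)
    (hχ : 0 < χ) (hχ1 : χ ≤ 1) (hgood : ∀ᵐ ω ∂(pathLaw ν), ω ∈ goodSet χ) :
    ∀ δ > 0, ∃ C, 0 ≤ C ∧ ∀ lam, 0 ≤ lam → ∀ k n : ℕ, 0 < k → k ≤ n →
      |∫ ω, tiltWeight lam k n ω ∂(pathLaw ν) - ∫ ω, tiltWeight 0 k n ω ∂(pathLaw ν)| ≤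
        (δ + lam * C) * wt n := by
  intro δ hδ
  obtain ⟨ε, hε, h₁, -⟩ := abs_integral_sub_setIntegral_tiltWeight_le hF hχ hχ1 hgood
  obtain ⟨K, hK⟩ := (hε.eventually (gt_mem_nhds (show 0 < δ / 2 by positivity))).exists
  obtain ⟨C, hC, h₂⟩ := abs_tiltWeight_sub_tiltWeight_zero_le hχ hχ1 (K : ℝ)
  obtain ⟨D, hD, h₃⟩ := setIntegral_exp_neg_pathSum_le hF 1 one_pos K
  refine ⟨C * D, by positivity, fun lam hlam k n hk hkn => ?_⟩
  have hw := wt_pos n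
  have e₁ := h₁ lam hlam k n K hkn
  have e₂ := h₁ 0 le_rfl k n K hkn
  have e₃ : |∫ ω in aboveSet n K, tiltWeight lam k n ω ∂(pathLaw ν) -
      ∫ ω in aboveSet n K, tiltWeight 0 k n ω ∂(pathLaw ν)| ≤ lam * C * (D * wt n) := by
    rw [← integral_sub (integrable_tiltWeight hχ hχ1 hgood hlam hkn).integrableOn
      (integrable_tiltWeight hχ hχ1 hgood le_rfl hkn).integrableOn, ← Real.norm_eq_abs]
    refine (norm_integral_le_of_norm_le
      ((integrableOn_exp_pathSum ν zero_le_one n K).const_mul (lam * C)) ?_).trans ?_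
    · filter_upwards [ae_restrict_of_ae hgood, ae_restrict_mem (measurableSet_aboveSet n K)]
        with ω hω hωK
      simpa using h₂ lam hlam k n hk hkn ω hω hωK
    · rw [integral_const_mul]
      exact mul_le_mul_of_nonneg_left (h₃ n) (by positivity)
  have e₄ := mul_le_mul_of_nonneg_right hK.le hw.le
  rw [abs_le] at *
  constructor <;> linarith [e₁.1, e₁.2, e₂.1, e₂.2, e₃.1, e₃.2]

lemma exists_integral_tiltWeight_le (hF : IsCenteredStep (ν.map Prod.fst) σ)
    (hχ : 0 < χ) (hχ1 : χ ≤ 1) (hgood : ∀ᵐ ω ∂(pathLaw ν), ω ∈ goodSet χ) :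
    ∀ δ > 0, ∃ C, 0 ≤ C ∧ ∀ lam, 0 < lam → ∀ k n : ℕ, 0 < k → k ≤ n →
      ∫ ω, tiltWeight lam k n ω ∂(pathLaw ν) ≤ (δ + √(χ⁻¹ ^ 9 / lam) * C) * wt n := by
  intro δ hδ
  obtain ⟨ε, hε, h₁, -⟩ := abs_integral_sub_setIntegral_tiltWeight_le hF hχ hχ1 hgood
  obtain ⟨K, hK⟩ := (hε.eventually (gt_mem_nhds hδ)).exists
  obtain ⟨D, hD, h₃⟩ := setIntegral_exp_neg_pathSum_le hF (1 / 2) one_half_pos K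
  refine ⟨D, hD, fun lam hlam k n hk hkn => ?_⟩
  have hw := wt_pos n
  have e₁ := (abs_le.1 (h₁ lam hlam.le k n K hkn)).2
  have e₃ : ∫ ω in aboveSet n K, tiltWeight lam k n ω ∂(pathLaw ν) ≤
      √(χ⁻¹ ^ 9 / lam) * (D * wt n) := by
    refine (setIntegral_mono_ae_restrict (integrable_tiltWeight hχ hχ1 hgood hlam.le hkn).integrableOn
      ((integrableOn_exp_pathSum ν one_half_pos.le n K).const_mul (√(χ⁻¹ ^ 9 / lam))) ?_).trans ?_
    · exact ae_restrict_of_ae (hgood.mono fun ω hω => tiltWeight_le_sqrt hχ hχ1 hω hlam hk hkn)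
    · rw [integral_const_mul]
      exact mul_le_mul_of_nonneg_left (h₃ n) (by positivity)
  have e₄ := mul_le_mul_of_nonneg_right hK.le hw.le
  linarith

lemma exists_le_integral_tiltWeight_zero (hF : IsCenteredStep (ν.map Prod.fst) σ)
    (hχ : 0 < χ) (hχ1 : χ ≤ 1) (hgood : ∀ᵐ ω ∂(pathLaw ν), ω ∈ goodSet χ) :
    ∃ c > 0, ∀ᶠ n in atTop, ∀ k ≤ n,
      c * wt n ≤ ∫ ω, tiltWeight 0 k n ω ∂(pathLaw ν) := by
  have : IsProbabilityMeasure (ν.map Prod.fst) :=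
    Measure.isProbabilityMeasure_map measurable_fst.aemeasurable
  obtain ⟨c, hc, h₁⟩ := le_integral_exp_posLaw hF
  obtain ⟨C, hC, h₂⟩ := setIntegral_exp_mul_exp_le hF le_rfl
  obtain ⟨C', hC', h₃⟩ := sum_wt_mul_wt_le
  set M := 2 * (C * C') / c with hM
  have hM0 : 0 < M := by positivity
  refine ⟨χ ^ 3 / 9 / M ^ 2 * (c / 2), by positivity, ?_⟩
  filter_upwards [h₁, eventually_gt_atTop 0] with n hn hn0 k hkn
  have hm := measurableSet_aboveSet n (0 : ℝ)
  have hw := wt_pos n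
  have h_intble (i : ℕ) (hi : i ≤ n) : IntegrableOn (fun ω => Real.exp (-pathSum i ω) *
      Real.exp (-pathSum n ω)) (aboveSet n 0) (pathLaw ν) := by
    refine integrableOn_of_abs_le ν hm (by fun_prop) (C := Real.exp 0 * Real.exp 0)
      fun ω hω => ?_
    rw [abs_mul, Real.abs_exp, Real.abs_exp]
    exact mul_le_mul (exp_neg_pathSum_le hi hω) (exp_neg_pathSum_le le_rfl hω)
      (Real.exp_pos _).le (Real.exp_pos _).le
  have h_intble₁ : IntegrableOn (fun ω => Real.exp (-pathSum n ω)) (aboveSet n 0) (pathLaw ν) := by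
    simpa using integrableOn_exp_pathSum ν zero_le_one n 0
  have h_intble₂ : IntegrableOn (fun ω => ∑ i ∈ Finset.range n, Real.exp (-pathSum i ω) *
      Real.exp (-pathSum n ω)) (aboveSet n 0) (pathLaw ν) :=
    integrable_finsetSum _ fun i hi => h_intble i (Finset.mem_range.1 hi).le
  have hlow : c * wt n ≤ ∫ ω in aboveSet n 0, Real.exp (-pathSum n ω) ∂(pathLaw ν) := by
    refine hn.trans_eq ?_
    rw [← setIntegral_aboveSet ν le_rfl n (g := fun z => Real.exp (-|z|)) (by fun_prop)]
    refine setIntegral_congr_fun hm fun ω hω => ?_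
    rw [abs_of_nonneg (hω n le_rfl), zero_add]
  have hup : ∫ ω in aboveSet n 0, ∑ i ∈ Finset.range n, Real.exp (-pathSum i ω) *
      Real.exp (-pathSum n ω) ∂(pathLaw ν) ≤ C * C' * wt n := by
    rw [integral_finsetSum _ fun i hi => h_intble i (Finset.mem_range.1 hi).le]
    calc _ ≤ ∑ i ∈ Finset.range n, C * (wt i * wt (n - i)) := by
          refine Finset.sum_le_sum fun i hi => ?_
          have h := h₂ i (n - i)
          rwa [Nat.add_sub_cancel' (Finset.mem_range.1 hi).le] at h
      _ ≤ C * ∑ i ∈ Finset.range (n + 1), wt i * wt (n - i) := by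
          rw [← Finset.mul_sum, Finset.sum_range_succ]
          have := wt_pos (n - n)
          gcongr
          exact le_add_of_nonneg_right (by positivity)
      _ ≤ _ := by rw [mul_assoc]; exact mul_le_mul_of_nonneg_left (h₃ n) hC.le
  have hti := integrable_tiltWeight hχ hχ1 hgood le_rfl hkn (lam := 0)
  calc χ ^ 3 / 9 / M ^ 2 * (c / 2) * wt n
      = χ ^ 3 / 9 / M ^ 2 * (c * wt n - C * C' * wt n / M) := by
        rw [hM]; field_simp; ring
    _ ≤ χ ^ 3 / 9 / M ^ 2 * (∫ ω in aboveSet n 0, Real.exp (-pathSum n ω) ∂(pathLaw ν) -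
        (∫ ω in aboveSet n 0, ∑ i ∈ Finset.range n, Real.exp (-pathSum i ω) *
          Real.exp (-pathSum n ω) ∂(pathLaw ν)) / M) := by gcongr
    _ = ∫ ω in aboveSet n 0, χ ^ 3 / 9 / M ^ 2 * (Real.exp (-pathSum n ω) -
        (∑ i ∈ Finset.range n, Real.exp (-pathSum i ω) * Real.exp (-pathSum n ω)) / M)
          ∂(pathLaw ν) := by
        rw [integral_const_mul, integral_sub h_intble₁ (h_intble₂.div_const M), integral_div]
    _ ≤ ∫ ω in aboveSet n 0, tiltWeight 0 k n ω ∂(pathLaw ν) := by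
        refine setIntegral_mono_ae_restrict ((h_intble₁.sub (h_intble₂.div_const M)).const_mul _)
          hti.integrableOn ?_
        filter_upwards [ae_restrict_of_ae hgood, ae_restrict_mem hm] with ω hω hωK
        exact le_tiltWeight_zero hχ hχ1 hω hkn hn0 hωK hM0
    _ ≤ _ := setIntegral_le_integral hti
        (hgood.mono fun ω hω => tiltWeight_nonneg hχ hχ1 hω le_rfl hkn)

/-- Asymptotics of the Laplace functionals of the population at time `k n`. -/
theorem exists_tiltWeight_limit (hF : IsCenteredStep (ν.map Prod.fst) σ)
    (hχ : 0 < χ) (hχ1 : χ ≤ 1) (hgood : ∀ᵐ ω ∂(pathLaw ν), ω ∈ goodSet χ)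
    (hk : Tendsto k atTop atTop) (hk' : Tendsto (fun n => n - k n) atTop atTop) :
    ∃ c : ℝ → ℝ, (∀ lam, 0 ≤ lam → Tendsto (fun n =>
        (∫ ω, tiltWeight lam (k n) n ω ∂(pathLaw ν)) / wt n) atTop (𝓝 (c lam))) ∧
      0 < c 0 ∧ Tendsto c (𝓝[>] 0) (𝓝 (c 0)) ∧ Tendsto c atTop (𝓝 0) := by
  choose! c hc using fun lam (hlam : 0 ≤ lam) =>
    exists_tendsto_integral_tiltWeight hF hχ hχ1 hgood hk hk' hlam
  have hev : ∀ᶠ n in atTop, 0 < k n ∧ k n ≤ n := by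
    filter_upwards [hk.eventually_gt_atTop 0, hk'.eventually_gt_atTop 0] with n h1 h2
    exact ⟨h1, by omega⟩
  refine ⟨c, hc, ?_, ?_, ?_⟩
  · obtain ⟨a, ha, h⟩ := exists_le_integral_tiltWeight_zero hF hχ hχ1 hgood
    refine ha.trans_le (ge_of_tendsto (hc 0 le_rfl) ?_)
    filter_upwards [h, hev] with n hn hkn
    exact (le_div_iff₀ (wt_pos n)).2 (hn (k n) hkn.2)
  · refine Metric.tendsto_nhds.2 fun δ hδ => ?_
    obtain ⟨C, hC, h⟩ := exists_abs_integral_tiltWeight_sub_le hF hχ hχ1 hgood (δ / 2)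
      (by positivity)
    have hlim : Tendsto (fun lam : ℝ => δ / 2 + lam * C) (𝓝[>] 0) (𝓝 (δ / 2 + 0 * C)) :=
      ((continuous_const.add (continuous_id.mul continuous_const)).tendsto 0).mono_left
        nhdsWithin_le_nhds
    filter_upwards [hlim.eventually (gt_mem_nhds (show δ / 2 + 0 * C < δ by linarith)),
      self_mem_nhdsWithin] with lam hlam (hlam0 : 0 < lam)
    refine lt_of_le_of_lt ?_ hlam
    rw [Real.dist_eq]
    refine le_of_tendsto ((hc lam hlam0.le).sub (hc 0 le_rfl)).abs ?_
    filter_upwards [hev] with n hn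
    have hw := wt_pos n
    rw [← sub_div, abs_div, abs_of_pos hw, div_le_iff₀ hw]
    exact h lam hlam0.le (k n) n hn.1 hn.2
  · refine Metric.tendsto_nhds.2 fun δ hδ => ?_
    obtain ⟨C, hC, h⟩ := exists_integral_tiltWeight_le hF hχ hχ1 hgood (δ / 2)
      (by positivity)
    have hlim : Tendsto (fun lam : ℝ => δ / 2 + √(χ⁻¹ ^ 9 / lam) * C) atTop
        (𝓝 (δ / 2 + √0 * C)) :=
      ((((Real.continuous_sqrt.tendsto 0).comp
        (tendsto_const_nhds.div_atTop tendsto_id)).mul_const C).const_add (δ / 2))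
    rw [Real.sqrt_zero, zero_mul, add_zero] at hlim
    filter_upwards [hlim.eventually (gt_mem_nhds (show δ / 2 < δ by linarith)),
      eventually_gt_atTop 0] with lam hlam hlam0
    refine lt_of_le_of_lt ?_ hlam
    have hnn : 0 ≤ c lam := by
      refine ge_of_tendsto (hc lam hlam0.le) ?_
      filter_upwards [hev] with n hn
      exact div_nonneg (integral_nonneg_of_ae (hgood.mono fun ω hω =>
        tiltWeight_nonneg hχ hχ1 hω hlam0.le hn.2)) (wt_pos n).le
    rw [Real.dist_eq, sub_zero, abs_of_nonneg hnn]
    refine le_of_tendsto (hc lam hlam0.le) ?_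
    filter_upwards [hev] with n hn
    rw [div_le_iff₀ (wt_pos n)]
    exact h lam hlam0 (k n) n hn.1 hn.2

end LimitProperties

section Environment

lemma measurable_tsum_of_nonneg {α : Type*} [MeasurableSpace α] {f : ℕ → α → ℝ}
    (hf : ∀ i, Measurable (f i)) (h0 : ∀ i x, 0 ≤ f i x) : Measurable fun x => ∑' i, f i x := by
  have h (x : α) : ∑' i, f i x = (∑' i, ENNReal.ofReal (f i x)).toReal := by
    rw [ENNReal.tsum_toReal_eq fun i => ENNReal.ofReal_ne_top]
    exact tsum_congr fun i => (ENNReal.toReal_ofReal (h0 i x)).symm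
  simp only [h]
  exact (Measurable.tsum fun i => (hf i).ennreal_ofReal).ennreal_toReal

lemma natCast_mul_sub_one_nonneg (i : ℕ) : (0 : ℝ) ≤ (i : ℝ) * ((i : ℝ) - 1) := by
  rcases i with - | i
  · simp
  · push_cast
    rw [add_sub_cancel_right]
    positivity

/-- The pair `(X, η)` attached to an offspring law. -/
def envPair (q : Measure ℕ) : ℝ × ℝ :=
  (Real.log (∑' i : ℕ, (i : ℝ) * (q {i}).toReal),
    (∑' i : ℕ, ((i : ℝ) * ((i : ℝ) - 1)) * (q {i}).toReal) /
      (2 * (∑' i : ℕ, (i : ℝ) * (q {i}).toReal) ^ 2))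

lemma measurable_envPair : Measurable envPair := by
  have hq (i : ℕ) : Measurable fun q : Measure ℕ => (q {i}).toReal :=
    (Measure.measurable_coe (measurableSet_singleton i)).ennreal_toReal
  have h1 : Measurable fun q : Measure ℕ => ∑' i : ℕ, (i : ℝ) * (q {i}).toReal :=
    measurable_tsum_of_nonneg (fun i => (hq i).const_mul _) fun i q => by positivity
  have h2 : Measurable fun q : Measure ℕ => ∑' i : ℕ, ((i : ℝ) * ((i : ℝ) - 1)) * (q {i}).toReal :=
    measurable_tsum_of_nonneg (fun i => (hq i).const_mul _) fun i q =>
      mul_nonneg (natCast_mul_sub_one_nonneg i) ENNReal.toReal_nonneg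
  exact (Real.measurable_log.comp h1).prodMk (h2.div ((h1.pow_const 2).const_mul 2))

variable {Ω : Type*} {Q : ℕ → Ω → Measure ℕ}

lemma etaEnv_nonneg (n : ℕ) (ω : Ω) : 0 ≤ etaEnv Q n ω :=
  div_nonneg (tsum_nonneg fun i => mul_nonneg (natCast_mul_sub_one_nonneg i)
    ENNReal.toReal_nonneg) (by positivity)

/-- The pairs `(X, η)` of the successive generations. -/
def envPath (Q : ℕ → Ω → Measure ℕ) (ω : Ω) (i : ℕ) : ℝ × ℝ := envPair (Q (i + 1) ω)

lemma envPath_fst (ω : Ω) (i : ℕ) : (envPath Q ω i).1 = Xenv Q (i + 1) ω := rfl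

lemma envPath_snd (ω : Ω) (i : ℕ) : (envPath Q ω i).2 = etaEnv Q (i + 1) ω := rfl

lemma pathSum_envPath (n : ℕ) (ω : Ω) : pathSum n (envPath Q ω) = Senv Q n ω := by
  induction n with
  | zero => simp [Senv, walk]
  | succ n ih =>
    rw [pathSum_succ, ih, Senv, walk, walk, Finset.sum_Icc_succ_top (by omega), envPath_fst]

lemma pgf_mem_Ico (hfrac : FracLinear Q) {n : ℕ} (hn : 1 ≤ n) (ω : Ω) {s : ℝ}
    (hs : s ∈ Ico (0 : ℝ) 1) : pgf Q n ω s ∈ Ico (0 : ℝ) 1 := by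
  refine ⟨tsum_nonneg fun i => mul_nonneg ENNReal.toReal_nonneg (pow_nonneg hs.1 i), ?_⟩
  have h := hfrac n hn ω s hs.1 hs.2
  have h1 : 0 < 1 - s := by linarith [hs.2]
  have h2 : 0 < (1 - pgf Q n ω s)⁻¹ := by
    rw [h]
    have := etaEnv_nonneg (Q := Q) n ω
    positivity
  linarith [inv_pos.1 h2]

lemma pgfComp_succ {j n : ℕ} (h : j ≤ n) (ω : Ω) (s : ℝ) :
    pgfComp Q j (n + 1) ω s = pgfComp Q j n ω (pgf Q (n + 1) ω s) :=
  if_neg (by omega)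

lemma pgfComp_self (j : ℕ) (ω : Ω) (s : ℝ) : pgfComp Q j j ω s = s := by
  cases j with
  | zero => rfl
  | succ j => exact if_pos le_rfl

lemma pgfComp_mem_Ico (hfrac : FracLinear Q) {j n : ℕ} (h : j ≤ n) (ω : Ω) {s : ℝ}
    (hs : s ∈ Ico (0 : ℝ) 1) : pgfComp Q j n ω s ∈ Ico (0 : ℝ) 1 := by
  induction n, h using Nat.le_induction generalizing s with
  | base => rwa [pgfComp_self]
  | succ n hn ih =>
    rw [pgfComp_succ hn]
    exact ih (pgf_mem_Ico hfrac (by omega) ω hs)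

lemma potential_succ {j n : ℕ} (h : j ≤ n) (ω : ℕ → ℝ × ℝ) :
    potential j (n + 1) ω = potential j n ω + (ω n).2 * Real.exp (-pathSum n ω) :=
  Finset.sum_Ico_succ_top h _

lemma inv_one_sub_pgfComp (hfrac : FracLinear Q) {j n : ℕ} (h : j ≤ n) (ω : Ω) {s : ℝ}
    (hs : s ∈ Ico (0 : ℝ) 1) :
    (1 - pgfComp Q j n ω s)⁻¹ = (Real.exp (-pathSum n (envPath Q ω)) / (1 - s) +
      potential j n (envPath Q ω)) / Real.exp (-pathSum j (envPath Q ω)) := by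
  induction n, h using Nat.le_induction generalizing s with
  | base =>
    rw [pgfComp_self, potential, Finset.Ico_self, Finset.sum_empty, add_zero]
    have := Real.exp_pos (-pathSum j (envPath Q ω))
    field_simp
  | succ n hn ih =>
    rw [pgfComp_succ hn, ih (pgf_mem_Ico hfrac (by omega) ω hs), potential_succ hn, pathSum_succ,
      envPath_fst, envPath_snd, neg_add, Real.exp_add, div_eq_mul_inv _ (1 - pgf _ _ _ _),
      hfrac (n + 1) (by omega) ω s hs.1 hs.2]
    ring

lemma pgfComp_eq (hfrac : FracLinear Q) {j n : ℕ} (h : j ≤ n) (ω : Ω) {s : ℝ}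
    (hs : s ∈ Ico (0 : ℝ) 1) :
    pgfComp Q j n ω s = 1 - Real.exp (-pathSum j (envPath Q ω)) /
      (Real.exp (-pathSum n (envPath Q ω)) / (1 - s) + potential j n (envPath Q ω)) := by
  have := inv_one_sub_pgfComp hfrac h ω hs
  rw [inv_eq_iff_eq_inv, inv_div] at this
  linarith

lemma potential_envPath_nonneg (i j : ℕ) (ω : Ω) : 0 ≤ potential i j (envPath Q ω) :=
  Finset.sum_nonneg fun l _ => mul_nonneg (etaEnv_nonneg (l + 1) ω) (Real.exp_pos _).le

variable [MeasurableSpace Ω] {μ : Measure Ω}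

/-- The law of `(X, η)`. -/
def envLaw (μ : Measure Ω) (Q : ℕ → Ω → Measure ℕ) : Measure (ℝ × ℝ) :=
  μ.map fun ω => envPair (Q 1 ω)

lemma measurable_envPath (hQ : ∀ i, Measurable (Q i)) : Measurable (envPath Q) :=
  measurable_pi_lambda _ fun i => measurable_envPair.comp (hQ (i + 1))

lemma map_fst_envLaw (hQ : ∀ i, Measurable (Q i)) :
    (envLaw μ Q).map Prod.fst = μ.map (Xenv Q 1) := by
  exact Measure.map_map measurable_fst (measurable_envPair.comp (hQ 1))

lemma envPath_mem_goodSet (hfrac : FracLinear Q) {χ : ℝ} (hA1 : AssumptionA1With μ Q χ) :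
    ∀ᵐ ω ∂μ, envPath Q ω ∈ goodSet χ := by
  obtain ⟨hχ, hχ2, h⟩ := hA1
  filter_upwards [ae_all_iff.2 fun i => h (i + 1) (by omega)] with ω hω i
  obtain ⟨h1, h2, h3⟩ := hω i
  have hf := hfrac (i + 1) (by omega) ω 0 le_rfl one_pos
  rw [sub_zero, div_one] at hf
  rw [envPath_fst, envPath_snd, ← hf]
  have hpos : 0 < 1 - pgf Q (i + 1) ω 0 := by linarith
  refine ⟨h3, ?_, (inv_le_inv₀ hpos hχ).2 (by linarith)⟩
  rw [le_sub_iff_add_le, le_inv_comm₀ (by linarith) hpos]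
  refine le_trans (by linarith : 1 - pgf Q (i + 1) ω 0 ≤ 1 - χ) ?_
  rw [← one_div, le_div_iff₀ (by linarith)]
  nlinarith

lemma isProbabilityMeasure_envLaw [IsProbabilityMeasure μ] (hQ : ∀ i, Measurable (Q i)) :
    IsProbabilityMeasure (envLaw μ Q) :=
  Measure.isProbabilityMeasure_map (measurable_envPair.comp (hQ 1)).aemeasurable

lemma map_envPath (hiid : IIDseq μ Q) [IsProbabilityMeasure (envLaw μ Q)] :
    μ.map (envPath Q) = pathLaw (envLaw μ Q) := by
  have h1 : iIndepFun (fun i ω => envPath Q ω i) μ :=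
    (hiid.2.1.precomp Nat.succ_injective).comp (fun _ => envPair) fun _ => measurable_envPair
  have h2 := h1.map_fun_eq_infinitePi_map fun i => measurable_envPair.comp (hiid.1 (i + 1))
  refine h2.trans ?_
  congr 1
  ext1 i
  exact ((hiid.2.2 (i + 1)).comp measurable_envPair).map_eq

lemma isCenteredStep_envLaw (hQ : ∀ i, Measurable (Q i)) (hA2 : AssumptionA2 μ Q) :
    IsCenteredStep ((envLaw μ Q).map Prod.fst) (√(∫ ω, Xenv Q 1 ω ^ 2 ∂μ)) := by
  obtain ⟨-, h2, h3, h4, h5⟩ := hA2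
  have hX : Measurable (Xenv Q 1) := measurable_fst.comp (measurable_envPair.comp (hQ 1))
  rw [map_fst_envLaw hQ]
  refine ⟨(integrable_map_measure (by fun_prop) hX.aemeasurable).2 h3, ?_, ?_,
    Real.sqrt_pos.2 h4, h5⟩
  · rw [integral_map hX.aemeasurable (by fun_prop)]
    exact h2
  · rw [integral_map hX.aemeasurable (by fun_prop), Real.sq_sqrt h4.le]

lemma measurableSet_goodSet (χ : ℝ) : MeasurableSet (goodSet χ) := by
  have h2 (i : ℕ) : Measurable fun ω : ℕ → ℝ × ℝ => (ω i).2 := by fun_prop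
  have h3 (i : ℕ) : Measurable fun ω : ℕ → ℝ × ℝ => Real.exp (-(ω i).1) + (ω i).2 := by fun_prop
  simp only [goodSet, ofPred_forall]
  exact MeasurableSet.iInter fun i => (measurableSet_le measurable_const (h2 i)).inter
    ((measurableSet_le measurable_const ((h3 i).sub_const 1)).inter
      (measurableSet_le (h3 i) measurable_const))

lemma ae_mem_goodSet (hiid : IIDseq μ Q) [IsProbabilityMeasure (envLaw μ Q)]
    (hfrac : FracLinear Q) {χ : ℝ} (hA1 : AssumptionA1With μ Q χ) :
    ∀ᵐ ω ∂(pathLaw (envLaw μ Q)), ω ∈ goodSet χ := by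
  rw [← map_envPath hiid]
  exact (ae_map_iff (measurable_envPath hiid.1).aemeasurable (measurableSet_goodSet χ)).2
    (envPath_mem_goodSet hfrac hA1)

end Environment

section Laplace

/-- The effect of one more generation on the fractional-linear generating function. -/
lemma inv_sub_inv_eq_tilt {lam h b r w : ℝ} (hlam : 0 ≤ lam) (hh : 0 < h) (hb : 0 ≤ b)
    (hr : h ≤ r) (hw : h ≤ r + w) :
    (1 - (1 / (h / (1 - Real.exp (-(lam * h)) * (1 - h / (r + w))) + b))) -
      (1 - (1 / (h / (1 - Real.exp (-(lam * h)) * (1 - h / r)) + b))) =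
      Real.exp (-(lam * h)) * w / (tiltDen lam h b r * tiltDen lam h b (r + w)) := by
  set e := Real.exp (-(lam * h)) with he
  have he0 : 0 < e := Real.exp_pos _
  have he1 : e ≤ 1 := Real.exp_le_one_iff.2 (by have := mul_nonneg hlam hh.le; linarith)
  have hD (r : ℝ) (hr : h ≤ r) : 0 < tiltDen lam h b r := by
    have h0 : 0 < r := hh.trans_le hr
    have h1 : 0 ≤ (1 - e) / h := div_nonneg (by linarith) hh.le
    rw [tiltDen, ← he]
    positivity
  have hX (r : ℝ) (hr : h ≤ r) : 1 / (h / (1 - e * (1 - h / r)) + b) =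
      ((1 - e) * r + e * h) / (h * tiltDen lam h b r) := by
    have h0 : 0 < r := hh.trans_le hr
    have h1 : 0 < (1 - e) * r + e * h := by
      have := mul_pos he0 hh
      have := mul_nonneg (sub_nonneg.2 he1) h0.le
      linarith
    have h2 : 1 - e * (1 - h / r) = ((1 - e) * r + e * h) / r := by field_simp; ring
    have h3 : h / (1 - e * (1 - h / r)) + b = h * tiltDen lam h b r / ((1 - e) * r + e * h) := by
      rw [h2, tiltDen, ← he, div_div_eq_mul_div, eq_div_iff h1.ne', add_mul,
        div_mul_cancel₀ _ h1.ne']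
      field_simp
      ring
    rw [h3, one_div_div]
  rw [hX r hr, hX (r + w) hw]
  have h1 := (hD r hr).ne'
  have h2 := (hD (r + w) hw).ne'
  have h3 : ((1 - e) * r + e * h) * tiltDen lam h b (r + w) -
      ((1 - e) * (r + w) + e * h) * tiltDen lam h b r = h * (e * w) := by
    simp only [tiltDen, ← he]
    field_simp
    ring
  rw [sub_sub_sub_cancel_left, div_sub_div _ _ (by positivity) (by positivity),
    div_eq_div_iff (by positivity) (by positivity)]
  linear_combination (h * tiltDen lam h b r * tiltDen lam h b (r + w)) * h3

variable {Ω : Type*} {Q : ℕ → Ω → Measure ℕ} {Z : ℕ → Ω → ℕ}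

lemma measurable_envSigma_envPath : Measurable[envSigma Q] (envPath Q) := by
  refine @measurable_pi_lambda _ _ _ (envSigma Q) _ _ fun i => measurable_envPair.comp ?_
  exact Measurable.mono (comap_measurable (Q (i + 1)))
    (le_iSup (fun i => MeasurableSpace.comap (Q (i + 1)) inferInstance) i) le_rfl

lemma pgfComp_zero_eq (hfrac : FracLinear Q) (k : ℕ) (ω : Ω) {s : ℝ}
    (hs : s ∈ Ico (0 : ℝ) 1) :
    pgfComp Q 0 k ω s = 1 - 1 / (Real.exp (-pathSum k (envPath Q ω)) / (1 - s) +
      potential 0 k (envPath Q ω)) := by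
  rw [pgfComp_eq hfrac (Nat.zero_le k) ω hs, pathSum_zero, neg_zero, Real.exp_zero]

lemma extinctTime_eq_succ_iff (hZ : ∀ n ω, Z n ω = 0 → Z (n + 1) ω = 0) (n : ℕ) (ω : Ω) :
    extinctTime Z ω = n + 1 ↔ Z (n + 1) ω = 0 ∧ Z n ω ≠ 0 := by
  have hmono {i j : ℕ} (hij : i ≤ j) (hi : Z i ω = 0) : Z j ω = 0 := by
    induction j, hij using Nat.le_induction with
    | base => exact hi
    | succ j _ ih => exact hZ j ω ih
  constructor
  · intro h
    have hne : {k | Z k ω = 0}.Nonempty := by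
      by_contra h0
      rw [not_nonempty_iff_eq_empty] at h0
      rw [extinctTime, h0, Nat.sInf_empty] at h
      omega
    refine ⟨?_, fun h0 => ?_⟩
    · have := Nat.sInf_mem hne
      rw [← extinctTime, h] at this
      exact this
    · have : extinctTime Z ω ≤ n := Nat.sInf_le h0
      omega
  · rintro ⟨h1, h2⟩
    refine le_antisymm (Nat.sInf_le h1) (Nat.succ_le_of_lt ?_)
    by_contra! h0
    exact h2 (hmono h0 (Nat.sInf_mem (s := {k | Z k ω = 0}) ⟨n + 1, h1⟩))

variable [m0 : MeasurableSpace Ω] {μ : Measure Ω}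

lemma measurableSet_extinctTime (hbranch : BranchingProperty μ Q Z) (n : ℕ) :
    MeasurableSet {ω | extinctTime Z ω = n + 1} := by
  simp only [extinctTime_eq_succ_iff hbranch.2.2.1]
  exact (hbranch.2.1 (n + 1) (measurableSet_singleton 0)).inter
    (hbranch.2.1 n (measurableSet_singleton 0)).compl

variable [IsProbabilityMeasure μ]

lemma envSigma_le (hQ : ∀ i, Measurable (Q i)) : envSigma Q ≤ m0 :=
  iSup_le fun i => (hQ (i + 1)).comap_le

lemma sup_comap_le (hQ : ∀ i, Measurable (Q i)) {k : ℕ} (hZ : Measurable (Z k)) :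
    envSigma Q ⊔ MeasurableSpace.comap (Z k) inferInstance ≤ m0 :=
  sup_le (envSigma_le hQ) hZ.comap_le

lemma integrable_pow_of_mem_Icc {G : Ω → ℝ} (hG : Measurable G) (h : ∀ ω, G ω ∈ Icc (0 : ℝ) 1)
    {N : Ω → ℕ} (hN : Measurable N) : Integrable (fun ω => G ω ^ N ω) μ := by
  refine Integrable.of_bound (hG.pow hN).aestronglyMeasurable 1 (ae_of_all _ fun ω => ?_)
  rw [Real.norm_of_nonneg (pow_nonneg (h ω).1 _)]
  exact pow_le_one₀ (h ω).1 (h ω).2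

lemma setIntegral_pow_eq (hQ : ∀ i, Measurable (Q i)) (hbranch : BranchingProperty μ Q Z) (k : ℕ)
    {s : ℝ} (hs0 : 0 ≤ s) (hs1 : s ≤ 1) {A : Set Ω} (hA : MeasurableSet[envSigma Q] A) :
    ∫ ω in A, s ^ Z k ω ∂μ = ∫ ω in A, pgfComp Q 0 k ω s ∂μ := by
  obtain ⟨hZ0, hZm, -, hZ⟩ := hbranch
  have hle := sup_comap_le (Z := Z) hQ (hZm 0)
  rw [← setIntegral_condExp hle
    (integrable_pow_of_mem_Icc measurable_const (fun _ => ⟨hs0, hs1⟩) (hZm k))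
    (le_sup_left (a := envSigma Q) A hA)]
  refine setIntegral_congr_ae (envSigma_le hQ A hA) ?_
  filter_upwards [hZ 0 k (Nat.zero_le k) s hs0 hs1] with ω hω _
  rw [hω, hZ0, pow_one]

/-- The generating function of `Z k` evaluated at a random argument measurable with respect to
the environment. -/
lemma integral_pow_eq (hQ : ∀ i, Measurable (Q i)) (hfrac : FracLinear Q)
    (hbranch : BranchingProperty μ Q Z) (k : ℕ) {G : Ω → ℝ} (hG : Measurable[envSigma Q] G)
    (hG1 : ∀ ω, G ω ∈ Ico (0 : ℝ) 1) :
    ∫ ω, G ω ^ Z k ω ∂μ = ∫ ω, pgfComp Q 0 k ω (G ω) ∂μ := by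
  have hG' : Measurable G := hG.mono (envSigma_le hQ) le_rfl
  have hZm := hbranch.2.1 k
  set j : ℕ → Ω → ℕ := fun m ω => ⌊((m : ℝ) + 1) * G ω⌋₊ with hj
  set a : ℕ → Ω → ℝ := fun m ω => (j m ω : ℝ) / ((m : ℝ) + 1) with ha
  have hjm (m : ℕ) : Measurable[envSigma Q] (j m) := Nat.measurable_floor.comp (hG.const_mul _)
  have hjm' (m : ℕ) : Measurable (j m) := (hjm m).mono (envSigma_le hQ) le_rfl
  have hjlt (m : ℕ) (ω : Ω) : j m ω < m + 1 := by
    rw [hj, Nat.floor_lt (mul_nonneg (by positivity) (hG1 ω).1)]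
    push_cast
    have : (0 : ℝ) < (m : ℝ) + 1 := by positivity
    nlinarith [(hG1 ω).2]
  have hs (m i : ℕ) (hi : i < m + 1) : (i : ℝ) / ((m : ℝ) + 1) ∈ Ico (0 : ℝ) 1 := by
    refine ⟨by positivity, ?_⟩
    rw [div_lt_one (by positivity)]
    exact_mod_cast hi
  have hamem (m : ℕ) (ω : Ω) : a m ω ∈ Ico (0 : ℝ) 1 := hs m _ (hjlt m ω)
  have halim (ω : Ω) : Tendsto (fun m => a m ω) atTop (𝓝 (G ω)) := by
    have h1 := (tendsto_nat_floor_mul_div_atTop (hG1 ω).1).comp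
      (tendsto_atTop_add_const_right atTop (1 : ℝ) tendsto_natCast_atTop_atTop)
    refine h1.congr fun m => ?_
    simp only [Function.comp_apply, ha, hj, mul_comm]
  have hmeas (s : ℝ) (hs : s ∈ Ico (0 : ℝ) 1) : Measurable fun ω => pgfComp Q 0 k ω s := by
    simp only [pgfComp_zero_eq hfrac k _ hs]
    have h1 := (measurable_pathSum k).comp (measurable_envPath hQ)
    have h2 := (measurable_potential 0 k).comp (measurable_envPath hQ)
    exact measurable_const.sub (measurable_const.div
      ((((Real.measurable_exp.comp h1.neg)).div_const _).add h2))
  have hdecomp (F : ℝ → Ω → ℝ) (m : ℕ) (ω : Ω) : F (a m ω) ω =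
      ∑ i ∈ Finset.range (m + 1), (j m ⁻¹' {i}).indicator (F ((i : ℝ) / ((m : ℝ) + 1))) ω := by
    rw [Finset.sum_eq_single_of_mem (j m ω) (Finset.mem_range.2 (hjlt m ω))]
    · rw [indicator_of_mem (by simp)]
    · intro i _ hi
      exact indicator_of_notMem (by simpa using hi.symm) _
  have h_intble (F : ℝ → Ω → ℝ) (m : ℕ)
      (hF : ∀ i, i < m + 1 → Integrable (F ((i : ℝ) / ((m : ℝ) + 1))) μ) :
      ∫ ω, F (a m ω) ω ∂μ =
        ∑ i ∈ Finset.range (m + 1), ∫ ω in j m ⁻¹' {i}, F ((i : ℝ) / ((m : ℝ) + 1)) ω ∂μ := by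
    simp only [hdecomp F m]
    rw [integral_finsetSum _ fun i hi => (hF i (Finset.mem_range.1 hi)).indicator
      (hjm' m (measurableSet_singleton i))]
    exact Finset.sum_congr rfl fun i _ => integral_indicator (hjm' m (measurableSet_singleton i))
  have hstep (m : ℕ) : ∫ ω, a m ω ^ Z k ω ∂μ = ∫ ω, pgfComp Q 0 k ω (a m ω) ∂μ := by
    rw [h_intble (fun s ω => s ^ Z k ω) m fun i hi => integrable_pow_of_mem_Icc measurable_const
      (fun _ => Ico_subset_Icc_self (hs m i hi)) hZm,
      h_intble (fun s ω => pgfComp Q 0 k ω s) m fun i hi => ?_]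
    · refine Finset.sum_congr rfl fun i hi => ?_
      have h1 := hs m i (Finset.mem_range.1 hi)
      exact setIntegral_pow_eq hQ hbranch k h1.1 h1.2.le (hjm m (measurableSet_singleton i))
    · refine Integrable.of_bound (hmeas _ (hs m i hi)).aestronglyMeasurable 1
        (ae_of_all _ fun ω => ?_)
      have h1 := pgfComp_mem_Ico hfrac (Nat.zero_le k) ω (hs m i hi)
      rw [Real.norm_of_nonneg h1.1]
      exact h1.2.le
  have ham (m : ℕ) : Measurable (a m) := (measurable_from_top.comp (hjm' m)).div_const _
  have hL : Tendsto (fun m => ∫ ω, a m ω ^ Z k ω ∂μ) atTop (𝓝 (∫ ω, G ω ^ Z k ω ∂μ)) := by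
    refine tendsto_integral_of_dominated_convergence (fun _ => 1)
      (fun m => ((ham m).pow hZm).aestronglyMeasurable) (integrable_const _)
      (fun m => ae_of_all _ fun ω => ?_) (ae_of_all _ fun ω => (halim ω).pow _)
    rw [Real.norm_of_nonneg (pow_nonneg (hamem m ω).1 _)]
    exact pow_le_one₀ (hamem m ω).1 (hamem m ω).2.le
  have hR : Tendsto (fun m => ∫ ω, pgfComp Q 0 k ω (a m ω) ∂μ) atTop
      (𝓝 (∫ ω, pgfComp Q 0 k ω (G ω) ∂μ)) := by
    refine tendsto_integral_of_dominated_convergence (fun _ => 1)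
      (fun m => ?_) (integrable_const _)
      (fun m => ae_of_all _ fun ω => ?_) (ae_of_all _ fun ω => ?_)
    · simp only [fun ω => pgfComp_zero_eq hfrac k ω (hamem m ω)]
      have h1 := (measurable_pathSum k).comp (measurable_envPath hQ)
      have h2 := (measurable_potential 0 k).comp (measurable_envPath hQ)
      exact (measurable_const.sub (measurable_const.div
        (((Real.measurable_exp.comp h1.neg).div (measurable_const.sub (ham m))).add
          h2))).aestronglyMeasurable
    · have h1 := pgfComp_mem_Ico hfrac (Nat.zero_le k) ω (hamem m ω)
      rw [Real.norm_of_nonneg h1.1]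
      exact h1.2.le
    · simp only [pgfComp_zero_eq hfrac k ω (hG1 ω), fun m => pgfComp_zero_eq hfrac k ω (hamem m ω)]
      have h1 : 0 < 1 - G ω := by linarith [(hG1 ω).2]
      have h2 := potential_envPath_nonneg (Q := Q) 0 k ω
      have h3 := Real.exp_pos (-pathSum k (envPath Q ω))
      exact tendsto_const_nhds.sub (tendsto_const_nhds.div ((tendsto_const_nhds.div
        (tendsto_const_nhds.sub (halim ω)) h1.ne').add tendsto_const_nhds) (by positivity))
  simp only [hstep] at hL
  exact tendsto_nhds_unique hL hR

lemma integral_pow_mul_zero_pow (hQ : ∀ i, Measurable (Q i)) (hbranch : BranchingProperty μ Q Z)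
    {k n : ℕ} (hkn : k ≤ n) {G : Ω → ℝ} (hG : Measurable[envSigma Q] G)
    (hG1 : ∀ ω, G ω ∈ Icc (0 : ℝ) 1) :
    ∫ ω, G ω ^ Z k ω * 0 ^ Z n ω ∂μ = ∫ ω, (G ω * pgfComp Q k n ω 0) ^ Z k ω ∂μ := by
  obtain ⟨-, hZm, -, hZ⟩ := hbranch
  have hle := sup_comap_le (Z := Z) hQ (hZm k)
  have hG' : Measurable G := hG.mono (envSigma_le hQ) le_rfl
  have hGm : StronglyMeasurable[envSigma Q ⊔ MeasurableSpace.comap (Z k) inferInstance]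
      fun ω => G ω ^ Z k ω :=
    ((hG.mono le_sup_left le_rfl).pow
      ((comap_measurable (Z k)).mono le_sup_right le_rfl)).stronglyMeasurable
  have hI2 : Integrable (fun ω => (0 : ℝ) ^ Z n ω) μ :=
    integrable_pow_of_mem_Icc measurable_const (fun _ => ⟨le_rfl, zero_le_one⟩) (hZm n)
  have hI1 : Integrable ((fun ω => G ω ^ Z k ω) * fun ω => (0 : ℝ) ^ Z n ω) μ := by
    refine Integrable.bdd_mul (c := 1) hI2 (hG'.pow (hZm k)).aestronglyMeasurable
      (ae_of_all _ fun ω => ?_)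
    rw [Real.norm_of_nonneg (pow_nonneg (hG1 ω).1 _)]
    exact pow_le_one₀ (hG1 ω).1 (hG1 ω).2
  have h1 := condExp_mul_of_stronglyMeasurable_left hGm hI1 hI2
  calc ∫ ω, G ω ^ Z k ω * 0 ^ Z n ω ∂μ = _ := (integral_condExp hle).symm
    _ = _ := by
      refine integral_congr_ae ?_
      filter_upwards [h1, hZ k n hkn 0 le_rfl zero_le_one] with ω hω1 hω2
      refine hω1.trans ?_
      rw [Pi.mul_apply, hω2, mul_pow]

/-- The Laplace transform of `Z k * exp (-S k)` on the event of extinction at time `n + 1`. -/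
theorem setIntegral_exp_extinct (hiid : IIDseq μ Q) [IsProbabilityMeasure (envLaw μ Q)]
    (hfrac : FracLinear Q) (hbranch : BranchingProperty μ Q Z) {k n : ℕ} (hkn : k ≤ n) {lam : ℝ}
    (hlam : 0 ≤ lam) :
    ∫ ω in {ω | extinctTime Z ω = n + 1},
        Real.exp (-(lam * ((Z k ω : ℝ) * Real.exp (-(Senv Q k ω))))) ∂μ =
      ∫ ω, tiltWeight lam k n ω ∂(pathLaw (envLaw μ Q)) := by
  have hQ := hiid.1
  have hZm := hbranch.2.1
  set e : Ω → ℝ := fun ω => Real.exp (-(lam * Real.exp (-pathSum k (envPath Q ω)))) with he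
  have hem : Measurable[envSigma Q] e := by
    have h1 : Measurable fun x : ℕ → ℝ × ℝ => Real.exp (-(lam * Real.exp (-pathSum k x))) := by
      have := measurable_pathSum k
      fun_prop
    exact h1.comp measurable_envSigma_envPath
  have he1 (ω : Ω) : e ω ∈ Icc (0 : ℝ) 1 :=
    ⟨(Real.exp_pos _).le, Real.exp_le_one_iff.2 (by
      have := mul_nonneg hlam (Real.exp_pos (-pathSum k (envPath Q ω))).le
      linarith)⟩
  have hem' : Measurable e := hem.mono (envSigma_le hQ) le_rfl
  set D : ℕ → Ω → ℝ := fun N ω =>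
    1 - 1 / (Real.exp (-pathSum k (envPath Q ω)) / (1 - e ω * (1 -
      Real.exp (-pathSum k (envPath Q ω)) / (Real.exp (-pathSum N (envPath Q ω)) +
        potential k N (envPath Q ω)))) + potential 0 k (envPath Q ω)) with hD
  have h0mem : (0 : ℝ) ∈ Ico (0 : ℝ) 1 := ⟨le_rfl, one_pos⟩
  have hq (N : ℕ) (hN : k ≤ N) (ω : Ω) : pgfComp Q k N ω 0 = 1 -
      Real.exp (-pathSum k (envPath Q ω)) / (Real.exp (-pathSum N (envPath Q ω)) +
        potential k N (envPath Q ω)) := by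
    rw [pgfComp_eq hfrac hN ω h0mem, sub_zero, div_one]
  have hGmem (N : ℕ) (hN : k ≤ N) (ω : Ω) : e ω * pgfComp Q k N ω 0 ∈ Ico (0 : ℝ) 1 := by
    have h1 := pgfComp_mem_Ico hfrac hN ω h0mem
    exact ⟨mul_nonneg (he1 ω).1 h1.1, (mul_le_of_le_one_left h1.1 (he1 ω).2).trans_lt h1.2⟩
  have hqm (N : ℕ) (hN : k ≤ N) : Measurable[envSigma Q] fun ω => pgfComp Q k N ω 0 := by
    simp only [hq N hN]
    have h1 : Measurable fun x : ℕ → ℝ × ℝ => 1 -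
        Real.exp (-pathSum k x) / (Real.exp (-pathSum N x) + potential k N x) := by
      have := measurable_pathSum k
      have := measurable_pathSum N
      have := measurable_potential k N
      fun_prop
    exact h1.comp measurable_envSigma_envPath
  have hmain (N : ℕ) (hN : k ≤ N) : ∫ ω, e ω ^ Z k ω * 0 ^ Z N ω ∂μ = ∫ ω, D N ω ∂μ := by
    rw [integral_pow_mul_zero_pow hQ hbranch hN hem he1,
      integral_pow_eq (G := fun ω => e ω * pgfComp Q k N ω 0) hQ hfrac hbranch k
        (hem.mul (hqm N hN)) (hGmem N hN)]
    refine integral_congr_ae (ae_of_all _ fun ω => ?_)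
    simp only [hD]
    rw [pgfComp_zero_eq hfrac k ω (hGmem N hN ω), hq N hN ω]
  have hDint (N : ℕ) (hN : k ≤ N) : Integrable (D N) μ := by
    have h2 (ω : Ω) : D N ω = pgfComp Q 0 k ω (e ω * pgfComp Q k N ω 0) := by
      rw [pgfComp_zero_eq hfrac k ω (hGmem N hN ω), hq N hN ω]
    have h1 : Measurable (D N) := by
      have h3 := (measurable_pathSum k).comp (measurable_envPath hQ)
      have h4 := (measurable_pathSum N).comp (measurable_envPath hQ)
      have h5 := (measurable_potential k N).comp (measurable_envPath hQ)
      have h6 := (measurable_potential 0 k).comp (measurable_envPath hQ)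
      simp only [Function.comp_def] at h3 h4 h5 h6
      fun_prop
    refine Integrable.of_bound h1.aestronglyMeasurable 1 (ae_of_all _ fun ω => ?_)
    rw [h2]
    have h3 := pgfComp_mem_Ico hfrac (Nat.zero_le k) ω (hGmem N hN ω)
    rw [Real.norm_of_nonneg h3.1]
    exact h3.2.le
  have hEint (N : ℕ) : Integrable (fun ω => e ω ^ Z k ω * 0 ^ Z N ω) μ := by
    refine Integrable.bdd_mul (c := 1) (integrable_pow_of_mem_Icc measurable_const
      (fun _ => ⟨le_rfl, zero_le_one⟩) (hZm N)) (hem'.pow (hZm k)).aestronglyMeasurable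
      (ae_of_all _ fun ω => ?_)
    rw [Real.norm_of_nonneg (pow_nonneg (he1 ω).1 _)]
    exact pow_le_one₀ (he1 ω).1 (he1 ω).2
  have hLHS : ∫ ω in {ω | extinctTime Z ω = n + 1},
        Real.exp (-(lam * ((Z k ω : ℝ) * Real.exp (-(Senv Q k ω))))) ∂μ =
      ∫ ω, (e ω ^ Z k ω * 0 ^ Z (n + 1) ω - e ω ^ Z k ω * 0 ^ Z n ω) ∂μ := by
    rw [← integral_indicator (measurableSet_extinctTime hbranch n)]
    refine integral_congr_ae (ae_of_all _ fun ω => ?_)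
    have hexp : Real.exp (-(lam * ((Z k ω : ℝ) * Real.exp (-(Senv Q k ω))))) = e ω ^ Z k ω := by
      rw [he, ← Real.exp_nat_mul, pathSum_envPath]
      congr 1
      ring
    by_cases h : extinctTime Z ω = n + 1
    · obtain ⟨h1, h2⟩ := (extinctTime_eq_succ_iff hbranch.2.2.1 n ω).1 h
      rw [indicator_of_mem (show ω ∈ {ω | extinctTime Z ω = n + 1} from h), hexp]
      simp only [h1, zero_pow h2, pow_zero, mul_one, mul_zero, sub_zero]
    · rw [indicator_of_notMem (show ω ∉ {ω | extinctTime Z ω = n + 1} from h)]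
      rw [extinctTime_eq_succ_iff hbranch.2.2.1, not_and_not_right] at h
      by_cases h0 : Z n ω = 0
      · simp only [h0, hbranch.2.2.1 n ω h0, sub_self]
      · simp only [zero_pow h0, zero_pow fun h1 => h0 (h h1), sub_self]
  rw [hLHS, integral_sub (hEint _) (hEint _), hmain _ (by omega), hmain _ hkn,
    ← integral_sub (hDint _ (by omega)) (hDint _ hkn), ← map_envPath hiid,
    integral_map (measurable_envPath hQ).aemeasurable
      (measurable_tiltWeight lam k n).aestronglyMeasurable]
  refine integral_congr_ae (ae_of_all _ fun ω => ?_)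
  have hbase (N : ℕ) (hN : k ≤ N) : Real.exp (-pathSum k (envPath Q ω)) ≤
      Real.exp (-pathSum N (envPath Q ω)) + potential k N (envPath Q ω) := by
    have h1 := pgfComp_mem_Ico hfrac hN ω h0mem
    rw [hq N hN ω] at h1
    have h2 : 0 < Real.exp (-pathSum N (envPath Q ω)) + potential k N (envPath Q ω) := by
      have := potential_envPath_nonneg (Q := Q) k N ω
      positivity
    exact (div_le_one h2).1 (by linarith [h1.1])
  have hw : Real.exp (-pathSum (n + 1) (envPath Q ω)) + potential k (n + 1) (envPath Q ω) =
      Real.exp (-pathSum n (envPath Q ω)) + potential k n (envPath Q ω) +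
        lastIncr n (envPath Q ω) := by
    rw [potential_succ hkn, pathSum_succ, neg_add, Real.exp_add, lastIncr]
    ring
  have h1 := hbase (n + 1) (by omega)
  rw [hw] at h1
  simp only [hD, hw, tiltWeight]
  exact inv_sub_inv_eq_tilt hlam (Real.exp_pos _) (potential_envPath_nonneg 0 k ω)
    (hbase n hkn) h1

end Laplace

section WeakLimit

/-- Convergence of moments implies weak convergence of probability measures on the unit interval
along some limit. -/
lemma exists_tendsto_of_tendsto_moments (κ : ℕ → ProbabilityMeasure unitInterval) {L : ℕ → ℝ}
    (h : ∀ j, Tendsto (fun n => ∫ u, (u : ℝ) ^ j ∂(κ n : Measure unitInterval)) atTop (𝓝 (L j))) :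
    ∃ κ' : ProbabilityMeasure unitInterval, Tendsto κ atTop (𝓝 κ') := by
  obtain ⟨κ', hκ'⟩ : ∃ κ', MapClusterPt κ' atTop κ :=
    exists_clusterPt_of_compactSpace (map κ atTop)
  refine ⟨κ', ProbabilityMeasure.tendsto_iff_forall_integral_tendsto.2 fun f => ?_⟩
  have h_intble (g : C(unitInterval, ℝ)) (P : ProbabilityMeasure unitInterval) :
      Integrable g (P : Measure unitInterval) :=
    (BoundedContinuousFunction.mkOfCompact g).integrable _
  have hmom (j : ℕ) : ∫ u, (u : ℝ) ^ j ∂(κ' : Measure unitInterval) = L j := by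
    have hc := (ProbabilityMeasure.continuous_integral_boundedContinuousFunction
      (BoundedContinuousFunction.mkOfCompact
        (⟨fun u : unitInterval => (u : ℝ) ^ j, by fun_prop⟩ : C(unitInterval, ℝ)))).continuousAt
        (x := κ')
    have hcl := hκ'.continuousAt_comp hc
    exact eq_of_nhds_neBot (ClusterPt.mono hcl (h j))
  have hpoly (p : Polynomial ℝ) :
      Tendsto (fun n => ∫ u, p.eval (u : ℝ) ∂(κ n : Measure unitInterval)) atTop
        (𝓝 (∫ u, p.eval (u : ℝ) ∂(κ' : Measure unitInterval))) := by
    have h1 (P : ProbabilityMeasure unitInterval) :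
        ∫ u, p.eval (u : ℝ) ∂(P : Measure unitInterval) =
          ∑ j ∈ Finset.range (p.natDegree + 1), p.coeff j *
            ∫ u, (u : ℝ) ^ j ∂(P : Measure unitInterval) := by
      simp only [Polynomial.eval_eq_sum_range]
      rw [integral_finsetSum _ fun j _ => h_intble ⟨fun u : unitInterval => p.coeff j * (u : ℝ) ^ j,
        by fun_prop⟩ P]
      exact Finset.sum_congr rfl fun j _ => integral_const_mul _ _
    simp only [h1, hmom]
    exact tendsto_finsetSum _ fun j _ => (h j).const_mul _
  rw [Metric.tendsto_atTop]
  intro ε hε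
  obtain ⟨p, hp⟩ := exists_polynomial_near_continuousMap 0 1 f.toContinuousMap (ε / 3)
    (by positivity)
  have hclose (P : ProbabilityMeasure unitInterval) :
      |∫ u, f u ∂(P : Measure unitInterval) - ∫ u, p.eval (u : ℝ) ∂(P : Measure unitInterval)|
        ≤ ε / 3 := by
    have hpi : Integrable (fun u : unitInterval => p.eval (u : ℝ)) (P : Measure unitInterval) :=
      h_intble ⟨fun u : unitInterval => p.eval (u : ℝ), by fun_prop⟩ P
    rw [← integral_sub (f.integrable _) hpi, ← Real.norm_eq_abs]
    refine (norm_integral_le_of_norm_le (integrable_const (ε / 3))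
      (ae_of_all _ fun u => ?_)).trans (by simp)
    rw [norm_sub_rev]
    exact ((p.toContinuousMapOn (Icc 0 1) - f.toContinuousMap).norm_coe_le_norm u).trans hp.le
  obtain ⟨N, hN⟩ := Metric.tendsto_atTop.1 (hpoly p) (ε / 3) (by positivity)
  refine ⟨N, fun n hn => ?_⟩
  have h1 := abs_le.1 (hclose (κ n))
  have h2 := abs_le.1 (hclose κ')
  have h3 := abs_lt.1 (hN n hn)
  rw [Real.dist_eq, abs_lt]
  constructor <;> linarith [h1.1, h1.2, h2.1, h2.2, h3.1, h3.2]

lemma ae_mem_Ioo_of_tendsto_rpow (κ : Measure unitInterval) [IsProbabilityMeasure κ]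
    (h0 : Tendsto (fun lam : ℝ => ∫ u, (u : ℝ) ^ lam ∂κ) (𝓝[>] 0) (𝓝 1))
    (h1 : Tendsto (fun lam : ℝ => ∫ u, (u : ℝ) ^ lam ∂κ) atTop (𝓝 0)) :
    ∀ᵐ u : unitInterval ∂κ, 0 < (u : ℝ) ∧ (u : ℝ) < 1 := by
  have hmeas (lam : ℝ) : AEStronglyMeasurable (fun u : unitInterval => (u : ℝ) ^ lam) κ := by
    have : Measurable fun u : unitInterval => (u : ℝ) ^ lam := by fun_prop
    exact this.aestronglyMeasurable
  have hbound {lam : ℝ} (hlam : 0 < lam) : ∀ᵐ u ∂κ, ‖((u : unitInterval) : ℝ) ^ lam‖ ≤ 1 := by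
    refine ae_of_all _ fun u => ?_
    rw [Real.norm_of_nonneg (Real.rpow_nonneg u.2.1 _)]
    exact Real.rpow_le_one u.2.1 u.2.2 hlam.le
  have hm0 : MeasurableSet {u : unitInterval | 0 < (u : ℝ)} :=
    measurableSet_lt measurable_const measurable_subtype_coe
  have hm1 : MeasurableSet {u : unitInterval | (u : ℝ) = 1} :=
    measurableSet_eq_fun measurable_subtype_coe measurable_const
  have hlim0 : Tendsto (fun lam : ℝ => ∫ u, (u : ℝ) ^ lam ∂κ) (𝓝[>] 0)
      (𝓝 (∫ u, {u : unitInterval | 0 < (u : ℝ)}.indicator 1 u ∂κ)) := by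
    refine tendsto_integral_filter_of_dominated_convergence (fun _ => 1)
      (Eventually.of_forall hmeas) (eventually_mem_nhdsWithin.mono fun lam => hbound)
      (integrable_const _) (ae_of_all _ fun u => ?_)
    by_cases hu : 0 < (u : ℝ)
    · rw [indicator_of_mem (show u ∈ {u : unitInterval | 0 < (u : ℝ)} from hu), Pi.one_apply,
        ← Real.rpow_zero (u : ℝ)]
      exact ((Real.continuous_const_rpow hu.ne').tendsto 0).mono_left nhdsWithin_le_nhds
    · rw [indicator_of_notMem (show u ∉ {u : unitInterval | 0 < (u : ℝ)} from hu)]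
      have hu0 : (u : ℝ) = 0 := le_antisymm (not_lt.1 hu) u.2.1
      refine tendsto_const_nhds.congr' (eventually_mem_nhdsWithin.mono fun lam hlam => ?_)
      simp only [hu0, Real.zero_rpow (ne_of_gt hlam)]
  have hlim1 : Tendsto (fun lam : ℝ => ∫ u, (u : ℝ) ^ lam ∂κ) atTop
      (𝓝 (∫ u, {u : unitInterval | (u : ℝ) = 1}.indicator 1 u ∂κ)) := by
    refine tendsto_integral_filter_of_dominated_convergence (fun _ => 1)
      (Eventually.of_forall hmeas) ((eventually_gt_atTop 0).mono fun lam => hbound)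
      (integrable_const _) (ae_of_all _ fun u => ?_)
    by_cases hu : (u : ℝ) = 1
    · rw [indicator_of_mem (show u ∈ {u : unitInterval | (u : ℝ) = 1} from hu), Pi.one_apply]
      simp only [hu, Real.one_rpow]
      exact tendsto_const_nhds
    · rw [indicator_of_notMem (show u ∉ {u : unitInterval | (u : ℝ) = 1} from hu)]
      exact tendsto_rpow_atTop_of_base_lt_one _ (by linarith [u.2.1])
        (lt_of_le_of_ne u.2.2 hu)
  have e0 := tendsto_nhds_unique hlim0 h0
  have e1 := tendsto_nhds_unique hlim1 h1
  rw [integral_indicator_one hm0] at e0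
  rw [integral_indicator_one hm1] at e1
  have a0 : ∀ᵐ u ∂κ, u ∈ {u : unitInterval | 0 < (u : ℝ)} := by
    refine (prob_compl_eq_zero_iff hm0).2 ?_
    rwa [measureReal_def, ENNReal.toReal_eq_one_iff] at e0
  have a1 : ∀ᵐ u ∂κ, u ∉ {u : unitInterval | (u : ℝ) = 1} :=
    measure_eq_zero_iff_ae_notMem.1 ((measureReal_eq_zero_iff).1 e1)
  filter_upwards [a0, a1] with u hu0 hu1
  exact ⟨hu0, lt_of_le_of_ne u.2.2 hu1⟩

/-- If the Laplace transforms of nonnegative random variables converge to a function which tends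
to `1` at `0` and to `0` at infinity, then the variables converge in law to a positive limit. -/
theorem exists_weakLimit_of_laplace {Ω : Type*} [MeasurableSpace Ω] (P : ℕ → Measure Ω)
    [hP : ∀ n, IsProbabilityMeasure (P n)] {Y : ℕ → Ω → ℝ} (hY : ∀ n, Measurable (Y n))
    (hY0 : ∀ n ω, 0 ≤ Y n ω) {L : ℝ → ℝ}
    (hL : ∀ lam, 0 ≤ lam → Tendsto (fun n => ∫ ω, Real.exp (-(lam * Y n ω)) ∂(P n)) atTop
      (𝓝 (L lam)))
    (hL0 : Tendsto L (𝓝[>] 0) (𝓝 1)) (hL1 : Tendsto L atTop (𝓝 0)) :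
    ∃ ν : Measure ℝ, IsProbabilityMeasure ν ∧ ν (Ioi 0) = 1 ∧
      ∀ g : BoundedContinuousFunction ℝ ℝ,
        Tendsto (fun n => ∫ ω, g (Y n ω) ∂(P n)) atTop (𝓝 (∫ x, g x ∂ν)) := by
  set U : ℕ → Ω → unitInterval := fun n ω =>
    ⟨Real.exp (-Y n ω), (Real.exp_pos _).le, Real.exp_le_one_iff.2 (by linarith [hY0 n ω])⟩ with hU
  have hUm (n : ℕ) : Measurable (U n) := (Real.measurable_exp.comp (hY n).neg).subtype_mk
  set κ : ℕ → ProbabilityMeasure unitInterval := fun n =>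
    ⟨(P n).map (U n), Measure.isProbabilityMeasure_map (hUm n).aemeasurable⟩ with hκ
  have hκint (f : unitInterval → ℝ) (hf : Measurable f) (n : ℕ) :
      ∫ u, f u ∂(κ n : Measure unitInterval) = ∫ ω, f (U n ω) ∂(P n) :=
    integral_map (hUm n).aemeasurable hf.aestronglyMeasurable
  obtain ⟨κ', hκ'⟩ := exists_tendsto_of_tendsto_moments κ (L := fun j => L j) fun j => by
    refine (hL j j.cast_nonneg).congr fun n => ?_
    rw [hκint (fun u => (u : ℝ) ^ j) (by fun_prop) n]
    refine integral_congr_ae (ae_of_all _ fun ω => ?_)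
    simp only [hU]
    rw [← Real.exp_nat_mul]
    congr 1
    ring
  have hrpow (lam : ℝ) (hlam : 0 < lam) :
      ∫ u, (u : ℝ) ^ lam ∂(κ' : Measure unitInterval) = L lam := by
    have hc : Continuous fun u : unitInterval => (u : ℝ) ^ lam :=
      continuous_subtype_val.rpow_const fun _ => Or.inr hlam.le
    have h1 := ProbabilityMeasure.tendsto_iff_forall_integral_tendsto.1 hκ'
      (BoundedContinuousFunction.mkOfCompact ⟨_, hc⟩)
    refine tendsto_nhds_unique h1 ((hL lam hlam.le).congr fun n => ?_)
    refine Eq.trans ?_ (hκint _ hc.measurable n).symm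
    refine integral_congr_ae (ae_of_all _ fun ω => ?_)
    simp only [hU]
    rw [← Real.exp_mul]
    congr 1
    ring
  have hae := ae_mem_Ioo_of_tendsto_rpow (κ' : Measure unitInterval)
    (hL0.congr' (eventually_mem_nhdsWithin.mono fun lam hlam => (hrpow lam hlam).symm))
    (hL1.congr' ((eventually_gt_atTop 0).mono fun lam hlam => (hrpow lam hlam).symm))
  have hlog : Measurable fun u : unitInterval => -Real.log (u : ℝ) := by fun_prop
  set ν : ProbabilityMeasure ℝ := ⟨(κ' : Measure unitInterval).map fun u : unitInterval => -Real.log (u : ℝ),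
    Measure.isProbabilityMeasure_map hlog.aemeasurable⟩ with hν
  set ρ : ℕ → ProbabilityMeasure ℝ := fun n =>
    ⟨(P n).map (Y n), Measure.isProbabilityMeasure_map (hY n).aemeasurable⟩ with hρ
  have hρν : Tendsto ρ atTop (𝓝 ν) := by
    refine tendsto_of_forall_isOpen_le_liminf_nat' fun G hG => ?_
    have hopen : IsOpen {u : unitInterval | 0 < (u : ℝ) ∧ -Real.log (u : ℝ) ∈ G} := by
      have hc : ContinuousOn (fun u : unitInterval => -Real.log (u : ℝ))
          {u : unitInterval | 0 < (u : ℝ)} :=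
        (continuous_subtype_val.continuousOn.log fun u hu => ne_of_gt hu).neg
      exact hc.isOpen_inter_preimage (isOpen_lt continuous_const continuous_subtype_val) hG
    have h1 := ProbabilityMeasure.le_liminf_measure_open_of_tendsto hκ' hopen
    have h2 : (ν : Measure ℝ) G =
        (κ' : Measure unitInterval) {u | 0 < (u : ℝ) ∧ -Real.log (u : ℝ) ∈ G} := by
      refine (Measure.map_apply hlog hG.measurableSet).trans (measure_congr ?_)
      filter_upwards [hae] with u hu
      exact propext ⟨fun h => ⟨hu.1, h⟩, fun h => h.2⟩
    have h3 (n : ℕ) : (ρ n : Measure ℝ) G =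
        (κ n : Measure unitInterval) {u | 0 < (u : ℝ) ∧ -Real.log (u : ℝ) ∈ G} := by
      refine (Measure.map_apply (hY n) hG.measurableSet).trans
        (Eq.trans (congrArg (P n) ?_) (Measure.map_apply (hUm n) hopen.measurableSet).symm)
      ext ω
      have hiff : -Real.log (U n ω : ℝ) = Y n ω := by simp only [hU, Real.log_exp, neg_neg]
      change Y n ω ∈ G ↔ 0 < (U n ω : ℝ) ∧ -Real.log (U n ω : ℝ) ∈ G
      rw [hiff]
      exact (and_iff_right (Real.exp_pos _)).symm
    rw [h2]
    exact h1.trans_eq (congrArg (liminf · atTop) (funext fun n => (h3 n).symm))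
  refine ⟨ν, inferInstance, ?_, fun g => ?_⟩
  · refine (Measure.map_apply hlog measurableSet_Ioi).trans
      ((prob_compl_eq_zero_iff (hlog measurableSet_Ioi)).1 ?_)
    filter_upwards [hae] with u hu
    exact neg_pos.2 (Real.log_neg hu.1 hu.2)
  · have := ProbabilityMeasure.tendsto_iff_forall_integral_tendsto.1 hρν g
    refine this.congr fun n => ?_
    exact integral_map (hY n).aemeasurable g.continuous.measurable.aestronglyMeasurable

/-- The Laplace transform of a positive random variable vanishes at infinity. -/
lemma tendsto_laplace_atTop (ν : Measure ℝ) [IsProbabilityMeasure ν] (h : ∀ᵐ x ∂ν, 0 < x) :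
    Tendsto (fun lam : ℝ => ∫ x, Real.exp (-lam * x) ∂ν) atTop (𝓝 0) := by
  rw [← integral_zero ℝ ℝ (μ := ν)]
  refine tendsto_integral_filter_of_dominated_convergence (fun _ => 1)
    (Eventually.of_forall fun lam => by fun_prop) ((eventually_ge_atTop 0).mono fun lam hlam => ?_)
    (integrable_const _) ?_
  · filter_upwards [h] with x hx
    rw [Real.norm_of_nonneg (Real.exp_pos _).le]
    exact Real.exp_le_one_iff.2 (by have := mul_nonneg hlam hx.le; linarith)
  · filter_upwards [h] with x hx
    refine Real.tendsto_exp_atBot.comp ?_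
    exact tendsto_neg_atTop_atBot.atBot_mul_const hx

/-- The Laplace transform of a positive random variable tends to `1` at the origin. -/
lemma tendsto_laplace_nhdsGT (ν : Measure ℝ) [IsProbabilityMeasure ν] (h : ∀ᵐ x ∂ν, 0 < x) :
    Tendsto (fun lam : ℝ => ∫ x, Real.exp (-lam * x) ∂ν) (𝓝[>] 0) (𝓝 1) := by
  have h1 : ∫ _, (1 : ℝ) ∂ν = 1 := by simp
  rw [← h1]
  refine tendsto_integral_filter_of_dominated_convergence (fun _ => 1)
    (Eventually.of_forall fun lam => by fun_prop) (eventually_mem_nhdsWithin.mono fun lam hlam => ?_)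
    (integrable_const _) (ae_of_all _ fun x => ?_)
  · filter_upwards [h] with x hx
    rw [Real.norm_of_nonneg (Real.exp_pos _).le]
    exact Real.exp_le_one_iff.2 (by have := mul_nonneg (le_of_lt hlam) hx.le; linarith)
  · have : Continuous fun lam : ℝ => Real.exp (-lam * x) := by fun_prop
    simpa using (this.tendsto 0).mono_left nhdsWithin_le_nhds

end WeakLimit

/-- **Lemma `onedim`.** Under A1–A3, for any fixed `t ∈ (0,1)`, the conditional law of
`Y_t^{(n)} = Z_{⌊nt⌋} e^{-S_{⌊nt⌋}}` given `T = n+1` converges weakly to the law of an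
a.s. strictly positive and finite random variable `W`; its Laplace transform
`H*(λ) = E e^{-λ W}` satisfies `H*(λ) → 0` as `λ → ∞` (no atom at zero) and
`H*(λ) → 1` as `λ ↓ 0` (no atom at infinity). -/
theorem statement19
    {Ω : Type*} [MeasurableSpace Ω] (μ : Measure Ω) [IsProbabilityMeasure μ]
    (Q : ℕ → Ω → Measure ℕ) (Z : ℕ → Ω → ℕ)
    (hQprob : ∀ n ω, IsProbabilityMeasure (Q n ω))
    (hiid : IIDseq μ Q) (hfrac : FracLinear Q)
    (hbranch : BranchingProperty μ Q Z)
    (hA1 : AssumptionA1 μ Q) (hA2 : AssumptionA2 μ Q) (hA3 : AssumptionA3 μ Q)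
    (t : ℝ) (ht0 : 0 < t) (ht1 : t < 1) :
    ∃ ν : Measure ℝ, IsProbabilityMeasure ν ∧ ν (Set.Ioi 0) = 1 ∧
      (∀ g : BoundedContinuousFunction ℝ ℝ,
        Tendsto (fun n : ℕ => ∫ ω, g ((Z ⌊(n : ℝ) * t⌋₊ ω : ℝ) *
            Real.exp (-(Senv Q ⌊(n : ℝ) * t⌋₊ ω))) ∂(μ[|{ω | extinctTime Z ω = n + 1}]))
          atTop (𝓝 (∫ x, g x ∂ν))) ∧
      Tendsto (fun lam : ℝ => ∫ x, Real.exp (-lam * x) ∂ν) atTop (𝓝 0) ∧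
      Tendsto (fun lam : ℝ => ∫ x, Real.exp (-lam * x) ∂ν) (𝓝[>] (0 : ℝ)) (𝓝 1) := by
  have hQ := hiid.1
  obtain ⟨χ, hA1⟩ := hA1
  have : IsProbabilityMeasure (envLaw μ Q) := isProbabilityMeasure_envLaw hQ
  set k : ℕ → ℕ := fun n => ⌊(n : ℝ) * t⌋₊ with hk
  set A : ℕ → Set Ω := fun n => {ω | extinctTime Z ω = n + 1} with hA
  set Y : ℕ → Ω → ℝ := fun n ω => (Z (k n) ω : ℝ) * Real.exp (-(Senv Q (k n) ω)) with hYdef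
  have hkn (n : ℕ) : k n ≤ n :=
    Nat.floor_le_of_le (mul_le_of_le_one_right n.cast_nonneg ht1.le)
  have hk1 : Tendsto k atTop atTop :=
    tendsto_nat_floor_atTop.comp (tendsto_natCast_atTop_atTop.atTop_mul_const ht0)
  have hk2 : Tendsto (fun n => n - k n) atTop atTop := by
    rw [← tendsto_natCast_atTop_iff (R := ℝ)]
    refine tendsto_atTop_mono (fun n => ?_)
      ((tendsto_natCast_atTop_atTop (R := ℝ)).atTop_mul_const (sub_pos.2 ht1))
    rw [Nat.cast_sub (hkn n)]
    have := Nat.floor_le (mul_nonneg n.cast_nonneg ht0.le : 0 ≤ (n : ℝ) * t)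
    linarith
  obtain ⟨c, hc, hc0, hcr, hcinf⟩ := exists_tiltWeight_limit (isCenteredStep_envLaw hQ hA2) hA1.1
    (by linarith [hA1.2.1]) (ae_mem_goodSet hiid hfrac hA1) hk1 hk2
  have hAm (n : ℕ) : MeasurableSet (A n) := measurableSet_extinctTime hbranch n
  have hY (n : ℕ) : Measurable (Y n) := by
    have h1 : Measurable (Senv Q (k n)) := by
      have : Senv Q (k n) = pathSum (k n) ∘ envPath Q := by
        ext ω; exact (pathSum_envPath _ ω).symm
      rw [this]
      exact (measurable_pathSum _).comp (measurable_envPath hQ)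
    exact (measurable_from_top.comp (hbranch.2.1 (k n))).mul (Real.measurable_exp.comp h1.neg)
  have hY0 (n : ℕ) (ω : Ω) : 0 ≤ Y n ω := by positivity
  have hlap (lam : ℝ) (hlam : 0 ≤ lam) (n : ℕ) :
      ∫ ω in A n, Real.exp (-(lam * Y n ω)) ∂μ =
        ∫ ω, tiltWeight lam (k n) n ω ∂(pathLaw (envLaw μ Q)) :=
    setIntegral_exp_extinct hiid hfrac hbranch (hkn n) hlam
  have hmass (n : ℕ) : μ.real (A n) = ∫ ω, tiltWeight 0 (k n) n ω ∂(pathLaw (envLaw μ Q)) := by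
    rw [← hlap 0 le_rfl n]
    simp
  have hlim (lam : ℝ) (hlam : 0 ≤ lam) :
      Tendsto (fun n => ∫ ω, Real.exp (-(lam * Y n ω)) ∂(μ[|A n])) atTop (𝓝 (c lam / c 0)) := by
    refine ((hc lam hlam).div (hc 0 le_rfl) hc0.ne').congr fun n => ?_
    rw [Pi.div_apply, div_div_div_cancel_right₀ (wt_pos n).ne', ← hmass, ← hlap lam hlam,
      ProbabilityTheory.cond,
      integral_smul_measure, ENNReal.toReal_inv, smul_eq_mul, div_eq_inv_mul]
    rfl
  obtain ⟨N, hN⟩ : ∃ N, ∀ n ≥ N, μ (A n) ≠ 0 := by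
    rw [← eventually_atTop]
    filter_upwards [(hc 0 le_rfl).eventually (lt_mem_nhds hc0)] with n hn h0
    rw [← hmass, measureReal_def, h0] at hn
    simp at hn
  have hprob (n : ℕ) : IsProbabilityMeasure (μ[|A (n + N)]) :=
    cond_isProbabilityMeasure (hN _ (by omega))
  have hdiv {l : Filter ℝ} {x : ℝ} (h : Tendsto c l (𝓝 x)) :
      Tendsto (fun lam => c lam / c 0) l (𝓝 (x / c 0)) := h.div_const _
  obtain ⟨ν, hν, hν1, hνg⟩ := exists_weakLimit_of_laplace (fun n => μ[|A (n + N)])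
    (fun n => hY (n + N)) (fun n => hY0 (n + N))
    (fun lam hlam => (hlim lam hlam).comp (tendsto_add_atTop_nat N))
    (by simpa only [div_self hc0.ne'] using hdiv hcr) (by simpa only [zero_div] using hdiv hcinf)
  have hpos : ∀ᵐ x ∂ν, 0 < x := (prob_compl_eq_zero_iff measurableSet_Ioi).2 hν1
  exact ⟨ν, hν, hν1, fun g => (tendsto_add_atTop_iff_nat N).1 (hνg g),
    tendsto_laplace_atTop ν hpos, tendsto_laplace_nhdsGT ν hpos⟩

end BPREpaper
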